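/- arXiv:1703.04515 — 4 statements merged into one kernel-verified Lean document; each statement's English description precedes it below -/
import Mathlib

section
/- Let n = 2 and choose the integers m_1, m_2 with m_1 = m_2 + 1, so that the generators c^0_{12} and c^1_{21} have degree 0. Then the cohomology H(I_2^K) is concentrated in degree 0, and there is a K-algebra isomorphism H(I_2^K) ≅ K[z, z^{−1}] with the Laurent polynomial algebra over K, sending the cohomology class of c^0_{12} to z. -/
/-!
The base-changed internal DG-algebra `I_n^K` of Ekholm–Ng, where all idempotents of
`k_n` are sent to `1 ∈ K`: the free associative `K`-algebra on the generators
`c^p_{ij}` with `c^0_{ij} = 0` for `i ≥ j`.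
-/

namespace InternalAlgebraK

inductive CGen (n : ℕ) : Type
  | c (p : ℕ) (i j : Fin n) : CGen n

open CGen

variable (K : Type) [Field K] (n : ℕ)

inductive Rel : FreeAlgebra K (CGen n) → FreeAlgebra K (CGen n) → Prop
  | czero (i j : Fin n) (h : ¬ i < j) : Rel (FreeAlgebra.ι K (c 0 i j)) 0

/-- The internal algebra `I_n^K`. -/
abbrev IAlgK := RingQuot (Rel K n)

def ι (g : CGen n) : IAlgK K n := RingQuot.mkAlgHom K (Rel K n) (FreeAlgebra.ι K g)

variable (m : Fin n → ℤ)

/-- `|c^p_{ij}| = 1 - 2p + m j - m i`. -/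
def dg : CGen n → ℤ
  | c p i j => 1 - 2 * (p : ℤ) + m j - m i

/-- The homogeneous component of degree `d`. -/
def Hgr (d : ℤ) : Submodule K (IAlgK K n) :=
  Submodule.span K
    { x | ∃ l : List (CGen n), (l.map (dg n m)).sum = d ∧ x = (l.map (ι K n)).prod }

def sgn (d : ℤ) : K := if Even d then 1 else -1

/-- The prescribed values of the differential on the generators (here `δ_{ij} = 1`
when `i = j`, since all idempotents are identified with `1`). -/
def Dval : CGen n → IAlgK K n
  | c 0 i j =>
      ∑ r : Fin n,
        if i < r ∧ r < j then
          sgn K (m r + m j) • (ι K n (c 0 r j) * ι K n (c 0 i r)) else 0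
  | c 1 i j =>
      (if i = j then 1 else 0)
      + ∑ r : Fin n,
          ((if i < r then sgn K (m r + m j) • (ι K n (c 1 r j) * ι K n (c 0 i r)) else 0)
            + (if r < j then sgn K (m r + m j) • (ι K n (c 0 r j) * ι K n (c 1 i r)) else 0))
  | c (p + 2) i j =>
      ∑ q ∈ Finset.range (p + 3), ∑ r : Fin n,
        sgn K (m r + m j) • (ι K n (c (p + 2 - q) r j) * ι K n (c q i r))

/-- The differential: `K`-linear, vanishing on constants, with the prescribed values on
generators, satisfying the graded Leibniz rule. -/
def IsDiff (D : IAlgK K n →ₗ[K] IAlgK K n) : Prop :=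
  (D 1 = 0) ∧
  (∀ g : CGen n, D (ι K n g) = Dval K n m g) ∧
  (∀ (d : ℤ) (a b : IAlgK K n), a ∈ Hgr K n m d →
    D (a * b) = D a * b + sgn K d • (a * D b))

/-- `u^k` for `k ≥ 0`, `v^{-k}` for `k < 0`: representatives of the powers of an
invertible cohomology class with representative `u` and inverse-representative `v`. -/
def zpRep (u v : IAlgK K n) (k : ℤ) : IAlgK K n :=
  if 0 ≤ k then u ^ k.toNat else v ^ (-k).toNat

end InternalAlgebraK

namespace InternalAlgebraK

open CGen Finset

section Linear

/-- Algebraic discrete Morse theory for an acyclic matching `μ` between the basis vectors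
indexed by `S` and those indexed by `μ '' S`: every cycle is homologous to a combination of the
critical basis vectors. -/
theorem exists_critical_add_boundary {K M W : Type*} [Field K] [AddCommGroup M] [Module K M]
    (D : M →ₗ[K] M) (hDD : ∀ x, D (D x) = 0) (e : W → M)
    (hspan : Submodule.span K (Set.range e) = ⊤) (S C : Set W) (μ : W → W) (hμ : S.InjOn μ)
    (rank : W → ℕ) (hclass : ∀ w, e w = 0 ∨ w ∈ C ∨ w ∈ S ∨ w ∈ μ '' S)
    (hlead : ∀ d ∈ S, ∃ a : K, a ≠ 0 ∧
      D (e d) - a • e (μ d) ∈ Submodule.span K (e '' {w | rank w < rank (μ d)}))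
    (hC : ∀ w ∈ C, D (e w) = 0) (φ : W → M →ₗ[K] K)
    (hφ : ∀ d ∈ S, φ (μ d) (e (μ d)) = 1) (hφ' : ∀ w w', w' ≠ w → φ w (e w') = 0)
    (x : M) (hx : D x = 0) :
    ∃ z ∈ Submodule.span K (e '' C), ∃ y, x = z + D y := by
  have hword : ∀ w, e w ∈
      Submodule.span K (e '' C) ⊔ Submodule.span K (e '' S) ⊔ LinearMap.range D := by
    intro w
    induction hr : rank w using Nat.strong_induction_on generalizing w with
    | _ r ih =>
      rcases hclass w with h | h | h | ⟨d, hd, rfl⟩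
      · simp [h]
      · exact Submodule.mem_sup_left (Submodule.mem_sup_left
          (Submodule.subset_span (Set.mem_image_of_mem _ h)))
      · exact Submodule.mem_sup_left (Submodule.mem_sup_right
          (Submodule.subset_span (Set.mem_image_of_mem _ h)))
      · obtain ⟨a, ha, h⟩ := hlead d hd
        have hlow := (Submodule.span_le.2 (by
          rintro _ ⟨w, hw, rfl⟩
          exact ih _ (hr ▸ hw) w rfl)) h
        have hsub := Submodule.sub_mem _
          (Submodule.mem_sup_right (LinearMap.mem_range_self D (e d))) hlow
        rw [sub_sub_cancel] at hsub
        exact (Submodule.smul_mem_iff _ ha).1 hsub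
  have htop : x ∈ Submodule.span K (e '' C) ⊔ Submodule.span K (e '' S) ⊔ LinearMap.range D := by
    have : (⊤ : Submodule K M) ≤ _ :=
      hspan ▸ Submodule.span_le.2 (Set.range_subset_iff.2 hword)
    exact this trivial
  obtain ⟨cs, hcs, _, ⟨y, rfl⟩, rfl⟩ := Submodule.mem_sup.1 htop
  obtain ⟨z, hz, s, hs, rfl⟩ := Submodule.mem_sup.1 hcs
  have hDz : D z = 0 := by
    have : Submodule.span K (e '' C) ≤ LinearMap.ker D :=
      Submodule.span_le.2 (by rintro _ ⟨w, hw, rfl⟩; exact hC w hw)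
    exact this hz
  have hDs : D s = 0 := by simpa [hDz, hDD] using hx
  suffices s = 0 from ⟨z, hz, y, by rw [this, add_zero]⟩
  obtain ⟨l, hl, rfl⟩ := (Finsupp.mem_span_image_iff_linearCombination K).1 hs
  suffices l = 0 by simp [this]
  by_contra hne
  obtain ⟨d₀, hd₀, hmax⟩ := Finset.exists_max_image l.support (fun d => rank (μ d))
    (Finsupp.support_nonempty_iff.2 hne)
  have hS : ∀ d ∈ l.support, d ∈ S := fun d hd => (Finsupp.mem_supported K l).1 hl hd
  classical
  have key : ∀ d ∈ l.support, ∃ a : K, a ≠ 0 ∧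
      φ (μ d₀) (D (e d)) = if d = d₀ then a else 0 := by
    intro d hd
    obtain ⟨a, ha, h⟩ := hlead d (hS d hd)
    refine ⟨a, ha, ?_⟩
    have hlow : φ (μ d₀) (D (e d) - a • e (μ d)) = 0 := by
      have : Submodule.span K (e '' {w | rank w < rank (μ d)}) ≤ LinearMap.ker (φ (μ d₀)) :=
        Submodule.span_le.2 (by
          rintro _ ⟨w, hw, rfl⟩
          refine hφ' _ _ ?_
          rintro rfl
          exact absurd (hmax d hd) (not_le.2 hw))
      exact this h
    rw [map_sub, sub_eq_zero, map_smul] at hlow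
    rw [hlow]
    split_ifs with h'
    · rw [h', hφ _ (hS _ hd₀), smul_eq_mul, mul_one]
    · rw [hφ' _ _ (fun h => h' (hμ (hS d hd) (hS d₀ hd₀) h)), smul_zero]
  have h0 : φ (μ d₀) (D (Finsupp.linearCombination K e l)) = 0 := by rw [hDs, map_zero]
  rw [Finsupp.linearCombination_apply, Finsupp.sum, map_sum, map_sum,
    Finset.sum_eq_single_of_mem d₀ hd₀] at h0
  · obtain ⟨a, ha, h⟩ := key d₀ hd₀
    rw [map_smul, map_smul, h, if_pos rfl, smul_eq_mul] at h0
    exact mul_ne_zero (Finsupp.mem_support_iff.1 hd₀) ha h0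
  · intro d hd hdd
    obtain ⟨a, -, h⟩ := key d hd
    rw [map_smul, map_smul, h, if_neg hdd, smul_zero]

theorem sum_antidiagonal_assoc {M : Type*} [AddCommMonoid M] (n : ℕ) (F : ℕ → ℕ → ℕ → M) :
    ∑ p ∈ antidiagonal n, ∑ q ∈ antidiagonal p.1, F q.1 q.2 p.2 =
      ∑ p ∈ antidiagonal n, ∑ q ∈ antidiagonal p.2, F p.1 q.1 q.2 := by
  simp only [Finset.sum_sigma']
  apply Finset.sum_nbij' (fun ⟨⟨_i, j⟩, ⟨k, l⟩⟩ ↦ ⟨(k, l + j), (l, j)⟩)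
    (fun ⟨⟨i, _j⟩, ⟨k, l⟩⟩ ↦ ⟨(i + k, l), (i, k)⟩) <;> simp +contextual [add_assoc]
  rintro ⟨⟨i, j⟩, k, l⟩ h1 h2
  simp_all only
  omega

end Linear

section General

variable (K : Type) [Field K]

theorem sgn_mul (a b : ℤ) : sgn K a * sgn K b = sgn K (a + b) := by
  unfold sgn
  by_cases ha : Even a <;> by_cases hb : Even b <;> simp [ha, hb, Int.even_add]

theorem sgn_add_one (a : ℤ) : sgn K (a + 1) = -sgn K a := by
  unfold sgn
  by_cases ha : Even a <;> simp [ha]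

theorem sgn_congr {a b : ℤ} (h : Even (a - b)) : sgn K a = sgn K b := by
  unfold sgn
  rw [Int.even_sub] at h
  simp [h]

theorem sgn_add_self (a : ℤ) : sgn K (a + a) = 1 := by simp [sgn]

theorem sgn_ne_zero (a : ℤ) : sgn K a ≠ 0 := by
  unfold sgn; split_ifs <;> simp

variable {n : ℕ}

theorem ι_zero_of_not_lt {i j : Fin n} (h : ¬ i < j) : ι K n (c 0 i j) = 0 := by
  rw [ι, RingQuot.mkAlgHom_rel K (Rel.czero i j h), map_zero]

theorem Dval_eq (m : Fin n → ℤ) (p : ℕ) (i j : Fin n) :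
    Dval K n m (c p i j) = (if p = 1 ∧ i = j then 1 else 0) +
      ∑ ab ∈ antidiagonal p, ∑ r : Fin n,
        sgn K (m r + m j) • (ι K n (c ab.1 r j) * ι K n (c ab.2 i r)) := by
  match p with
  | 0 =>
    simp only [Dval, HasAntidiagonal.antidiagonal_zero, sum_singleton,
      zero_ne_one, false_and, if_false, zero_add]
    refine sum_congr rfl fun r _ => ?_
    by_cases h1 : i < r
    · by_cases h2 : r < j
      · simp [h1, h2]
      · simp [h2, ι_zero_of_not_lt]
    · simp [h1, ι_zero_of_not_lt]
  | 1 =>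
    simp only [Dval, Nat.sum_antidiagonal_succ, HasAntidiagonal.antidiagonal_zero,
      sum_singleton, true_and, ← sum_add_distrib, zero_add]
    congr 1
    refine sum_congr rfl fun r _ => ?_
    rw [add_comm]
    congr 1
    · by_cases h2 : r < j <;> simp [h2, ι_zero_of_not_lt]
    · by_cases h1 : i < r <;> simp [h1, ι_zero_of_not_lt]
  | p + 2 =>
    rw [← Nat.sum_antidiagonal_swap, Nat.sum_antidiagonal_eq_sum_range_succ_mk]
    simp [Dval]

/-- The product of the generators in a word. -/
def mon (l : List (CGen n)) : IAlgK K n := (l.map (ι K n)).prod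

@[simp] theorem mon_nil : mon K ([] : List (CGen n)) = 1 := by simp [mon]

@[simp] theorem mon_cons (g : CGen n) (l : List (CGen n)) :
    mon K (g :: l) = ι K n g * mon K l := by simp [mon]

theorem mon_append (l l' : List (CGen n)) : mon K (l ++ l') = mon K l * mon K l' := by
  simp [mon]

theorem mon_replicate (a : ℕ) (g : CGen n) :
    mon K (List.replicate a g) = ι K n g ^ a := by
  simp [mon]

theorem span_mon : Submodule.span K (Set.range (mon K (n := n))) = ⊤ := by
  have h1 : (1 : IAlgK K n) ∈ Submodule.span K (Set.range (mon K (n := n))) :=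
    Submodule.subset_span ⟨[], mon_nil K⟩
  have hmul : ∀ x y, x ∈ Submodule.span K (Set.range (mon K (n := n))) →
      y ∈ Submodule.span K (Set.range (mon K (n := n))) →
      x * y ∈ Submodule.span K (Set.range (mon K (n := n))) := by
    intro x y hx hy
    have h := Submodule.mul_mem_mul hx hy
    rw [Submodule.span_mul_span] at h
    refine Submodule.span_mono ?_ h
    rintro _ ⟨_, ⟨l, rfl⟩, _, ⟨l', rfl⟩, rfl⟩
    exact ⟨l ++ l', mon_append K l l'⟩
  rw [eq_top_iff]
  rintro x -
  obtain ⟨a, rfl⟩ := RingQuot.mkAlgHom_surjective K (Rel K n) x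
  induction a using FreeAlgebra.induction with
  | grade0 r =>
    rw [AlgHom.commutes, Algebra.algebraMap_eq_smul_one]
    exact Submodule.smul_mem _ _ h1
  | grade1 g => exact Submodule.subset_span ⟨[g], by simp [ι]⟩
  | mul a b ha hb => rw [map_mul]; exact hmul _ _ ha hb
  | add a b ha hb => rw [map_add]; exact Submodule.add_mem _ ha hb

/-- Two linear maps agreeing on words agree. -/
theorem linearMap_ext_mon {M : Type*} [AddCommGroup M] [Module K M] {f g : IAlgK K n →ₗ[K] M}
    (h : ∀ l, f (mon K l) = g (mon K l)) : f = g :=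
  LinearMap.ext_on_range (span_mon K) h

variable (m : Fin n → ℤ)

theorem mon_mem_Hgr (l : List (CGen n)) : mon K l ∈ Hgr K n m (l.map (dg n m)).sum :=
  Submodule.subset_span ⟨l, rfl, rfl⟩

theorem ι_mem_Hgr (g : CGen n) : ι K n g ∈ Hgr K n m (dg n m g) := by
  simpa using mon_mem_Hgr K m [g]

theorem Dval_mem_Hgr (g : CGen n) : Dval K n m g ∈ Hgr K n m (dg n m g + 1) := by
  obtain ⟨p, i, j⟩ := g
  rw [Dval_eq]
  refine Submodule.add_mem _ ?_ (Submodule.sum_mem _ fun ab hab => Submodule.sum_mem _ fun r _ =>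
    Submodule.smul_mem _ _ ?_)
  · split_ifs with h
    · obtain ⟨rfl, rfl⟩ := h
      simpa [dg] using mon_mem_Hgr K m []
    · exact Submodule.zero_mem _
  · have h := mon_mem_Hgr K m [c ab.1 r j, c ab.2 i r]
    rw [HasAntidiagonal.mem_antidiagonal] at hab
    convert h using 1
    · simp only [dg, List.map_cons, List.map_nil, List.sum_cons, List.sum_nil, ← hab]
      push_cast
      ring_nf
    · simp

variable {K m} {D : IAlgK K n →ₗ[K] IAlgK K n}

theorem IsDiff.map_ι_mul (hD : IsDiff K n m D) (g : CGen n) (x : IAlgK K n) :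
    D (ι K n g * x) = D (ι K n g) * x + sgn K (dg n m g) • (ι K n g * D x) :=
  hD.2.2 _ _ _ (ι_mem_Hgr K m g)

theorem IsDiff.map_ι (hD : IsDiff K n m D) (p : ℕ) (i j : Fin n) :
    D (ι K n (c p i j)) = (if p = 1 ∧ i = j then 1 else 0) +
      ∑ ab ∈ antidiagonal p, ∑ r : Fin n,
        sgn K (m r + m j) • (ι K n (c ab.1 r j) * ι K n (c ab.2 i r)) := by
  rw [hD.2.1, Dval_eq]

theorem IsDiff.map_map_ι (hD : IsDiff K n m D) (g : CGen n) : D (D (ι K n g)) = 0 := by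
  obtain ⟨p, i, j⟩ := g
  have hδ : D (if p = 1 ∧ i = j then 1 else 0) = 0 := by split_ifs <;> simp [hD.1]
  let F : ℕ → ℕ → ℕ → IAlgK K n := fun x y z => ∑ r, ∑ t, sgn K (m r + m t) •
    (ι K n (c x t j) * (ι K n (c y r t) * ι K n (c z i r)))
  have hterm : ∀ ab : ℕ × ℕ,
      ∑ r, sgn K (m r + m j) • D (ι K n (c ab.1 r j) * ι K n (c ab.2 i r)) =
      (∑ q ∈ antidiagonal ab.1, F q.1 q.2 ab.2) - (∑ q ∈ antidiagonal ab.2, F ab.1 q.1 q.2) +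
      ((if ab.1 = 1 then ι K n (c ab.2 i j) else 0) -
        (if ab.2 = 1 then ι K n (c ab.1 i j) else 0)) := by
    rintro ⟨a, b⟩
    have h1 : ∀ r, sgn K (m r + m j) • D (ι K n (c a r j) * ι K n (c b i r)) =
        ((if a = 1 ∧ r = j then ι K n (c b i j) else 0) +
        ∑ q ∈ antidiagonal a, ∑ t, sgn K (m r + m t) •
          (ι K n (c q.1 t j) * (ι K n (c q.2 r t) * ι K n (c b i r)))) -
        ((if b = 1 ∧ i = r then ι K n (c a i j) else 0) +
        ∑ q ∈ antidiagonal b, ∑ t, sgn K (m t + m r) •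
          (ι K n (c a r j) * (ι K n (c q.1 t r) * ι K n (c q.2 i t)))) := by
      intro r
      have hs : sgn K (m r + m j) * sgn K (dg n m (c a r j)) = -1 := by
        rw [sgn_mul, ← sgn_add_self K 0, ← sgn_add_one]
        refine sgn_congr K ⟨m j - a, ?_⟩
        simp only [dg]; ring
      have hs' : ∀ t, sgn K (m r + m j) * sgn K (m t + m j) = sgn K (m r + m t) := fun t => by
        rw [sgn_mul]; exact sgn_congr K ⟨m j, by ring⟩
      rw [hD.map_ι_mul, smul_add, smul_smul, hs, hD.map_ι, hD.map_ι, neg_smul, one_smul,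
        ← sub_eq_add_neg, add_mul, mul_add, smul_add]
      congr 2
      · split_ifs with h
        · rw [h.2, sgn_add_self, one_smul, one_mul]
        · simp
      · simp only [sum_mul, smul_sum, smul_mul_assoc, smul_smul, hs', mul_assoc]
      · split_ifs with h
        · rw [h.2, mul_one]
        · simp
      · simp only [mul_sum, mul_smul_comm]
    simp only [h1, sum_sub_distrib, sum_add_distrib, F]
    rw [sum_comm, sum_comm (s := univ) (t := antidiagonal b)]
    have h2 : ∑ r, (if a = 1 ∧ r = j then ι K n (c b i j) else 0) =
        if a = 1 then ι K n (c b i j) else 0 := by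
      by_cases h : a = 1 <;> simp [h]
    have h3 : ∑ r, (if b = 1 ∧ i = r then ι K n (c a i j) else 0) =
        if b = 1 then ι K n (c a i j) else 0 := by
      by_cases h : b = 1 <;> simp [h]
    have h4 : ∀ q : ℕ × ℕ, ∑ r, ∑ t, sgn K (m t + m r) •
          (ι K n (c a r j) * (ι K n (c q.1 t r) * ι K n (c q.2 i t))) = ∑ r, ∑ t,
          sgn K (m r + m t) • (ι K n (c a t j) * (ι K n (c q.1 r t) * ι K n (c q.2 i r))) :=
      fun q => sum_comm
    simp only [h2, h3, h4]
    abel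
  rw [hD.map_ι, map_add, hδ, zero_add]
  simp only [map_sum, map_smul, hterm, sum_add_distrib, sum_sub_distrib]
  rw [sum_antidiagonal_assoc p F, sub_self, zero_add, sub_eq_zero, ← Nat.sum_antidiagonal_swap]
  rfl

theorem IsDiff.map_map (hD : IsDiff K n m D) (x : IAlgK K n) : D (D x) = 0 := by
  have : D ∘ₗ D = 0 := linearMap_ext_mon K fun l => by
    induction l with
    | nil => simp [hD.1]
    | cons g l ih =>
      have hg : D (D (ι K n g) * D (mon K l)) = _ :=
        hD.2.2 _ _ _ (hD.2.1 g ▸ Dval_mem_Hgr K m g)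
      have hg' : D (D (ι K n g) * mon K l) = _ :=
        hD.2.2 _ _ _ (hD.2.1 g ▸ Dval_mem_Hgr K m g)
      simp only [LinearMap.comp_apply, LinearMap.zero_apply] at ih ⊢
      rw [mon_cons, hD.map_ι_mul, map_add, hg', map_smul, hD.map_ι_mul, ih, hD.map_map_ι,
        sgn_add_one, zero_mul, zero_add, mul_zero, smul_zero, add_zero, ← add_smul,
        neg_add_cancel, zero_smul]
  exact LinearMap.congr_fun this x

end General

section Words

/-- The weight `1 - |g|` of a generator, when `m 0 = m 1 + 1`; it is `0` exactly on the
generators which vanish. -/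
def wt : CGen 2 → ℕ
  | c p i j => 2 * p + j - i

def tgt : CGen 2 → Fin 2
  | c _ _ j => j

/-- The generator of weight one with target `j`. -/
def unitGen : Fin 2 → CGen 2
  | 0 => c 1 1 0
  | 1 => c 0 0 1

/-- The generator `g'` for which `unitGen (tgt g) * g'` is the leading term of `∂ g`. -/
def rest : CGen 2 → CGen 2
  | c p i 0 => c (p - 1) i 1
  | c p i 1 => c p i 0

/-- The inverse of `rest`. -/
def merge : CGen 2 → CGen 2
  | c p i 0 => c p i 1
  | c p i 1 => c (p + 1) i 0

theorem rest_merge (g : CGen 2) : rest (merge g) = g := by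
  obtain ⟨p, i, j⟩ := g
  fin_cases j <;> simp [rest, merge]

theorem merge_rest {g : CGen 2} (h : 2 ≤ wt g) : merge (rest g) = g := by
  obtain ⟨p, i, j⟩ := g
  fin_cases j <;> simp [rest, merge, wt] at h ⊢
  omega

theorem tgt_merge_of_ne {g : CGen 2} {j : Fin 2} (h : tgt g ≠ j) : tgt (merge g) = j := by
  obtain ⟨p, i, k⟩ := g
  fin_cases k <;> fin_cases j <;> simp [tgt, merge] at h ⊢

theorem tgt_rest_ne (g : CGen 2) : tgt (rest g) ≠ tgt g := by
  obtain ⟨p, i, j⟩ := g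
  fin_cases j <;> simp [tgt, rest]

theorem wt_merge {g : CGen 2} (h : 0 < wt g) : wt (merge g) = wt g + 1 := by
  obtain ⟨p, i, j⟩ := g
  fin_cases j <;> simp [wt, merge] at h ⊢ <;> omega

theorem wt_rest {g : CGen 2} (h : 2 ≤ wt g) : wt (rest g) + 1 = wt g := by
  obtain ⟨p, i, j⟩ := g
  fin_cases j <;> simp [wt, rest] at h ⊢ <;> omega

@[simp] theorem wt_unitGen (j : Fin 2) : wt (unitGen j) = 1 := by
  fin_cases j <;> simp [wt, unitGen]

@[simp] theorem tgt_unitGen (j : Fin 2) : tgt (unitGen j) = j := by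
  fin_cases j <;> simp [tgt, unitGen]

theorem eq_unitGen {g : CGen 2} (h : wt g = 1) : g = unitGen (tgt g) := by
  obtain ⟨p, i, j⟩ := g
  fin_cases j <;> fin_cases i <;> simp [wt, unitGen, tgt] at h ⊢ <;> omega

theorem wt_add {p a b : ℕ} {i j r : Fin 2} (h : a + b = p) (h1 : 0 < wt (c a r j))
    (h2 : 0 < wt (c b i r)) : wt (c a r j) + wt (c b i r) = wt (c p i j) := by
  simp only [wt] at *
  omega

theorem exists_split (p : ℕ) (i j : Fin 2) (h : 2 ≤ wt (c p i j)) :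
    ∃ a b r, a + b = p ∧ unitGen j = c a r j ∧ rest (c p i j) = c b i r := by
  fin_cases j
  · refine ⟨1, p - 1, 1, ?_, rfl, rfl⟩
    simp only [wt] at h
    have := i.isLt
    simp at h
    omega
  · exact ⟨0, p, 0, by simp, rfl, rfl⟩

def Valid (l : List (CGen 2)) : Prop := ∀ g ∈ l, 0 < wt g

theorem valid_nil : Valid [] := by simp [Valid]

theorem valid_cons {g : CGen 2} {l : List (CGen 2)} : Valid (g :: l) ↔ 0 < wt g ∧ Valid l := by
  simp [Valid]

/-- The total weight of a word. -/
def wtl (l : List (CGen 2)) : ℕ := (l.map wt).sum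

@[simp] theorem wtl_nil : wtl [] = 0 := rfl

@[simp] theorem wtl_cons (g : CGen 2) (l : List (CGen 2)) : wtl (g :: l) = wt g + wtl l := by
  simp [wtl]

/-- A numerical rank ordering valid words first by weight, then lexicographically, with letters
of smaller weight being larger. -/
def code : List (CGen 2) → ℕ
  | [] => 1
  | g :: l => 2 ^ (wt g + wtl l) + code l

theorem two_pow_wtl_le_code (l : List (CGen 2)) : 2 ^ wtl l ≤ code l := by
  cases l <;> simp [code]

theorem code_lt {l : List (CGen 2)} (h : Valid l) : code l < 2 ^ (wtl l + 1) := by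
  induction l with
  | nil => simp [code]
  | cons g l ih =>
    rw [valid_cons] at h
    have h1 := ih h.2
    have h2 : 2 ^ (wtl l + 1) ≤ 2 ^ (wt g + wtl l) := Nat.pow_le_pow_right two_pos (by omega)
    rw [code, wtl_cons, pow_succ 2 (wt g + wtl l)]
    omega

theorem code_cons_lt (g : CGen 2) {l l' : List (CGen 2)} (hl' : Valid l')
    (h : code l < code l') : code (g :: l) < code (g :: l') := by
  have h1 := (two_pow_wtl_le_code l).trans_lt (h.trans (code_lt hl'))
  rw [Nat.pow_lt_pow_iff_right one_lt_two] at h1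
  have h2 : 2 ^ (wt g + wtl l) ≤ 2 ^ (wt g + wtl l') := Nat.pow_le_pow_right two_pos (by omega)
  rw [code, code]
  omega

theorem code_cons_lt_of_two_le {g u h : CGen 2} {l l' : List (CGen 2)} (hg : 2 ≤ wt g)
    (hu : wt u = 1) (hl : Valid l) (hw : wtl (g :: l) ≤ wtl (u :: h :: l')) :
    code (g :: l) < code (u :: h :: l') := by
  have h1 := code_lt hl
  simp only [wtl_cons, hu] at hw
  have h2 : 2 ^ (wtl l + 1) ≤ 2 ^ (wt h + wtl l') := Nat.pow_le_pow_right two_pos (by omega)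
  have h3 : 2 ^ (wt g + wtl l) ≤ 2 ^ (1 + (wt h + wtl l')) :=
    Nat.pow_le_pow_right two_pos (by omega)
  simp only [code, wtl_cons, hu]
  omega

theorem code_lt_of_wtl_lt {l l' : List (CGen 2)} (hl : Valid l) (hw : wtl l < wtl l') :
    code l < code l' :=
  (code_lt hl).trans_le
    ((Nat.pow_le_pow_right two_pos hw).trans (two_pow_wtl_le_code l'))

/-- The matching sending a word to the leading term of its differential. -/
def flow : List (CGen 2) → List (CGen 2)
  | [] => []
  | g :: l => if 2 ≤ wt g then unitGen (tgt g) :: rest g :: l else g :: flow l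

/-- The words of the form `(unitGen j)^a · g · l` with `g` of target `j` and weight at least
two. -/
def Down (j : Fin 2) : List (CGen 2) → Prop
  | [] => False
  | g :: l => tgt g = j ∧ ((2 ≤ wt g ∧ Valid l) ∨ (wt g = 1 ∧ Down j l))

theorem Down.valid_flow {j : Fin 2} : ∀ {d : List (CGen 2)}, Down j d → Valid (flow d)
  | g :: l, ⟨_, .inl ⟨h, hl⟩⟩ => by
    have := wt_rest h
    simp only [flow, h, if_true, valid_cons, wt_unitGen]
    exact ⟨one_pos, by omega, hl⟩
  | g :: l, ⟨_, .inr ⟨h, hl⟩⟩ => by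
    simp only [flow, h, Nat.not_ofNat_le_one, if_false, valid_cons]
    exact ⟨one_pos, hl.valid_flow⟩

theorem Down.exists_flow_eq {j : Fin 2} :
    ∀ {d : List (CGen 2)}, Down j d → ∃ t, flow d = unitGen j :: t
  | g :: l, ⟨hj, .inl ⟨h, hl⟩⟩ => ⟨rest g :: l, by simp [flow, h, hj]⟩
  | g :: l, ⟨hj, .inr ⟨h, hl⟩⟩ => ⟨flow l, by rw [← hj, ← eq_unitGen h]; simp [flow, h]⟩

theorem Down.eq_of_flow_eq {j : Fin 2} {d : List (CGen 2)} (hd : Down j d) :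
    ∀ {d' : List (CGen 2)}, Down j d' → flow d = flow d' → d = d' := by
  induction d with
  | nil => exact hd.elim
  | cons g l ih =>
    intro d' hd' h
    cases d' with
    | nil => exact hd'.elim
    | cons g' l' =>
      obtain ⟨hj, h1⟩ := hd
      obtain ⟨hj', h1'⟩ := hd'
      rcases h1 with ⟨hg, -⟩ | ⟨hg, hl⟩ <;> rcases h1' with ⟨hg', -⟩ | ⟨hg', hl'⟩
      · simp only [flow, hg, hg', if_true, List.cons.injEq] at h
        rw [← merge_rest hg, ← merge_rest hg', h.2.1, h.2.2]
      · obtain ⟨t, ht⟩ := hl'.exists_flow_eq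
        simp only [flow, hg, hg', if_true, Nat.not_ofNat_le_one, if_false, ht,
          List.cons.injEq] at h
        exact absurd (by rw [h.2.1, tgt_unitGen, hj]) (tgt_rest_ne g)
      · obtain ⟨t, ht⟩ := hl.exists_flow_eq
        simp only [flow, hg, hg', if_true, Nat.not_ofNat_le_one, if_false, ht,
          List.cons.injEq] at h
        exact absurd (by rw [← h.2.1, tgt_unitGen, hj']) (tgt_rest_ne g')
      · simp only [flow, hg, hg', Nat.not_ofNat_le_one, if_false, List.cons.injEq] at h
        rw [h.1, ih hl hl' h.2]

theorem injOn_flow : {d | ∃ j, Down j d}.InjOn flow := by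
  rintro d ⟨j, hd⟩ d' ⟨j', hd'⟩ h
  obtain ⟨t, ht⟩ := hd.exists_flow_eq
  obtain ⟨t', ht'⟩ := hd'.exists_flow_eq
  have hj : j = j' := by
    rw [ht, ht', List.cons.injEq] at h
    rw [← tgt_unitGen j, h.1, tgt_unitGen]
  subst hj
  exact hd.eq_of_flow_eq hd' h

theorem Valid.classify : ∀ {l : List (CGen 2)}, Valid l →
    (∃ j a, l = List.replicate a (unitGen j)) ∨ (∃ j, Down j l) ∨ ∃ d, (∃ j, Down j d) ∧ flow d = l
  | [], _ => .inl ⟨0, 0, rfl⟩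
  | [g], h => by
    rw [valid_cons] at h
    rcases (Nat.succ_le_of_lt h.1).eq_or_lt with hg | hg
    · exact .inl ⟨tgt g, 1, by rw [← eq_unitGen hg.symm]; rfl⟩
    · exact .inr (.inl ⟨tgt g, rfl, .inl ⟨hg, h.2⟩⟩)
  | g :: k :: l, h => by
    rw [valid_cons] at h
    rcases (Nat.succ_le_of_lt h.1).eq_or_lt with hg | hg
    · replace hg : wt g = 1 := hg.symm
      by_cases hk : tgt k = tgt g
      · rcases Valid.classify h.2 with ⟨j, a, ha⟩ | ⟨j, hj⟩ | ⟨d, ⟨j, hd⟩, hfd⟩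
        · have hkj : k = unitGen j :=
            List.eq_of_mem_replicate (n := a) (by rw [← ha]; exact List.mem_cons_self)
          refine .inl ⟨j, a + 1, ?_⟩
          rw [ha, List.replicate_succ, eq_unitGen hg, ← hk, hkj, tgt_unitGen]
        · exact .inr (.inl ⟨j, hk ▸ hj.1, .inr ⟨hg, hj⟩⟩)
        · obtain ⟨t, ht⟩ := hd.exists_flow_eq
          have hkj : k = unitGen j := by
            rw [hfd, List.cons.injEq] at ht
            exact ht.1
          refine .inr (.inr ⟨g :: d, ⟨j, ?_, .inr ⟨hg, hd⟩⟩, ?_⟩)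
          · rw [← hk, hkj, tgt_unitGen]
          · simp [flow, hg, hfd]
      · have hk' := (valid_cons.1 h.2)
        have hm := wt_merge hk'.1
        have hm2 : 2 ≤ wt (merge k) := by omega
        refine .inr (.inr ⟨merge k :: l, ⟨tgt g, tgt_merge_of_ne hk, .inl ⟨hm2, hk'.2⟩⟩, ?_⟩)
        simp only [flow, hm2, if_true, rest_merge]
        rw [tgt_merge_of_ne hk, ← eq_unitGen hg]
    · exact .inr (.inl ⟨tgt g, rfl, .inl ⟨hg, h.2⟩⟩)

end Words

section Filtration

variable (K : Type) [Field K]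

theorem ι_eq_zero {g : CGen 2} (h : wt g = 0) : ι K 2 g = 0 := by
  obtain ⟨p, i, j⟩ := g
  simp only [wt] at h
  obtain rfl : p = 0 := by omega
  exact ι_zero_of_not_lt K (by rw [Fin.lt_def]; omega)

theorem mon_eq_zero {l : List (CGen 2)} (h : ¬ Valid l) : mon K l = 0 := by
  simp only [Valid, not_forall, not_lt, nonpos_iff_eq_zero] at h
  obtain ⟨g, hg, h⟩ := h
  exact List.prod_eq_zero (List.mem_map.2 ⟨g, hg, ι_eq_zero K h⟩)

theorem ι_mul_ι_eq_zero_or {p a b : ℕ} (i j r : Fin 2) (h : a + b = p) :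
    ι K 2 (c a r j) * ι K 2 (c b i r) = 0 ∨ 0 < wt (c a r j) ∧ 0 < wt (c b i r) ∧
      wt (c a r j) + wt (c b i r) = wt (c p i j) := by
  rcases Nat.eq_zero_or_pos (wt (c a r j)) with h1 | h1
  · exact .inl (by rw [ι_eq_zero K h1, zero_mul])
  rcases Nat.eq_zero_or_pos (wt (c b i r)) with h2 | h2
  · exact .inl (by rw [ι_eq_zero K h2, mul_zero])
  exact .inr ⟨h1, h2, wt_add h h1 h2⟩

/-- The span of the words of weight at most `N`. -/
def wtFil (N : ℕ) : Submodule K (IAlgK K 2) :=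
  Submodule.span K (mon K '' {w | Valid w ∧ wtl w ≤ N})

/-- The span of the words of rank less than that of `w`. -/
def lower (w : List (CGen 2)) : Submodule K (IAlgK K 2) :=
  Submodule.span K (mon K '' {w' | code w' < code w})

variable {K}

theorem mon_mem_wtFil {w : List (CGen 2)} {N : ℕ} (h : Valid w) (hN : wtl w ≤ N) :
    mon K w ∈ wtFil K N :=
  Submodule.subset_span ⟨w, ⟨h, hN⟩, rfl⟩

theorem mon_mem_lower {w w' : List (CGen 2)} (h : code w' < code w) : mon K w' ∈ lower K w :=
  Submodule.subset_span ⟨w', h, rfl⟩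

theorem mul_mem_wtFil {x y : IAlgK K 2} {M N : ℕ} (hx : x ∈ wtFil K M) (hy : y ∈ wtFil K N) :
    x * y ∈ wtFil K (M + N) := by
  have h := Submodule.mul_mem_mul hx hy
  rw [wtFil, wtFil, Submodule.span_mul_span] at h
  refine Submodule.span_mono ?_ h
  rintro _ ⟨_, ⟨l, ⟨hl, hM⟩, rfl⟩, _, ⟨l', ⟨hl', hN⟩, rfl⟩, rfl⟩
  refine ⟨l ++ l', ⟨?_, ?_⟩, mon_append K l l'⟩
  · intro g hg
    exact (List.mem_append.1 hg).elim (hl g) (hl' g)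
  · simp only [wtl, List.map_append, List.sum_append] at hM hN ⊢
    omega

theorem ι_mem_wtFil (g : CGen 2) : ι K 2 g ∈ wtFil K (wt g) := by
  rcases Nat.eq_zero_or_pos (wt g) with h | h
  · rw [ι_eq_zero K h]; exact Submodule.zero_mem _
  · simpa using mon_mem_wtFil (K := K) (w := [g]) (N := wt g)
      (valid_cons.2 ⟨h, valid_nil⟩) (by simp)

theorem ι_mul_mem_lower (u : CGen 2) {w : List (CGen 2)} (hw : Valid w) {x : IAlgK K 2}
    (hx : x ∈ lower K w) : ι K 2 u * x ∈ lower K (u :: w) := by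
  have : lower K w ≤ (lower K (u :: w)).comap (LinearMap.mulLeft K (ι K 2 u)) :=
    Submodule.span_le.2 (by
      rintro _ ⟨w', hw', rfl⟩
      simpa using mon_mem_lower (K := K) (code_cons_lt u hw hw'))
  exact this hx

variable {m : Fin 2 → ℤ} {D : IAlgK K 2 →ₗ[K] IAlgK K 2}

theorem IsDiff.map_ι_of_wt_le_one (hD : IsDiff K 2 m D) {g : CGen 2} (h : wt g ≤ 1) :
    D (ι K 2 g) = 0 := by
  obtain ⟨p, i, j⟩ := g
  rw [hD.map_ι, if_neg, zero_add]
  · refine sum_eq_zero fun ab hab => sum_eq_zero fun r _ => ?_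
    rcases ι_mul_ι_eq_zero_or K i j r (HasAntidiagonal.mem_antidiagonal.1 hab) with h0 | h0
    · rw [h0, smul_zero]
    · omega
  · rintro ⟨rfl, rfl⟩
    simp only [wt] at h
    omega

theorem IsDiff.map_ι_mem_wtFil (hD : IsDiff K 2 m D) (g : CGen 2) :
    D (ι K 2 g) ∈ wtFil K (wt g) := by
  obtain ⟨p, i, j⟩ := g
  rw [hD.map_ι]
  refine Submodule.add_mem _ ?_ (Submodule.sum_mem _ fun ab hab => Submodule.sum_mem _ fun r _ =>
    Submodule.smul_mem _ _ ?_)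
  · split_ifs
    · simpa using mon_mem_wtFil (K := K) valid_nil (Nat.zero_le (wt (c p i j)))
    · exact Submodule.zero_mem _
  · rcases ι_mul_ι_eq_zero_or K i j r (HasAntidiagonal.mem_antidiagonal.1 hab) with h0 | h0
    · rw [h0]; exact Submodule.zero_mem _
    · rw [← h0.2.2]; exact mul_mem_wtFil (ι_mem_wtFil _) (ι_mem_wtFil _)

theorem IsDiff.map_mon_mem_wtFil (hD : IsDiff K 2 m D) (l : List (CGen 2)) :
    D (mon K l) ∈ wtFil K (wtl l) := by
  by_cases hl : Valid l
  swap
  · rw [mon_eq_zero K hl, map_zero]; exact Submodule.zero_mem _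
  induction l with
  | nil => rw [mon_nil, hD.1]; exact Submodule.zero_mem _
  | cons g l ih =>
    rw [valid_cons] at hl
    rw [mon_cons, hD.map_ι_mul, wtl_cons]
    exact Submodule.add_mem _
      (mul_mem_wtFil (hD.map_ι_mem_wtFil g) (mon_mem_wtFil hl.2 le_rfl))
      (Submodule.smul_mem _ _ (mul_mem_wtFil (ι_mem_wtFil g) (ih hl.2)))

theorem IsDiff.map_ι_mul_of_wt_eq_one (hD : IsDiff K 2 m D) {g : CGen 2} (h : wt g = 1)
    (x : IAlgK K 2) : D (ι K 2 g * x) = sgn K (dg 2 m g) • (ι K 2 g * D x) := by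
  rw [hD.map_ι_mul, hD.map_ι_of_wt_le_one h.le, zero_mul, zero_add]

theorem IsDiff.exists_leading_cons (hD : IsDiff K 2 m D) {g : CGen 2} {l : List (CGen 2)}
    (hg : 2 ≤ wt g) (hl : Valid l) : ∃ a : K, a ≠ 0 ∧
      D (mon K (g :: l)) - a • mon K (unitGen (tgt g) :: rest g :: l) ∈
        lower K (unitGen (tgt g) :: rest g :: l) := by
  have hwr := wt_rest hg
  have hmul : ι K 2 g * D (mon K l) ∈ lower K (unitGen (tgt g) :: rest g :: l) := by
    have : wtFil K (wtl l) ≤ (lower K (unitGen (tgt g) :: rest g :: l)).comap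
        (LinearMap.mulLeft K (ι K 2 g)) :=
      Submodule.span_le.2 (by
        rintro _ ⟨w, ⟨hw, hwl⟩, rfl⟩
        have := code_cons_lt_of_two_le (u := unitGen (tgt g)) (h := rest g) (l' := l) hg
          (wt_unitGen _) hw (by simp only [wtl_cons, wt_unitGen]; omega)
        simpa using mon_mem_lower (K := K) this)
    exact this (hD.map_mon_mem_wtFil l)
  have h1 : mon K l ∈ lower K (unitGen (tgt g) :: rest g :: l) :=
    mon_mem_lower (code_lt_of_wtl_lt hl (by simp only [wtl_cons, wt_unitGen]; omega))
  obtain ⟨p, i, j⟩ := g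
  obtain ⟨a, b, r, hab, hu, hr⟩ := exists_split p i j hg
  rw [tgt] at *
  refine ⟨sgn K (m r + m j), sgn_ne_zero K _, ?_⟩
  rw [mon_cons, hD.map_ι_mul, hD.map_ι, ← sum_product' (s := antidiagonal p) (t := univ)
    (f := fun ab r => sgn K (m r + m j) • (ι K 2 (c ab.1 r j) * ι K 2 (c ab.2 i r))),
    ← add_sum_erase _ _ (show ((a, b), r) ∈ antidiagonal p ×ˢ univ by simp [hab]), mon_cons,
    mon_cons, hr, hu]
  have hrest : (∑ x ∈ (antidiagonal p ×ˢ univ).erase ((a, b), r),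
      sgn K (m x.2 + m j) • (ι K 2 (c x.1.1 x.2 j) * ι K 2 (c x.1.2 i x.2))) * mon K l ∈
      lower K (unitGen j :: rest (c p i j) :: l) := by
    rw [sum_mul]
    refine Submodule.sum_mem _ ?_
    rintro ⟨⟨a', b'⟩, r'⟩ hx
    simp only [mem_erase, mem_product, HasAntidiagonal.mem_antidiagonal, mem_univ,
      and_true] at hx
    rw [smul_mul_assoc]
    refine Submodule.smul_mem _ _ ?_
    rcases ι_mul_ι_eq_zero_or K i j r' hx.2 with h0 | ⟨h2, h3, h4⟩
    · rw [h0, zero_mul]; exact Submodule.zero_mem _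
    · have h5 : 2 ≤ wt (c a' r' j) := by
        by_contra hlt
        have h6 := eq_unitGen (g := c a' r' j) (by omega)
        rw [tgt, hu] at h6
        injection h6 with h6 h7
        subst h6 h7
        exact hx.1 (by rw [show b' = b by omega])
      have := code_cons_lt_of_two_le (l := c b' i r' :: l) (u := unitGen j)
        (h := rest (c p i j)) (l' := l) h5 (wt_unitGen _) (valid_cons.2 ⟨h3, hl⟩)
        (by simp only [wtl_cons, wt_unitGen]; omega)
      simpa [mul_assoc] using mon_mem_lower (K := K) this
  rw [hr, hu] at hrest hmul h1
  have h2 : (if p = 1 ∧ i = j then 1 else 0) * mon K l ∈ lower K (c a r j :: c b i r :: l) := by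
    split_ifs
    · rwa [one_mul]
    · rw [zero_mul]; exact Submodule.zero_mem _
  convert Submodule.add_mem _ (Submodule.add_mem _ h2 hrest)
    (Submodule.smul_mem _ (sgn K (dg 2 m (c p i j))) hmul) using 1
  simp only [add_mul, smul_mul_assoc, mul_assoc]
  abel

theorem IsDiff.exists_leading (hD : IsDiff K 2 m D) {j : Fin 2} : ∀ {d : List (CGen 2)},
    Down j d → ∃ a : K, a ≠ 0 ∧ D (mon K d) - a • mon K (flow d) ∈ lower K (flow d)
  | g :: l, ⟨_, .inl ⟨h, hl⟩⟩ => by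
    simpa only [flow, h, if_true] using hD.exists_leading_cons h hl
  | g :: l, ⟨_, .inr ⟨h, hl⟩⟩ => by
    obtain ⟨a, ha, h1⟩ := hD.exists_leading hl
    refine ⟨sgn K (dg 2 m g) * a, mul_ne_zero (sgn_ne_zero K _) ha, ?_⟩
    simp only [flow, h, Nat.not_ofNat_le_one, if_false, mon_cons]
    convert Submodule.smul_mem _ (sgn K (dg 2 m g)) (ι_mul_mem_lower g hl.valid_flow h1) using 1
    rw [hD.map_ι_mul_of_wt_eq_one h, mul_smul, mul_sub, mul_smul_comm]
    exact (smul_sub (sgn K (dg 2 m g)) _ _).symm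

end Filtration

section Functionals

variable (K : Type) [Field K]

/-- The map from `IAlgK K 2` to an algebra determined by the images of the nonzero
generators. -/
noncomputable def liftAlg {A : Type} [Ring A] [Algebra K A] (f : CGen 2 → A)
    (hf : ∀ g, wt g = 0 → f g = 0) : IAlgK K 2 →ₐ[K] A :=
  RingQuot.liftAlgHom K ⟨FreeAlgebra.lift K f, by
    rintro _ _ ⟨i, j, h⟩
    rw [FreeAlgebra.lift_ι_apply, map_zero]
    refine hf _ ?_
    rw [Fin.lt_def] at h
    simp only [wt]
    omega⟩

theorem liftAlg_ι {A : Type} [Ring A] [Algebra K A] (f : CGen 2 → A)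
    (hf : ∀ g, wt g = 0 → f g = 0) (g : CGen 2) : liftAlg K f hf (ι K 2 g) = f g := by
  simp [liftAlg, ι]

/-- The embedding of `IAlgK K 2` in the free algebra. -/
noncomputable def toFree : IAlgK K 2 →ₐ[K] MonoidAlgebra K (FreeMonoid (CGen 2)) :=
  liftAlg K (fun g => if 0 < wt g then MonoidAlgebra.of K _ (FreeMonoid.of g) else 0)
    (by simp +contextual)

instance (l : List (CGen 2)) : Decidable (Valid l) :=
  inferInstanceAs (Decidable (∀ g ∈ l, 0 < wt g))

theorem toFree_mon (l : List (CGen 2)) : toFree K (mon K l) =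
    if Valid l then MonoidAlgebra.of K _ (FreeMonoid.ofList l) else 0 := by
  induction l with
  | nil => simp [valid_nil, MonoidAlgebra.one_def]
  | cons g l ih =>
    rw [mon_cons, map_mul, ih, toFree, liftAlg_ι, FreeMonoid.ofList_cons, map_mul]
    by_cases h1 : 0 < wt g <;> by_cases h2 : Valid l <;> simp [h1, h2, valid_cons]

/-- The coefficient of a word. -/
noncomputable def wordCoeff (w : List (CGen 2)) : IAlgK K 2 →ₗ[K] K :=
  Finsupp.lapply (FreeMonoid.ofList w) ∘ₗ
    (MonoidAlgebra.coeffLinearEquiv K).toLinearMap ∘ₗ (toFree K).toLinearMap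

theorem wordCoeff_self {w : List (CGen 2)} (h : Valid w) : wordCoeff K w (mon K w) = 1 := by
  simp [wordCoeff, toFree_mon, h]

theorem wordCoeff_of_ne (w w' : List (CGen 2)) (h : w' ≠ w) : wordCoeff K w (mon K w') = 0 := by
  by_cases hw : Valid w'
  · simp [wordCoeff, toFree_mon, hw, h]
  · simp [wordCoeff, toFree_mon, hw]

/-- The augmentation sending `c^0_{12}` to `T`, `c^1_{21}` to `T⁻¹`, and the other generators
to zero. -/
noncomputable def aug : IAlgK K 2 →ₐ[K] LaurentPolynomial K :=
  liftAlg K (fun g => if wt g = 1 then LaurentPolynomial.T (if tgt g = 1 then 1 else -1) else 0)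
    (by simp +contextual)

theorem aug_ι (g : CGen 2) : aug K (ι K 2 g) =
    if wt g = 1 then LaurentPolynomial.T (if tgt g = 1 then 1 else -1) else 0 :=
  liftAlg_ι K _ _ g

theorem aug_c001 : aug K (ι K 2 (c 0 0 1)) = LaurentPolynomial.T 1 := by
  simp [aug_ι, wt, tgt]

theorem aug_c110 : aug K (ι K 2 (c 1 1 0)) = LaurentPolynomial.T (-1) := by
  simp [aug_ι, wt, tgt]

variable {K} {m : Fin 2 → ℤ} {D : IAlgK K 2 →ₗ[K] IAlgK K 2}

theorem sgn_add_eq_neg_one (hm : m 0 = m 1 + 1) : sgn K (m 0 + m 1) = -1 := by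
  rw [← sgn_add_self K (m 1), ← sgn_add_one, hm]
  congr 1
  ring

theorem IsDiff.map_ι_one (hm : m 0 = m 1 + 1) (hD : IsDiff K 2 m D) :
    D (ι K 2 (c 1 0 0)) = 1 - ι K 2 (c 1 1 0) * ι K 2 (c 0 0 1) ∧
    D (ι K 2 (c 1 1 1)) = 1 - ι K 2 (c 0 0 1) * ι K 2 (c 1 1 0) := by
  have hs : sgn K (m 0 + m 1) = -1 := sgn_add_eq_neg_one hm
  have hs' : sgn K (m 1 + m 0) = -1 := by rw [add_comm, hs]
  have h0 (i : Fin 2) : ι K 2 (c 0 i 0) = 0 := ι_eq_zero K (by simp [wt])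
  have h1 : ι K 2 (c 0 1 1) = 0 := ι_eq_zero K (by simp [wt])
  constructor <;> rw [hD.map_ι] <;>
    simp only [Nat.sum_antidiagonal_succ, HasAntidiagonal.antidiagonal_zero, sum_singleton,
      Fin.sum_univ_two, h0, h1, hs, hs', zero_mul, mul_zero, smul_zero, zero_add, add_zero,
      and_self, if_true, sub_eq_add_neg, add_right_inj]
  · exact neg_one_smul K (ι K 2 (c 1 1 0) * ι K 2 (c 0 0 1))
  · exact neg_one_smul K (ι K 2 (c 0 0 1) * ι K 2 (c 1 1 0))

theorem IsDiff.aug_map_ι (hm : m 0 = m 1 + 1) (hD : IsDiff K 2 m D) (g : CGen 2) :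
    aug K (D (ι K 2 g)) = 0 := by
  obtain ⟨p, i, j⟩ := g
  by_cases h : p = 1 ∧ i = j
  · obtain ⟨rfl, rfl⟩ := h
    obtain rfl | rfl : i = 0 ∨ i = 1 := by omega
    · rw [(hD.map_ι_one hm).1, map_sub, map_one, map_mul, aug_c110, aug_c001,
        ← LaurentPolynomial.T_add]
      simp
    · rw [(hD.map_ι_one hm).2, map_sub, map_one, map_mul, aug_c001, aug_c110,
        ← LaurentPolynomial.T_add]
      simp
  · rw [hD.map_ι, if_neg h, zero_add, map_sum]
    refine sum_eq_zero fun ab hab => ?_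
    rw [map_sum]
    refine sum_eq_zero fun r _ => ?_
    rw [map_smul, map_mul, aug_ι, aug_ι]
    rw [HasAntidiagonal.mem_antidiagonal] at hab
    by_cases h1 : wt (c ab.1 r j) = 1
    · by_cases h2 : wt (c ab.2 i r) = 1
      · exfalso
        simp only [wt] at h1 h2
        exact h ⟨by omega, by ext; omega⟩
      · simp [h2]
    · simp [h1]

theorem IsDiff.aug_map (hm : m 0 = m 1 + 1) (hD : IsDiff K 2 m D) (x : IAlgK K 2) :
    aug K (D x) = 0 := by
  have : (aug K).toLinearMap ∘ₗ D = 0 := linearMap_ext_mon K fun l => by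
    induction l with
    | nil => simp [hD.1]
    | cons g l ih =>
      simp only [LinearMap.comp_apply, LinearMap.zero_apply, AlgHom.toLinearMap_apply] at ih ⊢
      rw [mon_cons, hD.map_ι_mul, map_add, map_mul, map_smul, map_mul, ih, hD.aug_map_ι hm]
      simp
  exact LinearMap.congr_fun this x

theorem aug_mem_Hgr (hm : m 0 = m 1 + 1) {d : ℤ} (hd : d ≠ 0) {x : IAlgK K 2}
    (hx : x ∈ Hgr K 2 m d) : aug K x = 0 := by
  have hword : ∀ l : List (CGen 2), aug K (mon K l) ≠ 0 → (l.map (dg 2 m)).sum = 0 := by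
    intro l
    induction l with
    | nil => simp
    | cons g l ih =>
      rw [mon_cons, map_mul, List.map_cons, List.sum_cons]
      intro h
      rw [ih (right_ne_zero_of_mul h), add_zero]
      have hg : wt g = 1 := by
        by_contra hg
        exact left_ne_zero_of_mul h (by rw [aug_ι, if_neg hg])
      rw [eq_unitGen hg]
      obtain h | h : tgt g = 0 ∨ tgt g = 1 := by omega
      · rw [h]; simp [unitGen, dg, hm]
      · rw [h]; simp only [unitGen, dg, hm]; ring
  have : Hgr K 2 m d ≤ LinearMap.ker (aug K).toLinearMap := Submodule.span_le.2 (by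
    rintro _ ⟨l, rfl, rfl⟩
    by_contra h
    exact hd (hword l h))
  exact this hx

theorem aug_zpRep (k : ℤ) : aug K (zpRep K 2 (ι K 2 (c 0 0 1)) (ι K 2 (c 1 1 0)) k) =
    LaurentPolynomial.T k := by
  unfold zpRep
  split_ifs with h
  · rw [map_pow, aug_c001, LaurentPolynomial.T_pow]
    simp [h]
  · rw [map_pow, aug_c110, LaurentPolynomial.T_pow]
    simp [(not_le.1 h).le]

theorem eq_zero_of_aug_sum_zpRep {f : ℤ →₀ K}
    (h : aug K (f.sum fun k a => a • zpRep K 2 (ι K 2 (c 0 0 1)) (ι K 2 (c 1 1 0)) k) = 0) :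
    f = 0 := by
  simp only [Finsupp.sum, map_sum, map_smul, aug_zpRep] at h
  ext k
  have h1 := congrArg (fun x : LaurentPolynomial K => x.coeff k) h
  simp only [AddMonoidAlgebra.coeff_sum, Finsupp.finsetSum_apply, AddMonoidAlgebra.coeff_smul,
    Finsupp.smul_apply, LaurentPolynomial.T_apply] at h1
  simpa using h1

end Functionals

section Cohomology

variable {K : Type} [Field K] {m : Fin 2 → ℤ} {D : IAlgK K 2 →ₗ[K] IAlgK K 2}

theorem IsDiff.map_replicate_unitGen (hD : IsDiff K 2 m D) (j : Fin 2) (a : ℕ) :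
    D (mon K (List.replicate a (unitGen j))) = 0 := by
  induction a with
  | zero => simp [hD.1]
  | succ a ih =>
    rw [List.replicate_succ, mon_cons, hD.map_ι_mul_of_wt_eq_one (wt_unitGen j), ih, mul_zero,
      smul_zero]

theorem mon_replicate_unitGen (j : Fin 2) (a : ℕ) :
    ∃ k : ℤ, mon K (List.replicate a (unitGen j)) =
      zpRep K 2 (ι K 2 (c 0 0 1)) (ι K 2 (c 1 1 0)) k := by
  rw [mon_replicate]
  obtain rfl | rfl : j = 0 ∨ j = 1 := by omega
  · refine ⟨-a, ?_⟩
    unfold zpRep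
    split_ifs with h
    · obtain rfl : a = 0 := by omega
      simp
    · simp [unitGen]
  · exact ⟨a, by simp [zpRep, unitGen]⟩

/-- Every cycle is homologous to a Laurent polynomial in the class of `c^0_{12}`. -/
theorem IsDiff.exists_sum_zpRep_add (hD : IsDiff K 2 m D) {x : IAlgK K 2} (hx : D x = 0) :
    ∃ (f : ℤ →₀ K) (y : IAlgK K 2),
      x = (f.sum fun k a => a • zpRep K 2 (ι K 2 (c 0 0 1)) (ι K 2 (c 1 1 0)) k) + D y := by
  obtain ⟨z, hz, y, hy⟩ := exists_critical_add_boundary D hD.map_map (mon K) (span_mon K)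
    {d | ∃ j, Down j d} {w | ∃ j a, w = List.replicate a (unitGen j)} flow injOn_flow code
    (fun w => by
      by_cases hw : Valid w
      · exact .inr (by simpa [Set.mem_image] using hw.classify)
      · exact .inl (mon_eq_zero K hw))
    (fun d ⟨_, hd⟩ => hD.exists_leading hd)
    (by rintro _ ⟨j, a, rfl⟩; exact hD.map_replicate_unitGen j a)
    (wordCoeff K) (fun d ⟨_, hd⟩ => wordCoeff_self K hd.valid_flow) (wordCoeff_of_ne K) x hx
  have hz' : z ∈ Submodule.span K
      (Set.range (zpRep K 2 (ι K 2 (c 0 0 1)) (ι K 2 (c 1 1 0)))) := by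
    refine Submodule.span_mono ?_ hz
    rintro _ ⟨_, ⟨j, a, rfl⟩, rfl⟩
    obtain ⟨k, hk⟩ := mon_replicate_unitGen (K := K) j a
    exact ⟨k, hk.symm⟩
  obtain ⟨f, hf⟩ := Finsupp.mem_span_range_iff_exists_finsupp.1 hz'
  exact ⟨f, y, by rw [hf]; exact hy⟩

end Cohomology

end InternalAlgebraK

open InternalAlgebraK CGen

/-- Let `n = 2` and `m 0 = m 1 + 1`, so that `c^0_{12}` and `c^1_{21}`
have degree `0`.  Then the cohomology `H(I_2^K)` is concentrated in degree `0`, and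
there is a `K`-algebra isomorphism `H(I_2^K) ≅ K[z, z⁻¹]` sending the class of
`c^0_{12}` to `z`: the class `u` of `c^0_{12}` is invertible in cohomology, and the
classes of its (positive and negative) powers form a `K`-basis of the cohomology. -/
theorem statement5 (K : Type) [Field K] (m : Fin 2 → ℤ) (hm : m 0 = m 1 + 1)
    (D : IAlgK K 2 →ₗ[K] IAlgK K 2) (hD : IsDiff K 2 m D) :
    -- the cohomology is concentrated in degree 0:
    (∀ d : ℤ, d ≠ 0 → ∀ x ∈ Hgr K 2 m d, D x = 0 → ∃ y : IAlgK K 2, x = D y) ∧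
    -- `c^0_{12}` is a cycle whose class is invertible, and whose powers give a basis:
    (D (ι K 2 (c 0 0 1)) = 0) ∧
    (∃ v : IAlgK K 2, D v = 0 ∧
      (∃ y : IAlgK K 2, ι K 2 (c 0 0 1) * v - 1 = D y) ∧
      (∃ y : IAlgK K 2, v * ι K 2 (c 0 0 1) - 1 = D y) ∧
      -- the classes of the powers span the cohomology:
      (∀ x : IAlgK K 2, D x = 0 →
        ∃ (f : ℤ →₀ K) (y : IAlgK K 2),
          x = (f.sum fun k a => a • zpRep K 2 (ι K 2 (c 0 0 1)) v k) + D y) ∧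
      -- and they are linearly independent modulo boundaries:
      (∀ f : ℤ →₀ K,
        (∃ y : IAlgK K 2, (f.sum fun k a => a • zpRep K 2 (ι K 2 (c 0 0 1)) v k) = D y)
        → f = 0)) := by
  have hu : D (ι K 2 (c 0 0 1)) = 0 := hD.map_ι_of_wt_le_one (by simp [wt])
  have hv : D (ι K 2 (c 1 1 0)) = 0 := hD.map_ι_of_wt_le_one (by simp [wt])
  obtain ⟨h0, h1⟩ := hD.map_ι_one hm
  refine ⟨fun d hd x hx hDx => ?_, hu, ι K 2 (c 1 1 0), hv, ⟨-ι K 2 (c 1 1 1), ?_⟩,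
    ⟨-ι K 2 (c 1 0 0), ?_⟩, fun x hx => hD.exists_sum_zpRep_add hx, ?_⟩
  · obtain ⟨f, y, rfl⟩ := hD.exists_sum_zpRep_add hDx
    have h := aug_mem_Hgr hm hd hx
    rw [map_add, hD.aug_map hm, add_zero] at h
    exact ⟨y, by rw [eq_zero_of_aug_sum_zpRep h, Finsupp.sum_zero_index, zero_add]⟩
  · rw [map_neg, h1, neg_sub]
  · rw [map_neg, h0, neg_sub]
  · rintro f ⟨y, hy⟩
    exact eq_zero_of_aug_sum_zpRep (by rw [hy, hD.aug_map hm])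
end

section
/- Let k = ⊕_{v=1}^{s} K e_v be a finite product of copies of K, and let θ : k_n → k be any unital K-algebra homomorphism. Then the base-changed retraction r : I_n^k → A_n^k, defined on generators by the same formulas as r : I_n → A_n, is a chain map that induces an isomorphism on cohomology. -/
/-!
The base-changed internal DG-algebra `I_n^k` of Ekholm–Ng, for a unital `K`-algebra map
`θ : k_n → k` where `k_n = K^n` and `k = K^s` are finite products of copies of the
field `K`.
-/

namespace InternalAlgebraBC

inductive Gen (s n : ℕ) : Type
  | b (v : Fin s) : Gen s n
  | c (p : ℕ) (i j : Fin n) : Gen s n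

open Gen

variable (K : Type) [Field K] (s n : ℕ)

/-- The element of the free algebra representing `f ∈ k = K^s`. -/
def embF (f : Fin s → K) : FreeAlgebra K (Gen s n) :=
  ∑ v : Fin s, f v • FreeAlgebra.ι K (b v)

variable (θ : (Fin n → K) →ₐ[K] (Fin s → K))

/-- `θ(e i) ∈ k`. -/
def θe (i : Fin n) : Fin s → K := θ (Pi.single i 1)

/-- Relations defining `I_n^k`: the `b v` are orthogonal idempotents spanning `k` and
summing to `1`, each generator satisfies `θ(e j) · c^p_{ij} · θ(e i) = c^p_{ij}`, and
`c^0_{ij} = 0` unless `i < j`. -/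
inductive Rel : FreeAlgebra K (Gen s n) → FreeAlgebra K (Gen s n) → Prop
  | idem (v : Fin s) :
      Rel (FreeAlgebra.ι K (b v) * FreeAlgebra.ι K (b v)) (FreeAlgebra.ι K (b v))
  | orth (v w : Fin s) (h : v ≠ w) :
      Rel (FreeAlgebra.ι K (b v) * FreeAlgebra.ι K (b w)) 0
  | total : Rel (∑ v : Fin s, FreeAlgebra.ι K (b v)) 1
  | left (p : ℕ) (i j : Fin n) :
      Rel (embF K s n (θe K s n θ j) * FreeAlgebra.ι K (c p i j)) (FreeAlgebra.ι K (c p i j))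
  | right (p : ℕ) (i j : Fin n) :
      Rel (FreeAlgebra.ι K (c p i j) * embF K s n (θe K s n θ i)) (FreeAlgebra.ι K (c p i j))
  | czero (i j : Fin n) (h : ¬ i < j) : Rel (FreeAlgebra.ι K (c 0 i j)) 0

/-- The base-changed internal algebra `I_n^k`. -/
abbrev IAlgBC := RingQuot (Rel K s n θ)

def ι (g : Gen s n) : IAlgBC K s n θ := RingQuot.mkAlgHom K (Rel K s n θ) (FreeAlgebra.ι K g)

/-- The image of `θ(e i)` in `I_n^k`. -/
def θeQ (i : Fin n) : IAlgBC K s n θ := ∑ v : Fin s, θe K s n θ i v • ι K s n θ (b v)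

variable (m : Fin n → ℤ)

def dg : Gen s n → ℤ
  | b _ => 0
  | c p i j => 1 - 2 * (p : ℤ) + m j - m i

def Hgr (d : ℤ) : Submodule K (IAlgBC K s n θ) :=
  Submodule.span K
    { x | ∃ l : List (Gen s n), (l.map (dg s n m)).sum = d ∧ x = (l.map (ι K s n θ)).prod }

def sgn (d : ℤ) : K := if Even d then 1 else -1

/-- The prescribed values of the differential on the generators (with `δ_{ij} = θ(e i)`
when `i = j`). -/
def Dval : Gen s n → IAlgBC K s n θ
  | b _ => 0
  | c 0 i j =>
      ∑ r : Fin n,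
        if i < r ∧ r < j then
          sgn K (m r + m j) • (ι K s n θ (c 0 r j) * ι K s n θ (c 0 i r)) else 0
  | c 1 i j =>
      (if i = j then θeQ K s n θ i else 0)
      + ∑ r : Fin n,
          ((if i < r then
              sgn K (m r + m j) • (ι K s n θ (c 1 r j) * ι K s n θ (c 0 i r)) else 0)
            + (if r < j then
              sgn K (m r + m j) • (ι K s n θ (c 0 r j) * ι K s n θ (c 1 i r)) else 0))
  | c (p + 2) i j =>
      ∑ q ∈ Finset.range (p + 3), ∑ r : Fin n,
        sgn K (m r + m j) • (ι K s n θ (c (p + 2 - q) r j) * ι K s n θ (c q i r))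

/-- The DG-subalgebra `A_n^k` generated over `k` by the `c^0_{ij}` and `c^1_{ij}`. -/
def Asub : Subalgebra K (IAlgBC K s n θ) :=
  Algebra.adjoin K
    ({x | ∃ v, x = ι K s n θ (b v)} ∪ {x | ∃ i j, x = ι K s n θ (c 0 i j)}
      ∪ {x | ∃ i j, x = ι K s n θ (c 1 i j)})

def IsDiff (D : IAlgBC K s n θ →ₗ[K] IAlgBC K s n θ) : Prop :=
  (∀ v : Fin s, D (ι K s n θ (b v)) = 0) ∧
  (∀ g : Gen s n, D (ι K s n θ g) = Dval K s n θ m g) ∧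
  (∀ (d : ℤ) (a x : IAlgBC K s n θ), a ∈ Hgr K s n θ m d →
    D (a * x) = D a * x + sgn K d • (a * D x))

/-- The chain `c^q_{k_L j} ⋯ c^1_{k_1 k_2} c^1_{i k_1}`. -/
def chainQ (q : ℕ) : Fin n → List (Fin n) → Fin n → IAlgBC K s n θ
  | i, [], j => ι K s n θ (c q i j)
  | i, k :: ks, j => chainQ q k ks j * ι K s n θ (c 1 i k)

/-- The value of the retraction on `c^p_{ij}` for `p > 1`, given by the same
Catalan-number formula as over `k_n`. -/
def Rval (p : ℕ) (i j : Fin n) : IAlgBC K s n θ :=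
  (catalan (p - 1) : K) •
    ∑ ks : Fin (2 * (p - 1)) → Fin n,
      sgn K (∑ t, m (ks t)) • chainQ K s n θ 1 i (List.ofFn ks) j

end InternalAlgebraBC

open InternalAlgebraBC Gen

/-! ### Entrywise maps on power series of matrices -/

section PowerSeriesMatrix

open PowerSeries

variable {K A N : Type*} [Field K] [Ring A] [Algebra K A] [Fintype N] [DecidableEq N]

theorem map_mul_of_twisted {f u v : A →ₗ[K] A}
    (hf : ∀ x y, f (x * y) = f x * u y + v x * f y) (M L : Matrix N N A) :
    (M * L).map f = M.map f * L.map u + M.map v * L.map f := by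
  ext i j
  simp [Matrix.mul_apply, hf, Finset.sum_add_distrib]

/-- The entrywise application of a linear map to all coefficients of a power series. -/
noncomputable def coeffMap (f : A →ₗ[K] A) : (Matrix N N A)⟦X⟧ →+ (Matrix N N A)⟦X⟧ where
  toFun F := PowerSeries.mk fun p => (coeff p F).map f
  map_zero' := by ext; simp
  map_add' F G := by ext; simp

@[simp] theorem coeff_coeffMap (f : A →ₗ[K] A) (F : (Matrix N N A)⟦X⟧) (p : ℕ) :
    coeff p (coeffMap f F) = (coeff p F).map f := by
  simp [coeffMap]

@[simp] theorem coeffMap_C (f : A →ₗ[K] A) (M : Matrix N N A) :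
    coeffMap f (C M) = C (M.map f) := by
  ext p i j
  rw [coeff_coeffMap, coeff_C, coeff_C]
  split_ifs <;> simp

@[simp] theorem coeffMap_X_mul (f : A →ₗ[K] A) (F : (Matrix N N A)⟦X⟧) :
    coeffMap f (X * F) = X * coeffMap f F := by
  ext p i j
  cases p <;> simp [coeff_succ_X_mul]

theorem coeffMap_mul_of_twisted {f u v : A →ₗ[K] A}
    (hf : ∀ x y, f (x * y) = f x * u y + v x * f y) (F G : (Matrix N N A)⟦X⟧) :
    coeffMap f (F * G) = coeffMap f F * coeffMap u G + coeffMap v F * coeffMap f G := by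
  ext p : 1
  rw [coeff_coeffMap, map_add, coeff_mul, coeff_mul, coeff_mul, ← Finset.sum_add_distrib]
  simp only [coeff_coeffMap, ← map_mul_of_twisted hf]
  exact map_sum (f.mapMatrix (m := N) (n := N)) _ _

theorem coeffMap_mul_of_mul {u : A →ₗ[K] A} (hu : ∀ x y, u (x * y) = u x * u y)
    (F G : (Matrix N N A)⟦X⟧) :
    coeffMap u (F * G) = coeffMap u F * coeffMap u G := by
  simpa [show coeffMap (N := N) (0 : A →ₗ[K] A) = 0 by ext; simp] using
    coeffMap_mul_of_twisted (f := u) (u := u) (v := 0) (by simp [hu]) F G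

@[simp] theorem coeffMap_id (F : (Matrix N N A)⟦X⟧) :
    coeffMap (LinearMap.id : A →ₗ[K] A) F = F := by
  ext; simp

/-- A diagonal matrix with entries in the ground field. -/
def scalarDiag (A : Type*) [Ring A] [Algebra K A] (e : N → K) : Matrix N N A :=
  Matrix.diagonal fun i => algebraMap K A (e i)

theorem scalarDiag_mul_apply (e : N → K) (M : Matrix N N A) (i j : N) :
    (scalarDiag A e * M) i j = e i • M i j := by
  simp [scalarDiag, Matrix.diagonal_mul, Algebra.smul_def]

theorem mul_scalarDiag_apply (e : N → K) (M : Matrix N N A) (i j : N) :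
    (M * scalarDiag A e) i j = e j • M i j := by
  simp [scalarDiag, Matrix.mul_diagonal, Algebra.smul_def, Algebra.commutes]

theorem map_scalarDiag_mul (f : A →ₗ[K] A) (e : N → K) (M : Matrix N N A) :
    (scalarDiag A e * M).map f = scalarDiag A e * M.map f := by
  ext i j
  simp [scalarDiag_mul_apply]

theorem coeffMap_scalarDiag_mul (f : A →ₗ[K] A) (e : N → K) (F : (Matrix N N A)⟦X⟧) :
    coeffMap f (C (scalarDiag A e) * F) = C (scalarDiag A e) * coeffMap f F := by
  ext p : 1
  simp [map_scalarDiag_mul]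

theorem scalarDiag_mul_self {e : N → K} (he : ∀ i, e i * e i = 1) :
    scalarDiag A e * scalarDiag A e = 1 := by
  simp [scalarDiag, ← map_mul, he]

/-- The power series `f(M² X)`. -/
noncomputable def evalSq (M : Matrix N N A) (f : K⟦X⟧) : (Matrix N N A)⟦X⟧ :=
  PowerSeries.mk fun k => coeff k f • M ^ (2 * k)

@[simp] theorem coeff_evalSq (M : Matrix N N A) (f : K⟦X⟧) (k : ℕ) :
    coeff k (evalSq M f) = coeff k f • M ^ (2 * k) := by
  simp [evalSq]

theorem evalSq_mul (M : Matrix N N A) (f g : K⟦X⟧) :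
    evalSq M (f * g) = evalSq M f * evalSq M g := by
  ext p : 1
  rw [coeff_evalSq, coeff_mul, coeff_mul, Finset.sum_smul]
  refine Finset.sum_congr rfl fun x hx => ?_
  obtain rfl := Finset.HasAntidiagonal.mem_antidiagonal.1 hx
  rw [coeff_evalSq, coeff_evalSq, smul_mul_smul_comm, ← pow_add,
    mul_add]

theorem evalSq_add (M : Matrix N N A) (f g : K⟦X⟧) :
    evalSq M (f + g) = evalSq M f + evalSq M g := by
  ext p : 1
  simp [add_smul]

theorem evalSq_one (M : Matrix N N A) : evalSq M (1 : K⟦X⟧) = 1 := by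
  ext p : 1
  rw [coeff_evalSq, coeff_one, coeff_one]
  split_ifs with h <;> simp [h]

theorem evalSq_X (M : Matrix N N A) : evalSq M (X : K⟦X⟧) = X * (C M * C M) := by
  ext p : 1
  rw [coeff_evalSq, coeff_X, ← map_mul]
  rcases p with _ | _ | p
  · simp
  · simp [coeff_succ_X_mul, sq]
  · simp [coeff_succ_X_mul]

theorem evalSq_mul_C (M : Matrix N N A) (f : K⟦X⟧) :
    evalSq M f * C M = C M * evalSq M f := by
  ext p : 1
  simp [← pow_succ, ← pow_succ']

theorem evalSq_X_mul_mul (M : Matrix N N A) (f g : K⟦X⟧) :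
    evalSq M (X * (f * g)) = X * (evalSq M f * C M * (evalSq M g * C M)) := by
  rw [evalSq_mul, evalSq_mul, evalSq_X, mul_assoc X]
  congr 1
  rw [evalSq_mul_C M f, evalSq_mul_C M g, mul_assoc, mul_assoc, ← mul_assoc (evalSq M f),
    evalSq_mul_C M f, mul_assoc]

/-- The generating series of the Catalan numbers. -/
noncomputable def catalanGF (K : Type*) [Field K] : K⟦X⟧ := PowerSeries.mk fun k => (catalan k : K)

theorem catalanGF_eq : catalanGF K = 1 + X * (catalanGF K * catalanGF K) := by
  ext p
  rcases p with _ | p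
  · simp [catalanGF]
  · rw [map_add, coeff_succ_X_mul, coeff_mul]
    simp [catalanGF, catalan_succ', coeff_one]

/-- The generating series `1 / (1 - 2 X c(X))` of the central binomial coefficients. -/
noncomputable def centralGF (K : Type*) [Field K] : K⟦X⟧ := (1 - 2 * (X * catalanGF K))⁻¹

theorem centralGF_eq :
    centralGF K = 1 + X * (centralGF K * catalanGF K) + X * (catalanGF K * centralGF K) := by
  have h : (1 - 2 * (X * catalanGF K)) * centralGF K = 1 :=
    PowerSeries.mul_inv_cancel _ (by simp)
  linear_combination h

/-- The image `M₀ + X c(M₁² X) M₁` of the generating matrix under the retraction. -/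
noncomputable def retractSeries (K : Type*) [Field K] [Algebra K A] (M₀ M₁ : Matrix N N A) :
    (Matrix N N A)⟦X⟧ :=
  C M₀ + X * (evalSq M₁ (catalanGF K) * C M₁)

/-- The left multiplier defining the contracting homotopy. -/
noncomputable def homotopySeries (K : Type*) [Field K] [Algebra K A] (M₁ : Matrix N N A) :
    (Matrix N N A)⟦X⟧ :=
  evalSq M₁ (centralGF K) * C M₁

variable {D σ : A →ₗ[K] A} {e : N → K} {M₀ M₁ Δ : Matrix N N A}

theorem map_mul_of_sign {a b : K} {M L : Matrix N N A}
    (hσ : ∀ x y, σ (x * y) = σ x * σ y) (he : ∀ i, e i * e i = 1)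
    (hM : M.map σ = a • (scalarDiag A e * M * scalarDiag A e))
    (hL : L.map σ = b • (scalarDiag A e * L * scalarDiag A e)) :
    (M * L).map σ = (a * b) • (scalarDiag A e * (M * L) * scalarDiag A e) := by
  have hS := scalarDiag_mul_self (A := A) he
  have h := map_mul_of_twisted (f := σ) (u := σ) (v := 0) (by simp [hσ]) M L
  have h0 : M.map (0 : A →ₗ[K] A) = 0 := by ext; simp
  rw [h, h0, zero_mul, add_zero, hM, hL, smul_mul_smul_comm]
  congr 1
  calc _ = scalarDiag A e * M * (scalarDiag A e * scalarDiag A e) * L * scalarDiag A e := by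
        simp only [mul_assoc]
    _ = _ := by rw [hS]; simp only [mul_assoc, one_mul]

theorem map_pow_of_odd (hσ : ∀ x y, σ (x * y) = σ x * σ y) (hσ1 : σ 1 = 1)
    (he : ∀ i, e i * e i = 1)
    (hM : M₁.map σ = (-1 : K) • (scalarDiag A e * M₁ * scalarDiag A e)) (k : ℕ) :
    (M₁ ^ k).map σ = ((-1) ^ k : K) • (scalarDiag A e * M₁ ^ k * scalarDiag A e) := by
  induction k with
  | zero => simp [scalarDiag_mul_self he, Matrix.map_one σ (map_zero σ) hσ1]
  | succ k ih => rw [pow_succ, pow_succ]; exact map_mul_of_sign hσ he ih hM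

theorem coeffMap_evalSq_mul_C_of_odd (hσ : ∀ x y, σ (x * y) = σ x * σ y) (hσ1 : σ 1 = 1)
    (he : ∀ i, e i * e i = 1)
    (hM : M₁.map σ = (-1 : K) • (scalarDiag A e * M₁ * scalarDiag A e)) (f : K⟦X⟧) :
    coeffMap σ (evalSq M₁ f * C M₁)
      = -(C (scalarDiag A e) * (evalSq M₁ f * C M₁) * C (scalarDiag A e)) := by
  ext p : 1
  have h := map_pow_of_odd hσ hσ1 he hM (2 * p + 1)
  have h' : (coeff p f • M₁ ^ (2 * p + 1)).map σ = coeff p f • (M₁ ^ (2 * p + 1)).map σ := by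
    ext; simp
  simp only [coeff_coeffMap, coeff_mul_C, coeff_C_mul, coeff_evalSq, map_neg, smul_mul_assoc,
    ← pow_succ, h', h, mul_smul_comm]
  simp [pow_succ]

theorem map_pow_two_mul (hD : ∀ x y, D (x * y) = D x * y + σ x * D y)
    (hσ : ∀ x y, σ (x * y) = σ x * σ y) (hσ1 : σ 1 = 1) (hD1 : D 1 = 0)
    (he : ∀ i, e i * e i = 1)
    (hM : M₁.map σ = (-1 : K) • (scalarDiag A e * M₁ * scalarDiag A e))
    (hDM : M₁.map D = scalarDiag A e * (Δ + M₁ * M₀ + M₀ * M₁))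
    (hΔl : Δ * M₁ = M₁) (hΔr : M₁ * Δ = M₁) (k : ℕ) :
    (M₁ ^ (2 * k)).map D
      = scalarDiag A e * (M₀ * M₁ ^ (2 * k) - M₁ ^ (2 * k) * M₀) := by
  have hS : ∀ Z, scalarDiag A e * (scalarDiag A e * Z) = Z := fun Z => by
    rw [← mul_assoc, scalarDiag_mul_self he, one_mul]
  have key := map_mul_of_twisted (N := N) (f := D) (u := LinearMap.id) (v := σ) hD
  have hid : ∀ Z : Matrix N N A, Z.map (LinearMap.id : A →ₗ[K] A) = Z := fun Z => by ext; simp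
  have h2 : (M₁ * M₁).map D = scalarDiag A e * (M₀ * (M₁ * M₁) - (M₁ * M₁) * M₀) := by
    rw [key, hid, hM, hDM]
    simp only [neg_smul, one_smul, mul_add, add_mul, mul_sub, neg_mul, mul_assoc, hS, hΔl, hΔr]
    abel
  induction k with
  | zero => ext i j; by_cases h : i = j <;> simp [h, hD1]
  | succ k ih =>
    have h3 := map_pow_of_odd hσ hσ1 he hM (2 * k)
    rw [pow_mul (-1 : K), neg_one_sq, one_pow, one_smul] at h3
    rw [show 2 * (k + 1) = 2 * k + 2 by ring, pow_add, sq, key, hid, ih, h2, h3]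
    simp only [mul_sub, sub_mul, mul_assoc, hS]
    abel

theorem coeffMap_evalSq_mul_C (hD : ∀ x y, D (x * y) = D x * y + σ x * D y)
    (hσ : ∀ x y, σ (x * y) = σ x * σ y) (hσ1 : σ 1 = 1) (hD1 : D 1 = 0)
    (he : ∀ i, e i * e i = 1)
    (hM : M₁.map σ = (-1 : K) • (scalarDiag A e * M₁ * scalarDiag A e))
    (hDM : M₁.map D = scalarDiag A e * (Δ + M₁ * M₀ + M₀ * M₁))
    (hΔl : Δ * M₁ = M₁) (hΔr : M₁ * Δ = M₁) (f : K⟦X⟧) :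
    coeffMap D (evalSq M₁ f * C M₁)
      = C (scalarDiag A e) * (C M₀ * (evalSq M₁ f * C M₁) + evalSq M₁ f * C M₁ * C M₀
          + evalSq M₁ f * C Δ) := by
  have hS : ∀ Z, scalarDiag A e * (scalarDiag A e * Z) = Z := fun Z => by
    rw [← mul_assoc, scalarDiag_mul_self he, one_mul]
  have key := map_mul_of_twisted (N := N) (f := D) (u := LinearMap.id) (v := σ) hD
  have hid : ∀ Z : Matrix N N A, Z.map (LinearMap.id : A →ₗ[K] A) = Z := fun Z => by ext; simp
  ext p : 1
  have h3 := map_pow_of_odd hσ hσ1 he hM (2 * p)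
  rw [pow_mul (-1 : K), neg_one_sq, one_pow, one_smul] at h3
  have h4 : (M₁ ^ (2 * p) * M₁).map D = scalarDiag A e * (M₀ * (M₁ ^ (2 * p) * M₁)
      + M₁ ^ (2 * p) * M₁ * M₀ + M₁ ^ (2 * p) * Δ) := by
    rw [key, hid, map_pow_two_mul hD hσ hσ1 hD1 he hM hDM hΔl hΔr, h3, hDM]
    simp only [mul_add, mul_sub, sub_mul, mul_assoc, hS]
    abel
  have h5 : (coeff p f • (M₁ ^ (2 * p) * M₁)).map D
      = coeff p f • (M₁ ^ (2 * p) * M₁).map D := by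
    ext; simp
  simp only [coeff_coeffMap, coeff_mul_C, coeff_C_mul, coeff_evalSq, map_add, smul_mul_assoc,
    h5, h4, ← smul_add, mul_smul_comm]

theorem coeffMap_retractSeries (hD : ∀ x y, D (x * y) = D x * y + σ x * D y)
    (hσ : ∀ x y, σ (x * y) = σ x * σ y) (hσ1 : σ 1 = 1) (hD1 : D 1 = 0)
    (he : ∀ i, e i * e i = 1)
    (hM : M₁.map σ = (-1 : K) • (scalarDiag A e * M₁ * scalarDiag A e))
    (hDM : M₁.map D = scalarDiag A e * (Δ + M₁ * M₀ + M₀ * M₁))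
    (hDM₀ : M₀.map D = scalarDiag A e * (M₀ * M₀))
    (hΔl : Δ * M₁ = M₁) (hΔr : M₁ * Δ = M₁) :
    coeffMap D (retractSeries K M₀ M₁) = C (scalarDiag A e) *
      (retractSeries K M₀ M₁ * retractSeries K M₀ M₁ + X * C Δ) := by
  set c := evalSq M₁ (catalanGF K) with hc
  have hX : ∀ Z W : (Matrix N N A)⟦X⟧, Z * (X * W) = X * (Z * W) := fun Z W => by
    rw [← mul_assoc, ← X_mul, mul_assoc]
  have hcΔ : c * C M₁ * C Δ = c * C M₁ := by rw [mul_assoc, ← map_mul, hΔr]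
  have hcat : c * C Δ = C Δ + X * (c * C M₁ * (c * C M₁)) := by
    conv_lhs => rw [hc, catalanGF_eq, evalSq_add, evalSq_one, evalSq_X_mul_mul, ← hc]
    rw [add_mul, one_mul, mul_assoc X, mul_assoc (c * C M₁), hcΔ]
  rw [retractSeries, map_add, coeffMap_C, coeffMap_X_mul,
    coeffMap_evalSq_mul_C hD hσ hσ1 hD1 he hM hDM hΔl hΔr, hDM₀, ← hc, hcat, map_mul, map_mul]
  simp only [mul_add, add_mul, hX, mul_assoc]
  abel

theorem coeffMap_homotopySeries (hD : ∀ x y, D (x * y) = D x * y + σ x * D y)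
    (hσ : ∀ x y, σ (x * y) = σ x * σ y) (hσ1 : σ 1 = 1) (hD1 : D 1 = 0)
    (he : ∀ i, e i * e i = 1)
    (hM : M₁.map σ = (-1 : K) • (scalarDiag A e * M₁ * scalarDiag A e))
    (hDM : M₁.map D = scalarDiag A e * (Δ + M₁ * M₀ + M₀ * M₁))
    (hΔl : Δ * M₁ = M₁) (hΔr : M₁ * Δ = M₁) :
    coeffMap D (homotopySeries K M₁) = C (scalarDiag A e) *
      (homotopySeries K M₁ * retractSeries K M₀ M₁
        + retractSeries K M₀ M₁ * homotopySeries K M₁ + C Δ) := by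
  set c := evalSq M₁ (catalanGF K) with hc
  set a := evalSq M₁ (centralGF K) with ha
  have hX : ∀ Z W : (Matrix N N A)⟦X⟧, Z * (X * W) = X * (Z * W) := fun Z W => by
    rw [← mul_assoc, ← X_mul, mul_assoc]
  have hcΔ : c * C M₁ * C Δ = c * C M₁ := by rw [mul_assoc, ← map_mul, hΔr]
  have haΔ : a * C M₁ * C Δ = a * C M₁ := by rw [mul_assoc, ← map_mul, hΔr]
  have hcen : a * C Δ = C Δ + X * (a * C M₁ * (c * C M₁)) + X * (c * C M₁ * (a * C M₁)) := by
    conv_lhs => rw [ha, centralGF_eq, evalSq_add, evalSq_add, evalSq_one, evalSq_X_mul_mul,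
      evalSq_X_mul_mul, ← hc, ← ha]
    rw [add_mul, add_mul, one_mul, mul_assoc X, mul_assoc X, mul_assoc (a * C M₁), hcΔ,
      mul_assoc (c * C M₁), haΔ]
  rw [homotopySeries, retractSeries,
    coeffMap_evalSq_mul_C hD hσ hσ1 hD1 he hM hDM hΔl hΔr, ← hc, ← ha, hcen]
  simp only [mul_add, add_mul, hX, mul_assoc]
  abel

theorem mul_retractSeries (h₀ : Δ * M₀ = M₀) (h₁ : Δ * M₁ = M₁) :
    C Δ * retractSeries K M₀ M₁ = retractSeries K M₀ M₁ := by
  rw [retractSeries, evalSq_mul_C, mul_add, ← mul_assoc, ← X_mul, mul_assoc, ← mul_assoc (C Δ),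
    ← map_mul, ← map_mul, h₀, h₁]

theorem retractSeries_mul (h₀ : M₀ * Δ = M₀) (h₁ : M₁ * Δ = M₁) :
    retractSeries K M₀ M₁ * C Δ = retractSeries K M₀ M₁ := by
  rw [retractSeries, add_mul, mul_assoc, mul_assoc, ← map_mul, ← map_mul, h₀, h₁]

theorem mul_homotopySeries (h₁ : Δ * M₁ = M₁) :
    C Δ * homotopySeries K M₁ = homotopySeries K M₁ := by
  rw [homotopySeries, evalSq_mul_C, ← mul_assoc, ← map_mul, h₁]

theorem coeff_zero_retractSeries : coeff 0 (retractSeries K M₀ M₁) = M₀ := by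
  simp [retractSeries]

theorem coeff_succ_retractSeries (p : ℕ) :
    coeff (p + 1) (retractSeries K M₀ M₁) = (catalan p : K) • M₁ ^ (2 * p + 1) := by
  rw [retractSeries, map_add, coeff_succ_X_mul, coeff_mul_C, coeff_evalSq, smul_mul_assoc,
    ← pow_succ, coeff_C, if_neg (Nat.succ_ne_zero p), zero_add, catalanGF, coeff_mk]

theorem coeffMap_retractSeries_of_odd (hσ : ∀ x y, σ (x * y) = σ x * σ y) (hσ1 : σ 1 = 1)
    (he : ∀ i, e i * e i = 1)
    (hM₀ : M₀.map σ = (-1 : K) • (scalarDiag A e * M₀ * scalarDiag A e))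
    (hM : M₁.map σ = (-1 : K) • (scalarDiag A e * M₁ * scalarDiag A e)) :
    coeffMap σ (retractSeries K M₀ M₁)
      = -(C (scalarDiag A e) * retractSeries K M₀ M₁ * C (scalarDiag A e)) := by
  rw [retractSeries, map_add, coeffMap_C, coeffMap_X_mul,
    coeffMap_evalSq_mul_C_of_odd hσ hσ1 he hM, hM₀, mul_add, add_mul, ← mul_assoc _ X, ← X_mul]
  simp only [neg_smul, one_smul, map_neg, map_mul, mul_neg, mul_assoc, neg_add]

theorem coeffMap_mul_of_odd (hσ : ∀ x y, σ (x * y) = σ x * σ y) (he : ∀ i, e i * e i = 1)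
    {F G : (Matrix N N A)⟦X⟧}
    (hF : coeffMap σ F = -(C (scalarDiag A e) * F * C (scalarDiag A e)))
    (hG : coeffMap σ G = -(C (scalarDiag A e) * G * C (scalarDiag A e))) :
    coeffMap σ (F * G) = C (scalarDiag A e) * (F * G) * C (scalarDiag A e) := by
  set S : (Matrix N N A)⟦X⟧ := C (scalarDiag A e) with hS
  have hSS : S * S = 1 := by
    rw [hS, ← map_mul, scalarDiag_mul_self he, map_one]
  rw [coeffMap_mul_of_mul hσ, hF, hG, neg_mul_neg]
  calc S * F * S * (S * G * S) = S * F * (S * S) * G * S := by simp only [mul_assoc]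
    _ = S * (F * G) * S := by rw [hSS]; simp only [mul_assoc, one_mul]

theorem coeffMap_homotopy {h v : A →ₗ[K] A} {F R G : (Matrix N N A)⟦X⟧}
    (he : ∀ i, e i * e i = 1)
    (hD : ∀ x y, D (x * y) = D x * y + σ x * D y)
    (hh : ∀ x y, h (x * y) = h x * y + v x * h y)
    (hvF : coeffMap v F = -(C (scalarDiag A e) * R * C (scalarDiag A e)))
    (hhF : coeffMap h F = C (scalarDiag A e) * (G * (F - R)))
    (hhΔ : Δ.map h = 0)
    (hDF : coeffMap D F = C (scalarDiag A e) * (F * F + X * C Δ))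
    (hDR : coeffMap D R = C (scalarDiag A e) * (R * R + X * C Δ))
    (hDG : coeffMap D G = C (scalarDiag A e) * (G * R + R * G + C Δ))
    (hσG : coeffMap σ G = -(C (scalarDiag A e) * G * C (scalarDiag A e)))
    (hΔF : C Δ * F = F) (hΔR : C Δ * R = R) :
    coeffMap D (coeffMap h F) + coeffMap h (coeffMap D F) = F - R := by
  set S : (Matrix N N A)⟦X⟧ := C (scalarDiag A e) with hS
  have hSS : ∀ Z, S * (S * Z) = Z := fun Z => by
    rw [← mul_assoc, hS, ← map_mul, scalarDiag_mul_self he, map_one, one_mul]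
  rw [hhF, hDF, coeffMap_scalarDiag_mul, coeffMap_scalarDiag_mul, map_add,
    coeffMap_mul_of_twisted (u := LinearMap.id) (v := v) hh, coeffMap_X_mul, coeffMap_C, hhΔ,
    coeffMap_mul_of_twisted (u := LinearMap.id) (v := σ) hD, map_sub, map_sub, hDF, hDR, hDG, hσG,
    hvF, hhF, coeffMap_id, coeffMap_id, ← hS]
  simp only [mul_add, add_mul, mul_sub, sub_mul, mul_neg, neg_mul, mul_assoc, hSS, hΔF, hΔR,
    map_zero, mul_zero]
  abel

end PowerSeriesMatrix

theorem neg_mul_add_mul_eq {A : Type*} [Ring A] (x y z w : A) :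
    -(x * y + z * w) = -x * y + z * -w := by
  rw [neg_add, neg_mul, mul_neg]

/-- The anticommutator of two compatible twisted derivations is a twisted derivation. -/
theorem anticommutator_mul {K A : Type*} [CommRing K] [Ring A] [Algebra K A]
    {D h : A →ₗ[K] A} {σ r : A →ₐ[K] A}
    (hD : ∀ x y, D (x * y) = D x * y + σ x * D y)
    (hh : ∀ x y, h (x * y) = h x * y + σ (r x) * h y)
    (hσ : ∀ x, σ (σ x) = x) (hσh : ∀ x, σ (h x) = -h (σ x)) (hrσ : ∀ x, r (σ x) = σ (r x))
    (hσr : ∀ x, D (σ (r x)) = -σ (r (D x))) (x y : A) :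
    (D.comp h + h.comp D) (x * y)
      = (D.comp h + h.comp D) x * y + r x * (D.comp h + h.comp D) y := by
  simp only [LinearMap.add_apply, LinearMap.comp_apply, hh, hD, map_add, hσh, hσr, hrσ, hσ,
    add_mul, mul_add, neg_mul]
  abel

theorem neg_mul_comm_smul {K A : Type*} [CommRing K] [AddCommGroup A] [Module K A] (a b : K)
    (x : A) : (a * b) • x = -(-(b * a) • x) := by
  rw [neg_smul, neg_neg, mul_comm]


/-! ### The base-changed internal algebra -/

namespace InternalAlgebraBC

variable {K : Type} [Field K] {s n : ℕ} {θ : (Fin n → K) →ₐ[K] (Fin s → K)} {m : Fin n → ℤ}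

theorem IAlgBC.induction {P : IAlgBC K s n θ → Prop} (halg : ∀ k : K, P (algebraMap K _ k))
    (hι : ∀ g, P (ι K s n θ g)) (hadd : ∀ x y, P x → P y → P (x + y))
    (hmul : ∀ x y, P x → P y → P (x * y)) (x : IAlgBC K s n θ) : P x := by
  obtain ⟨x, rfl⟩ := RingQuot.mkAlgHom_surjective K (Rel K s n θ) x
  induction x using FreeAlgebra.induction with
  | grade0 k => rw [AlgHom.commutes]; exact halg k
  | grade1 g => exact hι g
  | mul x y hx hy => rw [map_mul]; exact hmul _ _ hx hy
  | add x y hx hy => rw [map_add]; exact hadd _ _ hx hy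

theorem IAlgBC.algHom_eq {B : Type*} [Ring B] [Algebra K B] {f g : IAlgBC K s n θ →ₐ[K] B}
    (h : ∀ x, f (ι K s n θ x) = g (ι K s n θ x)) (x : IAlgBC K s n θ) : f x = g x := by
  induction x using IAlgBC.induction with
  | halg k => simp
  | hι g => exact h g
  | hadd x y hx hy => simp [hx, hy]
  | hmul x y hx hy => simp [hx, hy]

theorem IAlgBC.exists_lift {B : Type*} [Ring B] [Algebra K B] (f : Gen s n → B)
    (hidem : ∀ v, f (b v) * f (b v) = f (b v))
    (horth : ∀ v w, v ≠ w → f (b v) * f (b w) = 0)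
    (htotal : ∑ v, f (b v) = 1)
    (hleft : ∀ p i j, (∑ v, θe K s n θ j v • f (b v)) * f (c p i j) = f (c p i j))
    (hright : ∀ p i j, f (c p i j) * (∑ v, θe K s n θ i v • f (b v)) = f (c p i j))
    (hzero : ∀ i j, ¬ i < j → f (c 0 i j) = 0) :
    ∃ φ : IAlgBC K s n θ →ₐ[K] B, ∀ g, φ (ι K s n θ g) = f g := by
  refine ⟨RingQuot.liftAlgHom K ⟨FreeAlgebra.lift K f, ?_⟩, fun g => ?_⟩
  · rintro _ _ (_ | _ | _ | _ | _ | _)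
    · simp [hidem]
    · simp [*]
    · simp [htotal]
    · simp [embF, hleft]
    · simp [embF, hright]
    · simp [*]
  · simp [ι, RingQuot.liftAlgHom_mkAlgHom_apply]

theorem ι_b_mul_self (v : Fin s) :
    ι K s n θ (b v) * ι K s n θ (b v) = ι K s n θ (b v) := by
  simpa [ι] using RingQuot.mkAlgHom_rel K (Rel.idem (K := K) (θ := θ) v)

theorem ι_b_mul_of_ne {v w : Fin s} (h : v ≠ w) :
    ι K s n θ (b v) * ι K s n θ (b w) = 0 := by
  simpa [ι] using RingQuot.mkAlgHom_rel K (Rel.orth (K := K) (θ := θ) v w h)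

theorem sum_ι_b : ∑ v, ι K s n θ (b v) = 1 := by
  simpa [ι] using RingQuot.mkAlgHom_rel K (Rel.total (K := K) (θ := θ))

theorem θeQ_mul_ι (p : ℕ) (i j : Fin n) :
    θeQ K s n θ j * ι K s n θ (c p i j) = ι K s n θ (c p i j) := by
  simpa [ι, embF, θeQ] using RingQuot.mkAlgHom_rel K (Rel.left (K := K) (θ := θ) p i j)

theorem ι_mul_θeQ (p : ℕ) (i j : Fin n) :
    ι K s n θ (c p i j) * θeQ K s n θ i = ι K s n θ (c p i j) := by
  simpa [ι, embF, θeQ] using RingQuot.mkAlgHom_rel K (Rel.right (K := K) (θ := θ) p i j)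

theorem ι_c_zero {i j : Fin n} (h : ¬ i < j) : ι K s n θ (c 0 i j) = 0 := by
  simpa [ι] using RingQuot.mkAlgHom_rel K (Rel.czero (K := K) (θ := θ) i j h)

theorem sgn_add (x y : ℤ) : sgn K (x + y) = sgn K x * sgn K y := by
  by_cases hx : Even x <;> by_cases hy : Even y <;> simp [sgn, Int.even_add, hx, hy]

theorem sgn_mul_self (x : ℤ) : sgn K x * sgn K x = 1 := by
  by_cases hx : Even x <;> simp [sgn, hx]

theorem sgn_dg_c (p : ℕ) (i j : Fin n) :
    sgn K (dg s n m (c p i j)) = -(sgn K (m j) * sgn K (m i)) := by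
  have h : sgn K (1 - 2 * (p : ℤ)) = -1 := by
    simp [sgn, Int.even_sub]
  have h' : sgn K (-m i) = sgn K (m i) := by simp [sgn]
  rw [dg, sub_eq_add_neg _ (m i), sgn_add, sgn_add, h, h']
  ring

/-- Two twisted derivations that agree on the generators are equal. -/
theorem twisted_eq {F G : IAlgBC K s n θ →ₗ[K] IAlgBC K s n θ}
    {u v : IAlgBC K s n θ → IAlgBC K s n θ}
    (hF : ∀ x y, F (x * y) = F x * u y + v x * F y)
    (hG : ∀ x y, G (x * y) = G x * u y + v x * G y)
    (h : ∀ g, F (ι K s n θ g) = G (ι K s n θ g)) (x : IAlgBC K s n θ) : F x = G x := by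
  induction x using IAlgBC.induction with
  | halg k =>
    rw [Algebra.algebraMap_eq_smul_one, map_smul, map_smul, ← sum_ι_b, map_sum, map_sum]
    simp [h]
  | hι g => exact h g
  | hadd x y hx hy => simp [hx, hy]
  | hmul x y hx hy => simp [hF, hG, hx, hy]

/-- The diagonal matrix of signs `(-1) ^ m i`. -/
noncomputable abbrev signMat (θ : (Fin n → K) →ₐ[K] (Fin s → K)) (m : Fin n → ℤ) :
    Matrix (Fin n) (Fin n) (IAlgBC K s n θ) :=
  scalarDiag _ fun i => sgn K (m i)

/-- The matrix with entry `(-1) ^ m j c^p_{ij}` at position `(j, i)`. -/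
def genMat (θ : (Fin n → K) →ₐ[K] (Fin s → K)) (m : Fin n → ℤ) (p : ℕ) :
    Matrix (Fin n) (Fin n) (IAlgBC K s n θ) :=
  Matrix.of fun j i => sgn K (m j) • ι K s n θ (c p i j)

/-- The diagonal matrix of the idempotents `θ(e i)`. -/
def idemMat (θ : (Fin n → K) →ₐ[K] (Fin s → K)) : Matrix (Fin n) (Fin n) (IAlgBC K s n θ) :=
  Matrix.diagonal (θeQ K s n θ)

open PowerSeries

/-- The generating series of the matrices `genMat θ m p`. -/
noncomputable def genSeries (θ : (Fin n → K) →ₐ[K] (Fin s → K)) (m : Fin n → ℤ) :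
    (Matrix (Fin n) (Fin n) (IAlgBC K s n θ))⟦X⟧ :=
  PowerSeries.mk (genMat θ m)

theorem sgn_smul_eq_iff {i : ℤ} {x y : IAlgBC K s n θ} :
    sgn K i • x = y ↔ x = sgn K i • y := by
  constructor <;> rintro rfl <;> simp [smul_smul, sgn_mul_self]

theorem coeffMap_genSeries {f : IAlgBC K s n θ →ₗ[K] IAlgBC K s n θ}
    {F : (Matrix (Fin n) (Fin n) (IAlgBC K s n θ))⟦X⟧} :
    coeffMap f (genSeries θ m) = F ↔
      ∀ p i j, f (ι K s n θ (c p i j)) = sgn K (m j) • coeff p F j i := by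
  rw [PowerSeries.ext_iff]
  refine forall_congr' fun p => ?_
  rw [← Matrix.ext_iff, forall_comm]
  refine forall_congr' fun i => forall_congr' fun j => ?_
  rw [← sgn_smul_eq_iff]
  simp [genSeries, genMat]

theorem idemMat_mul_genMat (p : ℕ) : idemMat θ * genMat θ m p = genMat θ m p := by
  ext j i
  simp [idemMat, genMat, Matrix.diagonal_mul, θeQ_mul_ι]

theorem genMat_mul_idemMat (p : ℕ) : genMat θ m p * idemMat θ = genMat θ m p := by
  ext j i
  simp [idemMat, genMat, Matrix.mul_diagonal, ι_mul_θeQ]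

theorem idemMat_mul_genSeries : C (idemMat θ) * genSeries θ m = genSeries θ m := by
  ext p : 1
  simp [genSeries, idemMat_mul_genMat]

theorem genSeries_mul_idemMat : genSeries θ m * C (idemMat θ) = genSeries θ m := by
  ext p : 1
  simp [genSeries, genMat_mul_idemMat]

theorem θeQ_mul_coeff {F : (Matrix (Fin n) (Fin n) (IAlgBC K s n θ))⟦X⟧}
    (hF : C (idemMat θ) * F = F) (p : ℕ) (i j : Fin n) :
    θeQ K s n θ j * coeff p F j i = coeff p F j i := by
  conv_rhs => rw [← hF, coeff_C_mul, idemMat, Matrix.diagonal_mul]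

theorem coeff_mul_θeQ {F : (Matrix (Fin n) (Fin n) (IAlgBC K s n θ))⟦X⟧}
    (hF : F * C (idemMat θ) = F) (p : ℕ) (i j : Fin n) :
    coeff p F j i * θeQ K s n θ i = coeff p F j i := by
  conv_rhs => rw [← hF, coeff_mul_C, idemMat, Matrix.mul_diagonal]

theorem genMat_mul_apply (p q : ℕ) (i j : Fin n) :
    (genMat θ m p * genMat θ m q) j i
      = ∑ r, sgn K (m r + m j) • (ι K s n θ (c p r j) * ι K s n θ (c q i r)) := by
  simp only [Matrix.mul_apply, genMat, Matrix.of_apply, smul_mul_smul_comm, sgn_add]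
  simp only [mul_comm]

theorem Dval_eq_coeff (p : ℕ) (i j : Fin n) :
    Dval K s n θ m (c p i j)
      = (coeff p (genSeries θ m * genSeries θ m + X * C (idemMat θ)) : Matrix _ _ _) j i := by
  rw [map_add, coeff_mul, Matrix.add_apply, Matrix.sum_apply]
  simp only [genSeries, coeff_mk, genMat_mul_apply]
  rcases p with _ | _ | p
  · simp only [Dval, Finset.Nat.antidiagonal_zero, Finset.sum_singleton, coeff_zero_X_mul,
      Matrix.zero_apply, add_zero]
    refine Finset.sum_congr rfl fun r _ => ?_
    by_cases h1 : i < r <;> by_cases h2 : r < j <;> simp [h1, h2, ι_c_zero]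
  · rw [show (0 + 1 : ℕ) = 1 from rfl, add_comm, show (1 : ℕ) = 0 + 1 from rfl, coeff_succ_X_mul,
      Finset.Nat.antidiagonal_succ]
    simp only [Dval, Finset.Nat.antidiagonal_zero, coeff_zero_C, idemMat, Matrix.diagonal_apply,
      zero_add, Finset.sum_cons, Finset.map_singleton, Finset.sum_singleton, eq_comm (a := j)]
    congr 1
    · split_ifs with h <;> simp [h]
    · simp only [Finset.sum_add_distrib]
      rw [add_comm]
      congr 1
      · refine Finset.sum_congr rfl fun r _ => ?_
        by_cases h : r < j <;> simp [h, ι_c_zero]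
      · refine Finset.sum_congr rfl fun r _ => ?_
        by_cases h : i < r <;> simp [h, ι_c_zero]
  · rw [Dval, coeff_succ_X_mul, coeff_C, if_neg (Nat.succ_ne_zero p), Matrix.zero_apply, add_zero,
      ← Finset.Nat.sum_antidiagonal_swap, Finset.Nat.sum_antidiagonal_eq_sum_range_succ_mk]
    rfl

theorem sum_chainQ (L : ℕ) (i j : Fin n) :
    ∑ ks : Fin L → Fin n, sgn K (∑ t, m (ks t)) • chainQ K s n θ 1 i (List.ofFn ks) j
      = sgn K (m j) • (genMat θ m 1 ^ (L + 1)) j i := by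
  induction L generalizing i with
  | zero =>
    have h : sgn K 0 = 1 := by simp [sgn]
    simp [chainQ, genMat, smul_smul, sgn_mul_self, h]
  | succ L ih =>
    rw [← (Fin.consEquiv fun _ => Fin n).sum_comp, Fintype.sum_prod_type, pow_succ,
      Matrix.mul_apply, Finset.smul_sum]
    refine Finset.sum_congr rfl fun k _ => ?_
    simp only [Fin.consEquiv_apply, List.ofFn_succ, Fin.cons_zero, Fin.cons_succ, chainQ,
      Fin.sum_univ_succ, sgn_add, mul_smul, ← smul_mul_assoc, ← Finset.sum_mul, ← Finset.smul_sum,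
      ih]
    simp only [genMat, Matrix.of_apply, mul_smul_comm, smul_mul_assoc]

/-- The differential is a derivation twisted by the grading automorphism. -/
theorem IsDiff.map_mul {D : IAlgBC K s n θ →ₗ[K] IAlgBC K s n θ} (hD : IsDiff K s n θ m D)
    {σ : IAlgBC K s n θ →ₐ[K] IAlgBC K s n θ}
    (hσ : ∀ g, σ (ι K s n θ g) = sgn K (dg s n m g) • ι K s n θ g) (x y : IAlgBC K s n θ) :
    D (x * y) = D x * y + σ x * D y := by
  have h1 : D 1 = 0 := by rw [← sum_ι_b, map_sum]; simp [hD.1]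
  induction x using IAlgBC.induction generalizing y with
  | halg k =>
    rw [AlgHom.commutes, ← Algebra.smul_def, ← Algebra.smul_def, Algebra.algebraMap_eq_smul_one,
      map_smul, map_smul, h1, smul_zero, zero_mul, zero_add]
  | hι g =>
    rw [hσ, smul_mul_assoc]
    exact hD.2.2 _ _ _ (Submodule.subset_span ⟨[g], by simp, by simp⟩)
  | hadd x x' hx hx' =>
    simp only [add_mul, map_add, hx, hx']
    abel
  | hmul x x' hx hx' =>
    rw [mul_assoc, hx, hx', hx, _root_.map_mul, add_mul, mul_add, mul_assoc, mul_assoc, mul_assoc,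
      add_assoc]

theorem exists_grading_aut (θ : (Fin n → K) →ₐ[K] (Fin s → K)) (m : Fin n → ℤ) :
    ∃ σ : IAlgBC K s n θ →ₐ[K] IAlgBC K s n θ,
      ∀ g, σ (ι K s n θ g) = sgn K (dg s n m g) • ι K s n θ g := by
  have hb : ∀ v, sgn K (dg s n m (b v)) • ι K s n θ (b v) = ι K s n θ (b v) := fun v => by
    simp [dg, sgn]
  refine IAlgBC.exists_lift _ (fun v => ?_) (fun v w h => ?_) ?_ (fun p i j => ?_)
    (fun p i j => ?_) (fun i j h => ?_)
  · rw [hb, ι_b_mul_self]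
  · rw [hb, hb, ι_b_mul_of_ne h]
  · simp only [hb, sum_ι_b]
  · simp only [hb, mul_smul_comm]
    exact congrArg _ (θeQ_mul_ι p i j)
  · simp only [hb, smul_mul_assoc]
    exact congrArg _ (ι_mul_θeQ p i j)
  · rw [ι_c_zero h, smul_zero]

/-- The value of the retraction on the generating series. -/
noncomputable abbrev retr (θ : (Fin n → K) →ₐ[K] (Fin s → K)) (m : Fin n → ℤ) :
    (Matrix (Fin n) (Fin n) (IAlgBC K s n θ))⟦X⟧ :=
  retractSeries K (genMat θ m 0) (genMat θ m 1)

theorem exists_retraction (θ : (Fin n → K) →ₐ[K] (Fin s → K)) (m : Fin n → ℤ) :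
    ∃ r : IAlgBC K s n θ →ₐ[K] IAlgBC K s n θ,
      (∀ v, r (ι K s n θ (b v)) = ι K s n θ (b v)) ∧
      ∀ p i j, r (ι K s n θ (c p i j)) = sgn K (m j) • coeff p (retr θ m) j i := by
  obtain ⟨r, hr⟩ := IAlgBC.exists_lift (θ := θ)
    (fun | b v => ι K s n θ (b v) | c p i j => sgn K (m j) • coeff p (retr θ m) j i)
    ι_b_mul_self (fun v w => ι_b_mul_of_ne) sum_ι_b
    (fun p i j => by
      rw [mul_smul_comm]
      exact congrArg _ (θeQ_mul_coeff
        (mul_retractSeries (idemMat_mul_genMat 0) (idemMat_mul_genMat 1)) p i j))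
    (fun p i j => by
      rw [smul_mul_assoc]
      exact congrArg _ (coeff_mul_θeQ
        (retractSeries_mul (genMat_mul_idemMat 0) (genMat_mul_idemMat 1)) p i j))
    (fun i j h => by simp [coeff_zero_retractSeries, genMat, ι_c_zero h])
  exact ⟨r, fun v => hr _, fun p i j => hr _⟩

/-- Twisted derivations correspond to homomorphisms into upper triangular matrices. -/
theorem exists_twisted_derivation {v : IAlgBC K s n θ →ₐ[K] IAlgBC K s n θ}
    (hv : ∀ w, v (ι K s n θ (b w)) = ι K s n θ (b w))
    (f : ℕ → Fin n → Fin n → IAlgBC K s n θ)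
    (hleft : ∀ p i j, θeQ K s n θ j * f p i j = f p i j)
    (hright : ∀ p i j, f p i j * θeQ K s n θ i = f p i j)
    (hzero : ∀ i j, ¬ i < j → f 0 i j = 0) :
    ∃ h : IAlgBC K s n θ →ₗ[K] IAlgBC K s n θ,
      (∀ x y, h (x * y) = h x * y + v x * h y) ∧
      (∀ w, h (ι K s n θ (b w)) = 0) ∧ ∀ p i j, h (ι K s n θ (c p i j)) = f p i j := by
  have hvθ : ∀ j, v (θeQ K s n θ j) = θeQ K s n θ j := fun j => by simp [θeQ, hv]
  have hsum : ∀ j, ∑ w, θe K s n θ j w •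
      (!![ι K s n θ (b w), 0; 0, ι K s n θ (b w)] : Matrix (Fin 2) (Fin 2) (IAlgBC K s n θ))
      = !![θeQ K s n θ j, 0; 0, θeQ K s n θ j] := fun j => by
    ext a a'
    fin_cases a <;> fin_cases a' <;> simp [Matrix.sum_apply, θeQ]
  obtain ⟨φ, hφ⟩ := IAlgBC.exists_lift (θ := θ) (B := Matrix (Fin 2) (Fin 2) (IAlgBC K s n θ))
    (fun
      | b w => !![ι K s n θ (b w), 0; 0, ι K s n θ (b w)]
      | c p i j => !![v (ι K s n θ (c p i j)), f p i j; 0, ι K s n θ (c p i j)])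
    (fun w => by simp [ι_b_mul_self])
    (fun w w' h => by
      ext a a'
      fin_cases a <;> fin_cases a' <;> simp [ι_b_mul_of_ne h])
    (by
      ext a a'
      fin_cases a <;> fin_cases a' <;> simp [Matrix.sum_apply, sum_ι_b])
    (fun p i j => by
      have h := congrArg v (θeQ_mul_ι (θ := θ) p i j)
      rw [map_mul, hvθ] at h
      simp only [hsum]
      simp [h, hleft, θeQ_mul_ι])
    (fun p i j => by
      have h := congrArg v (ι_mul_θeQ (θ := θ) p i j)
      rw [map_mul, hvθ] at h
      simp only [hsum]
      simp [h, hright, ι_mul_θeQ])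
    (fun i j h => by
      ext a a'
      fin_cases a <;> fin_cases a' <;> simp [ι_c_zero h, hzero i j h])
  have key : ∀ x, φ x 0 0 = v x ∧ φ x 1 0 = 0 ∧ φ x 1 1 = x := by
    refine IAlgBC.induction (fun k => ?_) (fun g => ?_) (fun x y hx hy => ?_) (fun x y hx hy => ?_)
    · simp [Matrix.algebraMap_matrix_apply]
    · rw [hφ]
      cases g <;> simp [hv]
    · simp [hx, hy]
    · simp [Matrix.mul_apply, Fin.sum_univ_two, hx, hy]
  refine ⟨(Matrix.entryLinearMap K _ 0 1).comp φ.toLinearMap, fun x y => ?_, fun w => ?_,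
    fun p i j => ?_⟩
  · simp [Matrix.mul_apply, Fin.sum_univ_two, key, add_comm]
  · simp [hφ]
  · simp [hφ]

theorem sgn_smul_coeff_signMat_mul (F : (Matrix (Fin n) (Fin n) (IAlgBC K s n θ))⟦X⟧) (p : ℕ)
    (i j : Fin n) :
    sgn K (m j) • (coeff p (C (signMat θ m) * F) : Matrix _ _ _) j i = coeff p F j i := by
  rw [coeff_C_mul, scalarDiag_mul_apply, smul_smul, sgn_mul_self, one_smul]

theorem idemMat_map {r : IAlgBC K s n θ →ₗ[K] IAlgBC K s n θ}
    (hr : ∀ v, r (ι K s n θ (b v)) = ι K s n θ (b v)) : (idemMat θ).map r = idemMat θ := by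
  rw [idemMat, Matrix.diagonal_map (map_zero r)]
  congr 1
  ext i
  simp [θeQ, hr]

theorem coeffMap_comp (f g : IAlgBC K s n θ →ₗ[K] IAlgBC K s n θ)
    (F : (Matrix (Fin n) (Fin n) (IAlgBC K s n θ))⟦X⟧) :
    coeffMap (f.comp g) F = coeffMap f (coeffMap g F) := by
  ext; simp

section Grading

variable {σ : IAlgBC K s n θ →ₐ[K] IAlgBC K s n θ}

theorem grading_b (hσ : ∀ g, σ (ι K s n θ g) = sgn K (dg s n m g) • ι K s n θ g) (v : Fin s) :
    σ (ι K s n θ (b v)) = ι K s n θ (b v) := by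
  simp [hσ, dg, sgn]

theorem grading_involutive (hσ : ∀ g, σ (ι K s n θ g) = sgn K (dg s n m g) • ι K s n θ g)
    (x : IAlgBC K s n θ) : σ (σ x) = x :=
  IAlgBC.algHom_eq (f := σ.comp σ) (g := AlgHom.id K _)
    (fun g => by simp [hσ, smul_smul, sgn_mul_self]) x

theorem genMat_map_grading (hσ : ∀ g, σ (ι K s n θ g) = sgn K (dg s n m g) • ι K s n θ g)
    (p : ℕ) :
    (genMat θ m p).map σ.toLinearMap
      = (-1 : K) • (signMat θ m * genMat θ m p * signMat θ m) := by
  ext j i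
  simp only [Matrix.map_apply, Matrix.smul_apply, mul_scalarDiag_apply, scalarDiag_mul_apply,
    genMat, Matrix.of_apply, map_smul, AlgHom.toLinearMap_apply, hσ, sgn_dg_c, smul_smul]
  congr 1
  ring

theorem genSeries_map_grading (hσ : ∀ g, σ (ι K s n θ g) = sgn K (dg s n m g) • ι K s n θ g) :
    coeffMap σ.toLinearMap (genSeries θ m)
      = -(C (signMat θ m) * genSeries θ m * C (signMat θ m)) := by
  ext p : 1
  rw [map_neg, coeff_mul_C, coeff_C_mul, coeff_coeffMap, genSeries, coeff_mk,
    genMat_map_grading hσ]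
  exact neg_one_smul K (signMat θ m * genMat θ m p * signMat θ m)

theorem retr_map_grading (hσ : ∀ g, σ (ι K s n θ g) = sgn K (dg s n m g) • ι K s n θ g) :
    coeffMap σ.toLinearMap (retr θ m) = -(C (signMat θ m) * retr θ m * C (signMat θ m)) :=
  coeffMap_retractSeries_of_odd (σ := σ.toLinearMap) (map_mul σ) (map_one σ)
    (fun _ => sgn_mul_self _) (genMat_map_grading hσ 0) (genMat_map_grading hσ 1)

theorem retraction_comm_grading
    (hσ : ∀ g, σ (ι K s n θ g) = sgn K (dg s n m g) • ι K s n θ g)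
    {r : IAlgBC K s n θ →ₐ[K] IAlgBC K s n θ}
    (hrb : ∀ v, r (ι K s n θ (b v)) = ι K s n θ (b v))
    (hrc : ∀ p i j, r (ι K s n θ (c p i j)) = sgn K (m j) • coeff p (retr θ m) j i)
    (x : IAlgBC K s n θ) : r (σ x) = σ (r x) := by
  refine IAlgBC.algHom_eq (f := r.comp σ) (g := σ.comp r) (fun g => ?_) x
  rcases g with v | ⟨p, i, j⟩
  · simp [grading_b hσ, hrb]
  · have h := congrArg (fun F => (coeff p F : Matrix _ _ _) j i) (retr_map_grading (m := m) hσ)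
    simp only [coeff_coeffMap, map_neg, coeff_mul_C, coeff_C_mul, Matrix.map_apply,
      Matrix.neg_apply, mul_scalarDiag_apply, scalarDiag_mul_apply, AlgHom.toLinearMap_apply] at h
    simp only [AlgHom.comp_apply, hσ, sgn_dg_c, map_smul, hrc, h, smul_smul, ← neg_smul]
    congr 1
    ring

theorem grading_coeff_of_even
    (hσ : ∀ g, σ (ι K s n θ g) = sgn K (dg s n m g) • ι K s n θ g)
    {F : (Matrix (Fin n) (Fin n) (IAlgBC K s n θ))⟦X⟧}
    (hF : coeffMap σ.toLinearMap F = C (signMat θ m) * F * C (signMat θ m))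
    {f : IAlgBC K s n θ →ₗ[K] IAlgBC K s n θ} {p : ℕ} {i j : Fin n}
    (hf : f (ι K s n θ (c p i j)) = coeff p F j i) :
    σ (f (ι K s n θ (c p i j))) = -f (σ (ι K s n θ (c p i j))) := by
  have h := congrArg (fun F => (coeff p F : Matrix _ _ _) j i) hF
  simp only [coeff_coeffMap, coeff_mul_C, coeff_C_mul, Matrix.map_apply,
    mul_scalarDiag_apply, scalarDiag_mul_apply, AlgHom.toLinearMap_apply] at h
  rw [hσ, map_smul, hf, h, sgn_dg_c, smul_smul]
  exact neg_mul_comm_smul _ _ _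

end Grading

section Differential

variable {D : IAlgBC K s n θ →ₗ[K] IAlgBC K s n θ} {r σ : IAlgBC K s n θ →ₐ[K] IAlgBC K s n θ}

theorem IsDiff.coeffMap_genSeries (hD : IsDiff K s n θ m D) :
    coeffMap D (genSeries θ m)
      = C (signMat θ m) * (genSeries θ m * genSeries θ m + X * C (idemMat θ)) := by
  rw [InternalAlgebraBC.coeffMap_genSeries]
  intro p i j
  rw [sgn_smul_coeff_signMat_mul, hD.2.1, Dval_eq_coeff]

theorem IsDiff.genMat_zero (hD : IsDiff K s n θ m D) :
    (genMat θ m 0).map D = signMat θ m * (genMat θ m 0 * genMat θ m 0) := by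
  simpa [genSeries, coeff_mul, -coeff_zero_eq_constantCoeff] using
    congrArg (coeff 0) hD.coeffMap_genSeries

theorem IsDiff.genMat_one (hD : IsDiff K s n θ m D) :
    (genMat θ m 1).map D = signMat θ m
      * (idemMat θ + genMat θ m 1 * genMat θ m 0 + genMat θ m 0 * genMat θ m 1) := by
  have h := congrArg (coeff 1) hD.coeffMap_genSeries
  rw [coeff_C_mul, map_add, ← zero_add 1, coeff_succ_X_mul, coeff_zero_C, coeff_mul,
    Finset.Nat.antidiagonal_succ] at h
  simp only [coeff_coeffMap, genSeries, coeff_mk, Finset.Nat.antidiagonal_zero, zero_add,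
    Finset.sum_cons, Finset.map_singleton, Finset.sum_singleton] at h
  rw [h]
  congr 1
  simp
  abel

theorem IsDiff.map_one (hD : IsDiff K s n θ m D) : D 1 = 0 := by
  rw [← sum_ι_b, map_sum]
  simp [hD.1]

theorem IsDiff.coeffMap_retr (hD : IsDiff K s n θ m D)
    (hσ : ∀ g, σ (ι K s n θ g) = sgn K (dg s n m g) • ι K s n θ g) :
    coeffMap D (retr θ m)
      = C (signMat θ m) * (retr θ m * retr θ m + X * C (idemMat θ)) :=
  coeffMap_retractSeries (σ := σ.toLinearMap) (hD.map_mul hσ) (_root_.map_mul σ) (_root_.map_one σ)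
    hD.map_one (fun _ => sgn_mul_self _) (genMat_map_grading hσ 1) hD.genMat_one hD.genMat_zero
    (idemMat_mul_genMat 1) (genMat_mul_idemMat 1)

theorem IsDiff.coeffMap_homotopySeries (hD : IsDiff K s n θ m D)
    (hσ : ∀ g, σ (ι K s n θ g) = sgn K (dg s n m g) • ι K s n θ g) :
    coeffMap D (homotopySeries K (genMat θ m 1)) = C (signMat θ m) *
      (homotopySeries K (genMat θ m 1) * retr θ m + retr θ m * homotopySeries K (genMat θ m 1)
        + C (idemMat θ)) :=
  _root_.coeffMap_homotopySeries (σ := σ.toLinearMap) (hD.map_mul hσ) (_root_.map_mul σ)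
    (_root_.map_one σ) hD.map_one (fun _ => sgn_mul_self _) (genMat_map_grading hσ 1)
    hD.genMat_one (idemMat_mul_genMat 1) (genMat_mul_idemMat 1)

theorem retraction_comm_diff (hD : IsDiff K s n θ m D)
    (hσ : ∀ g, σ (ι K s n θ g) = sgn K (dg s n m g) • ι K s n θ g)
    (hrb : ∀ v, r (ι K s n θ (b v)) = ι K s n θ (b v))
    (hrc : ∀ p i j, r (ι K s n θ (c p i j)) = sgn K (m j) • coeff p (retr θ m) j i)
    (x : IAlgBC K s n θ) : D (r x) = r (D x) := by
  have hM : coeffMap r.toLinearMap (genSeries θ m) = retr θ m := coeffMap_genSeries.2 hrc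
  refine twisted_eq (F := D.comp r.toLinearMap) (G := r.toLinearMap.comp D) (u := r)
    (v := fun x => σ (r x)) (fun x y => ?_) (fun x y => ?_) (fun g => ?_) x
  · simp [hD.map_mul hσ]
  · simp [hD.map_mul hσ, retraction_comm_grading hσ hrb hrc]
  · rcases g with v | ⟨p, i, j⟩
    · simp [hrb, hD.1]
    · rw [coeffMap_genSeries.1 rfl p i j, coeffMap_genSeries.1 rfl p i j, coeffMap_comp,
        coeffMap_comp, hM, hD.coeffMap_retr hσ, hD.coeffMap_genSeries, coeffMap_scalarDiag_mul,
        map_add, coeffMap_mul_of_mul (by simp), coeffMap_X_mul, coeffMap_C, hM,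
        idemMat_map (by simpa using hrb)]

theorem diff_anticomm_grading (hD : IsDiff K s n θ m D)
    (hσ : ∀ g, σ (ι K s n θ g) = sgn K (dg s n m g) • ι K s n θ g) (x : IAlgBC K s n θ) :
    σ (D x) = -D (σ x) := by
  refine twisted_eq (F := σ.toLinearMap.comp D) (G := -(D.comp σ.toLinearMap)) (u := σ)
    (v := id) (fun x y => ?_) (fun x y => ?_) (fun g => ?_) x
  · simp [hD.map_mul hσ, grading_involutive hσ]
  · simp only [LinearMap.neg_apply, LinearMap.comp_apply, AlgHom.toLinearMap_apply, _root_.map_mul,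
      hD.map_mul hσ, grading_involutive hσ, id]
    exact neg_mul_add_mul_eq _ _ _ _
  · rcases g with v | ⟨p, i, j⟩
    · simp [grading_b hσ, hD.1]
    · have hΔ : signMat θ m * idemMat θ * signMat θ m = idemMat θ := by
        ext i j
        rw [mul_scalarDiag_apply, scalarDiag_mul_apply, idemMat, Matrix.diagonal_apply, smul_smul]
        split_ifs with h
        · rw [h, sgn_mul_self, one_smul]
        · rw [smul_zero]
      have hΔσ : (idemMat θ).map σ.toLinearMap = idemMat θ :=
        idemMat_map fun v => grading_b hσ v
      refine grading_coeff_of_even hσ (F := genSeries θ m * genSeries θ m + X * C (idemMat θ)) ?_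
        (by rw [hD.2.1, Dval_eq_coeff])
      rw [map_add, coeffMap_mul_of_odd (map_mul σ) (fun _ => sgn_mul_self _)
        (genSeries_map_grading hσ) (genSeries_map_grading hσ), coeffMap_X_mul, coeffMap_C, hΔσ,
        mul_add, add_mul, ← mul_assoc _ X, ← X_mul, mul_assoc X, mul_assoc X, ← map_mul,
        ← map_mul, hΔ]

theorem exists_homotopy (hD : IsDiff K s n θ m D)
    (hσ : ∀ g, σ (ι K s n θ g) = sgn K (dg s n m g) • ι K s n θ g)
    (hrb : ∀ v, r (ι K s n θ (b v)) = ι K s n θ (b v))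
    (hrc : ∀ p i j, r (ι K s n θ (c p i j)) = sgn K (m j) • coeff p (retr θ m) j i) :
    ∃ h : IAlgBC K s n θ →ₗ[K] IAlgBC K s n θ, ∀ x, D (h x) + h (D x) = x - r x := by
  have hM : coeffMap r.toLinearMap (genSeries θ m) = retr θ m := coeffMap_genSeries.2 hrc
  set G := homotopySeries K (genMat θ m 1) with hG
  set Y := genSeries θ m - retr θ m with hY
  have hGY : C (idemMat θ) * (G * Y) = G * Y := by
    rw [← mul_assoc, mul_homotopySeries (idemMat_mul_genMat 1)]
  have hYG : G * Y * C (idemMat θ) = G * Y := by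
    rw [mul_assoc, sub_mul, genSeries_mul_idemMat,
      retractSeries_mul (genMat_mul_idemMat 0) (genMat_mul_idemMat 1)]
  have hY0 : coeff 0 (G * Y) = 0 := by
    rw [coeff_mul, Finset.Nat.antidiagonal_zero, Finset.sum_singleton, hY, map_sub,
      coeff_zero_retractSeries, genSeries, coeff_mk, sub_self, mul_zero]
  have hσG : coeffMap σ.toLinearMap G = -(C (signMat θ m) * G * C (signMat θ m)) :=
    coeffMap_evalSq_mul_C_of_odd (map_mul σ) (map_one σ) (fun _ => sgn_mul_self _)
      (genMat_map_grading hσ 1) _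
  obtain ⟨h, hmul, hb, hc⟩ := exists_twisted_derivation (θ := θ) (v := σ.comp r)
    (fun w => by simp [hrb, grading_b hσ]) (fun p i j => coeff p (G * Y) j i)
    (θeQ_mul_coeff hGY) (coeff_mul_θeQ hYG) (fun i j _ => by rw [hY0, Matrix.zero_apply])
  have hhM : coeffMap h (genSeries θ m) = C (signMat θ m) * (G * Y) :=
    coeffMap_genSeries.2 fun p i j => by rw [sgn_smul_coeff_signMat_mul, hc]
  have hhΔ : (idemMat θ).map h = 0 := by
    ext i j
    simp only [idemMat, Matrix.map_apply, Matrix.diagonal_apply]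
    split_ifs <;> simp [θeQ, hb]
  have hrσ := retraction_comm_grading hσ hrb hrc
  have hσh : ∀ x, σ (h x) = -h (σ x) := by
    intro x
    refine twisted_eq (F := σ.toLinearMap.comp h) (G := -(h.comp σ.toLinearMap)) (u := σ)
      (v := r) (fun x y => ?_) (fun x y => ?_) (fun g => ?_) x
    · simp [hmul, grading_involutive hσ]
    · simp only [LinearMap.neg_apply, LinearMap.comp_apply, AlgHom.toLinearMap_apply, map_mul, hmul,
        AlgHom.comp_apply, hrσ, grading_involutive hσ]
      exact neg_mul_add_mul_eq _ _ _ _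
    · rcases g with v | ⟨p, i, j⟩
      · simp [grading_b hσ, hb]
      · refine grading_coeff_of_even hσ (F := G * Y)
          (coeffMap_mul_of_odd (map_mul σ) (fun _ => sgn_mul_self _) hσG ?_) (hc p i j)
        rw [hY, map_sub, genSeries_map_grading hσ, retr_map_grading hσ, mul_sub, sub_mul, neg_sub,
          neg_sub_neg]
  refine ⟨h, fun x => ?_⟩
  refine twisted_eq (F := D.comp h + h.comp D) (G := LinearMap.id - r.toLinearMap) (u := id)
    (v := r) (fun x y => ?_) (fun x y => ?_) (fun g => ?_) x
  · refine anticommutator_mul (hD.map_mul hσ) hmul (grading_involutive hσ) hσh hrσ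
      (fun x => ?_) x y
    rw [← retraction_comm_diff hD hσ hrb hrc, diff_anticomm_grading hD hσ, neg_neg]
  · simp [sub_mul, mul_sub]
  · rcases g with v | ⟨p, i, j⟩
    · simp [hrb, hb, hD.1]
    · have h1 : coeffMap (D.comp h + h.comp D) (genSeries θ m)
          = coeffMap D (coeffMap h (genSeries θ m)) + coeffMap h (coeffMap D (genSeries θ m)) := by
        ext; simp
      have h2 : coeffMap (LinearMap.id - r.toLinearMap) (genSeries θ m)
          = genSeries θ m - retr θ m := by
        rw [← hM]
        ext; simp
      rw [coeffMap_genSeries.1 rfl p i j, coeffMap_genSeries.1 rfl p i j, h1, h2,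
        coeffMap_homotopy (σ := σ.toLinearMap) (v := (σ.comp r).toLinearMap) (G := G)
          (fun _ => sgn_mul_self _) (hD.map_mul hσ) hmul
          (by
            rw [AlgHom.comp_toLinearMap, coeffMap_comp, hM, retr_map_grading hσ])
          hhM hhΔ hD.coeffMap_genSeries (hD.coeffMap_retr hσ) (hD.coeffMap_homotopySeries hσ) hσG
          idemMat_mul_genSeries
          (mul_retractSeries (idemMat_mul_genMat 0) (idemMat_mul_genMat 1))]

end Differential

theorem retraction_c_zero {r : IAlgBC K s n θ →ₐ[K] IAlgBC K s n θ}
    (hrc : ∀ p i j, r (ι K s n θ (c p i j)) = sgn K (m j) • coeff p (retr θ m) j i)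
    (i j : Fin n) : r (ι K s n θ (c 0 i j)) = ι K s n θ (c 0 i j) := by
  rw [hrc, coeff_zero_retractSeries]
  simp [genMat, smul_smul, sgn_mul_self]

theorem retraction_c_succ {r : IAlgBC K s n θ →ₐ[K] IAlgBC K s n θ}
    (hrc : ∀ p i j, r (ι K s n θ (c p i j)) = sgn K (m j) • coeff p (retr θ m) j i)
    (p : ℕ) (i j : Fin n) : r (ι K s n θ (c (p + 1) i j)) = Rval K s n θ m (p + 1) i j := by
  rw [hrc, coeff_succ_retractSeries, Rval, Nat.add_sub_cancel, sum_chainQ, Matrix.smul_apply,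
    smul_comm]

theorem retraction_c_one {r : IAlgBC K s n θ →ₐ[K] IAlgBC K s n θ}
    (hrc : ∀ p i j, r (ι K s n θ (c p i j)) = sgn K (m j) • coeff p (retr θ m) j i)
    (i j : Fin n) : r (ι K s n θ (c 1 i j)) = ι K s n θ (c 1 i j) := by
  rw [hrc, ← zero_add 1, coeff_succ_retractSeries]
  simp [genMat, smul_smul, sgn_mul_self]

theorem chainQ_one_mem_Asub (i j : Fin n) (ks : List (Fin n)) :
    chainQ K s n θ 1 i ks j ∈ Asub K s n θ := by
  induction ks generalizing i with
  | nil => exact Algebra.subset_adjoin (Or.inr ⟨i, j, rfl⟩)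
  | cons k ks ih => exact mul_mem (ih k) (Algebra.subset_adjoin (Or.inr ⟨i, k, rfl⟩))

theorem retraction_mem_Asub {r : IAlgBC K s n θ →ₐ[K] IAlgBC K s n θ}
    (hrb : ∀ v, r (ι K s n θ (b v)) = ι K s n θ (b v))
    (hrc : ∀ p i j, r (ι K s n θ (c p i j)) = sgn K (m j) • coeff p (retr θ m) j i)
    (x : IAlgBC K s n θ) : r x ∈ Asub K s n θ := by
  induction x using IAlgBC.induction with
  | halg k => rw [AlgHom.commutes]; exact algebraMap_mem _ k
  | hι g =>
    rcases g with v | ⟨_ | p, i, j⟩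
    · rw [hrb]
      exact Algebra.subset_adjoin (Or.inl (Or.inl ⟨v, rfl⟩))
    · rw [retraction_c_zero hrc]
      exact Algebra.subset_adjoin (Or.inl (Or.inr ⟨i, j, rfl⟩))
    · rw [retraction_c_succ hrc]
      exact Subalgebra.smul_mem _ (sum_mem fun ks _ =>
        Subalgebra.smul_mem _ (chainQ_one_mem_Asub _ _ _) _) _
  | hadd x y hx hy => rw [map_add]; exact add_mem hx hy
  | hmul x y hx hy => rw [map_mul]; exact mul_mem hx hy

theorem retraction_eq_self {r : IAlgBC K s n θ →ₐ[K] IAlgBC K s n θ}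
    (hrb : ∀ v, r (ι K s n θ (b v)) = ι K s n θ (b v))
    (hrc : ∀ p i j, r (ι K s n θ (c p i j)) = sgn K (m j) • coeff p (retr θ m) j i)
    {x : IAlgBC K s n θ} (hx : x ∈ Asub K s n θ) : r x = x := by
  have h : Asub K s n θ ≤ AlgHom.equalizer r (AlgHom.id K _) := by
    refine Algebra.adjoin_le ?_
    rintro _ ((⟨v, rfl⟩ | ⟨i, j, rfl⟩) | ⟨i, j, rfl⟩)
    · exact hrb v
    · exact retraction_c_zero hrc i j
    · exact retraction_c_one hrc i j
  exact h hx

end InternalAlgebraBC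

/-- For any finite product `k = K^s` of copies of `K` and any unital
`K`-algebra homomorphism `θ : k_n → k`, the base-changed retraction
`r : I_n^k → A_n^k`, defined on the generators by the same formulas, is a chain map
that induces an isomorphism on cohomology. -/
theorem statement6 (K : Type) [Field K] (s n : ℕ) (hs : 1 ≤ s) (hn : 1 ≤ n)
    (θ : (Fin n → K) →ₐ[K] (Fin s → K)) (m : Fin n → ℤ)
    (D : IAlgBC K s n θ →ₗ[K] IAlgBC K s n θ) (hD : IsDiff K s n θ m D) :
    ∃ r : IAlgBC K s n θ →ₐ[K] IAlgBC K s n θ,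
      -- `r` is defined on the generators by the same formulas as over `k_n`:
      (∀ v : Fin s, r (ι K s n θ (b v)) = ι K s n θ (b v)) ∧
      (∀ i j : Fin n, r (ι K s n θ (c 0 i j)) = ι K s n θ (c 0 i j)) ∧
      (∀ i j : Fin n, r (ι K s n θ (c 1 i j)) = ι K s n θ (c 1 i j)) ∧
      (∀ (p : ℕ) (i j : Fin n), 1 < p →
        r (ι K s n θ (c p i j)) = Rval K s n θ m p i j) ∧
      -- `r` takes values in `A_n^k` and restricts to the identity there:
      (∀ x, r x ∈ Asub K s n θ) ∧
      (∀ x ∈ Asub K s n θ, r x = x) ∧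
      -- `r` is a chain map:
      (∀ x, D (r x) = r (D x)) ∧
      -- the map induced by `r` on cohomology is surjective:
      (∀ a ∈ Asub K s n θ, D a = 0 →
        ∃ x, D x = 0 ∧ ∃ y ∈ Asub K s n θ, r x - a = D y) ∧
      -- and injective:
      (∀ x, D x = 0 → (∃ y ∈ Asub K s n θ, r x = D y) → ∃ z, x = D z) := by
  obtain ⟨σ, hσ⟩ := exists_grading_aut θ m
  obtain ⟨r, hrb, hrc⟩ := exists_retraction θ m
  have hcomm := retraction_comm_diff hD hσ hrb hrc
  obtain ⟨h, hh⟩ := exists_homotopy hD hσ hrb hrc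
  refine ⟨r, hrb, retraction_c_zero hrc, retraction_c_one hrc, fun p i j hp => ?_,
    retraction_mem_Asub hrb hrc, fun x => retraction_eq_self hrb hrc, hcomm,
    fun a ha hDa => ⟨a, hDa, 0, zero_mem _, ?_⟩, fun x hx => ?_⟩
  · obtain ⟨p, rfl⟩ := Nat.exists_eq_succ_of_ne_zero (by omega : p ≠ 0)
    exact retraction_c_succ hrc p i j
  · rw [retraction_eq_self hrb hrc ha, sub_self, map_zero]
  · rintro ⟨y, -, hy⟩
    refine ⟨h x + y, ?_⟩
    have hx' := hh x
    rw [hx, map_zero, add_zero] at hx'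
    rw [map_add, hx', ← hy, sub_add_cancel]
end

section
/- Let k be a finite product of copies of a field K, and let A be the free graded associative k-algebra on a set X of homogeneous generators together with two additional homogeneous generators a and b with |b| = |a| + 1. Let ∂ be a degree +1 graded derivation on A (∂(xy) = ∂(x)y + (−1)^{|x|} x ∂(y) for homogeneous x) with ∂ ∘ ∂ = 0, such that ∂a = b (hence ∂b = 0) and ∂ maps the subalgebra A' generated by X into itself. Then the inclusion of DG-algebras (A', ∂|_{A'}) ↪ (A, ∂) induces an isomorphism on cohomology (destabilisation). -/
/-!
Destabilisation: a free graded associative algebra over `k = K^s` on homogeneous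
generators `X ∪ {a, b}` with `|b| = |a| + 1`, realised as a quotient of the free
`K`-algebra on the generators together with the orthogonal idempotents of `k`.
-/

namespace Destab

inductive Gen (s : ℕ) (X : Type) : Type
  | e (v : Fin s) : Gen s X
  | x (g : X) : Gen s X
  | a : Gen s X
  | b : Gen s X

open Gen

variable (K : Type) [Field K] (s : ℕ) (X : Type)
  (lft rgt : Gen s X → Fin s)  -- the `k`-bimodule structure on the generators

/-- Relations: the `e v` are orthogonal idempotents summing to `1`, and each generator
`g` satisfies `e (lft g) * g = g = g * e (rgt g)`. -/
inductive Rel : FreeAlgebra K (Gen s X) → FreeAlgebra K (Gen s X) → Prop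
  | idem (v : Fin s) :
      Rel (FreeAlgebra.ι K (e v) * FreeAlgebra.ι K (e v)) (FreeAlgebra.ι K (e v))
  | orth (v w : Fin s) (h : v ≠ w) :
      Rel (FreeAlgebra.ι K (e v) * FreeAlgebra.ι K (e w)) 0
  | total : Rel (∑ v : Fin s, FreeAlgebra.ι K (e v)) 1
  | left (g : X) :
      Rel (FreeAlgebra.ι K (e (lft (x g))) * FreeAlgebra.ι K (x g)) (FreeAlgebra.ι K (x g))
  | right (g : X) :
      Rel (FreeAlgebra.ι K (x g) * FreeAlgebra.ι K (e (rgt (x g)))) (FreeAlgebra.ι K (x g))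
  | lefta : Rel (FreeAlgebra.ι K (e (lft a)) * FreeAlgebra.ι K a) (FreeAlgebra.ι K (a : Gen s X))
  | righta : Rel (FreeAlgebra.ι K a * FreeAlgebra.ι K (e (rgt a))) (FreeAlgebra.ι K (a : Gen s X))
  | leftb : Rel (FreeAlgebra.ι K (e (lft b)) * FreeAlgebra.ι K b) (FreeAlgebra.ι K (b : Gen s X))
  | rightb : Rel (FreeAlgebra.ι K b * FreeAlgebra.ι K (e (rgt b))) (FreeAlgebra.ι K (b : Gen s X))

/-- The free graded associative `k`-algebra on `X ∪ {a, b}`. -/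
abbrev A := RingQuot (Rel K s X lft rgt)

def ι (g : Gen s X) : A K s X lft rgt := RingQuot.mkAlgHom K (Rel K s X lft rgt) (FreeAlgebra.ι K g)

variable (degX : X → ℤ) (da : ℤ)

/-- Degrees: `|e v| = 0`, the generators of `X` are homogeneous of the given degrees,
`|a| = da` and `|b| = da + 1`. -/
def dg : Gen s X → ℤ
  | e _ => 0
  | x g => degX g
  | a => da
  | b => da + 1

/-- The homogeneous component of degree `d`. -/
def Hgr (d : ℤ) : Submodule K (A K s X lft rgt) :=
  Submodule.span K
    { y | ∃ l : List (Gen s X), (l.map (dg s X degX da)).sum = d ∧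
        y = (l.map (ι K s X lft rgt)).prod }

def sgn (d : ℤ) : K := if Even d then 1 else -1

/-- The subalgebra `A'` generated over `k` by the generators of `X`. -/
def Asub : Subalgebra K (A K s X lft rgt) :=
  Algebra.adjoin K
    ({y | ∃ v, y = ι K s X lft rgt (e v)} ∪ {y | ∃ g : X, y = ι K s X lft rgt (x g)})

end Destab

namespace Destab

open Gen

section Homotopy

variable {K R : Type*} [Field K] [Ring R] [Algebra K R] {D h : R →ₗ[K] R} {σ π : R →ₐ[K] R}

theorem anticommute_mul (hmul : ∀ u w, h (u * w) = h u * w + σ (π u) * h w)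
    (πσ : ∀ u, π (σ u) = σ (π u)) {u w : R} (hu : σ (h u) = -h (σ u))
    (hw : σ (h w) = -h (σ w)) : σ (h (u * w)) = -h (σ (u * w)) := by
  simp only [hmul, map_mul, map_add, hu, hw, πσ]
  noncomm_ring

/-- The maps `D * h + h * D` and `1 - π` satisfy the same product rule. -/
theorem homotopy_mul (Dmul : ∀ u w, D (u * w) = D u * w + σ u * D w)
    (hmul : ∀ u w, h (u * w) = h u * w + σ (π u) * h w) (σσ : ∀ u, σ (σ u) = u)
    (πσ : ∀ u, π (σ u) = σ (π u)) (σD : ∀ u, σ (D u) = -D (σ u))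
    (πD : ∀ u, π (D u) = D (π u)) (σh : ∀ u, σ (h u) = -h (σ u)) {u w : R}
    (hu : D (h u) + h (D u) = u - π u) (hw : D (h w) + h (D w) = w - π w) :
    D (h (u * w)) + h (D (u * w)) = u * w - π (u * w) := by
  have key : D (h (u * w)) + h (D (u * w)) =
      (D (h u) + h (D u)) * w + π u * (D (h w) + h (D w)) := by
    simp only [hmul, Dmul, map_add, πσ, σσ, σh, σD, πD]
    noncomm_ring
  rw [key, hu, hw, map_mul]
  noncomm_ring

end Homotopy

section Generators

variable {K : Type} [Field K] {s : ℕ} {X : Type} {lft rgt : Gen s X → Fin s}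

/-- The defining relations of `A`, for a family of elements of a `K`-algebra. -/
structure Compatible {B : Type*} [Ring B] (lft rgt : Gen s X → Fin s) (f : Gen s X → B) :
    Prop where
  idem (v : Fin s) : f (e v) * f (e v) = f (e v)
  orth (v w : Fin s) (h : v ≠ w) : f (e v) * f (e w) = 0
  total : ∑ v : Fin s, f (e v) = 1
  left (g : Gen s X) (hg : ∀ v, g ≠ e v) : f (e (lft g)) * f g = f g
  right (g : Gen s X) (hg : ∀ v, g ≠ e v) : f g * f (e (rgt g)) = f g

theorem compatible_ι : Compatible lft rgt (ι K s X lft rgt) where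
  idem v := by simpa [ι] using RingQuot.mkAlgHom_rel K (Rel.idem (K := K) (lft := lft) v)
  orth v w h := by simpa [ι] using RingQuot.mkAlgHom_rel K (Rel.orth (K := K) (lft := lft) v w h)
  total := by simpa [ι] using RingQuot.mkAlgHom_rel K (Rel.total (K := K) (lft := lft))
  left g hg := by
    cases g with
    | e v => exact absurd rfl (hg v)
    | x g => simpa [ι] using RingQuot.mkAlgHom_rel K (Rel.left (K := K) (lft := lft) g)
    | a => simpa [ι] using RingQuot.mkAlgHom_rel K (Rel.lefta (K := K) (lft := lft))
    | b => simpa [ι] using RingQuot.mkAlgHom_rel K (Rel.leftb (K := K) (lft := lft))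
  right g hg := by
    cases g with
    | e v => exact absurd rfl (hg v)
    | x g => simpa [ι] using RingQuot.mkAlgHom_rel K (Rel.right (K := K) (lft := lft) g)
    | a => simpa [ι] using RingQuot.mkAlgHom_rel K (Rel.righta (K := K) (lft := lft))
    | b => simpa [ι] using RingQuot.mkAlgHom_rel K (Rel.rightb (K := K) (lft := lft))

/-- The universal property of `A`. -/
theorem exists_lift {B : Type*} [Ring B] [Algebra K B] {f : Gen s X → B}
    (hf : Compatible lft rgt f) :
    ∃ F : A K s X lft rgt →ₐ[K] B, ∀ g, F (ι K s X lft rgt g) = f g := by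
  refine ⟨RingQuot.liftAlgHom K ⟨FreeAlgebra.lift K f, fun {p q} hpq => ?_⟩, fun g => ?_⟩
  swap
  · rw [ι, RingQuot.liftAlgHom_mkAlgHom_apply, FreeAlgebra.lift_ι_apply]
  induction hpq with
  | idem v => simpa using hf.idem v
  | orth v w h => simpa using hf.orth v w h
  | total => simpa using hf.total
  | left g => simpa using hf.left (x g) (by simp)
  | right g => simpa using hf.right (x g) (by simp)
  | lefta => simpa using hf.left a (by simp)
  | righta => simpa using hf.right a (by simp)
  | leftb => simpa using hf.left b (by simp)
  | rightb => simpa using hf.right b (by simp)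

theorem induction_on {P : A K s X lft rgt → Prop} (algebraMap : ∀ r, P (algebraMap K _ r))
    (ι : ∀ g, P (ι K s X lft rgt g)) (mul : ∀ u w, P u → P w → P (u * w))
    (add : ∀ u w, P u → P w → P (u + w)) (u : A K s X lft rgt) : P u := by
  obtain ⟨p, rfl⟩ := RingQuot.mkAlgHom_surjective K (Rel K s X lft rgt) u
  induction p using FreeAlgebra.induction with
  | grade0 r => simpa using algebraMap r
  | grade1 g => exact ι g
  | mul p q hp hq => simpa using mul _ _ hp hq
  | add p q hp hq => simpa using add _ _ hp hq

theorem algHom_ext {B : Type*} [Ring B] [Algebra K B] {F G : A K s X lft rgt →ₐ[K] B}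
    (h : ∀ g, F (ι K s X lft rgt g) = G (ι K s X lft rgt g)) (u : A K s X lft rgt) :
    F u = G u := by
  induction u using induction_on with
  | algebraMap r => simp
  | ι g => exact h g
  | mul u w hu hw => simp [hu, hw]
  | add u w hu hw => simp [hu, hw]

theorem ι_b_ne_zero : ι K s X lft rgt b ≠ 0 := by
  classical
  let f : Gen s X → Matrix (Fin s) (Fin s) K := fun g => match g with
    | e v => Matrix.single v v 1
    | x _ => 0
    | a => 0
    | b => Matrix.single (lft b) (rgt b) 1
  have hf : Compatible lft rgt f :=
    { idem := fun v => by simp [f]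
      orth := fun v w h => by simp [f, h]
      total := by
        ext i j
        simp [f, Matrix.sum_apply, Matrix.single_apply, Matrix.one_apply, ite_and]
      left := fun g hg => by cases g <;> simp_all [f]
      right := fun g hg => by cases g <;> simp_all [f] }
  obtain ⟨F, hF⟩ := exists_lift (K := K) hf
  intro h
  have h' := congrFun (congrFun ((hF b).symm.trans (by rw [h, map_zero])) (lft b)) (rgt b)
  simp [f] at h'

theorem lft_a_eq_lft_b (h : ι K s X lft rgt (e (lft a)) * ι K s X lft rgt b = ι K s X lft rgt b) :
    lft a = lft b := by
  by_contra hne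
  apply ι_b_ne_zero (K := K) (lft := lft) (rgt := rgt)
  rw [← h, ← compatible_ι.left b (by simp), ← mul_assoc, compatible_ι.orth _ _ hne, zero_mul]

theorem rgt_a_eq_rgt_b (h : ι K s X lft rgt b * ι K s X lft rgt (e (rgt a)) = ι K s X lft rgt b) :
    rgt a = rgt b := by
  by_contra hne
  apply ι_b_ne_zero (K := K) (lft := lft) (rgt := rgt)
  rw [← h, ← compatible_ι.right b (by simp), mul_assoc, compatible_ι.orth _ _ (Ne.symm hne),
    mul_zero]

theorem exists_projection :
    ∃ π : A K s X lft rgt →ₐ[K] A K s X lft rgt,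
      (∀ v, π (ι K s X lft rgt (e v)) = ι K s X lft rgt (e v)) ∧
      (∀ g, π (ι K s X lft rgt (x g)) = ι K s X lft rgt (x g)) ∧
      π (ι K s X lft rgt a) = 0 ∧ π (ι K s X lft rgt b) = 0 := by
  let f : Gen s X → A K s X lft rgt := fun g => match g with
    | e v => ι K s X lft rgt (e v)
    | x g => ι K s X lft rgt (x g)
    | a => 0
    | b => 0
  have hf : Compatible lft rgt f :=
    { idem := compatible_ι.idem
      orth := compatible_ι.orth
      total := compatible_ι.total
      left := fun g hg => by
        cases g
        case e v => exact absurd rfl (hg v)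
        case x g => exact compatible_ι.left (x g) hg
        all_goals exact mul_zero _
      right := fun g hg => by
        cases g
        case e v => exact absurd rfl (hg v)
        case x g => exact compatible_ι.right (x g) hg
        all_goals exact zero_mul _ }
  obtain ⟨F, hF⟩ := exists_lift (K := K) hf
  exact ⟨F, fun v => hF _, fun g => hF _, hF _, hF _⟩

theorem algHom_apply_of_mem_Asub {F : A K s X lft rgt →ₐ[K] A K s X lft rgt}
    (he : ∀ v, F (ι K s X lft rgt (e v)) = ι K s X lft rgt (e v))
    (hx : ∀ g, F (ι K s X lft rgt (x g)) = ι K s X lft rgt (x g))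
    {u : A K s X lft rgt} (hu : u ∈ Asub K s X lft rgt) : F u = u := by
  have : Asub K s X lft rgt ≤ AlgHom.equalizer F (AlgHom.id K _) := by
    refine Algebra.adjoin_le ?_
    rintro _ (⟨v, rfl⟩ | ⟨g, rfl⟩)
    · exact he v
    · exact hx g
  exact this hu

theorem ι_e_mem_Asub (v : Fin s) : ι K s X lft rgt (e v) ∈ Asub K s X lft rgt :=
  Algebra.subset_adjoin (Or.inl ⟨v, rfl⟩)

theorem ι_x_mem_Asub (g : X) : ι K s X lft rgt (x g) ∈ Asub K s X lft rgt :=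
  Algebra.subset_adjoin (Or.inr ⟨g, rfl⟩)

theorem projection_mem_Asub {π : A K s X lft rgt →ₐ[K] A K s X lft rgt}
    (he : ∀ v, π (ι K s X lft rgt (e v)) = ι K s X lft rgt (e v))
    (hx : ∀ g, π (ι K s X lft rgt (x g)) = ι K s X lft rgt (x g))
    (ha : π (ι K s X lft rgt a) = 0) (hb : π (ι K s X lft rgt b) = 0)
    (u : A K s X lft rgt) : π u ∈ Asub K s X lft rgt := by
  induction u using induction_on with
  | algebraMap r => simp
  | ι g =>
    cases g with
    | e v => simpa [he] using ι_e_mem_Asub v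
    | x g => simpa [hx] using ι_x_mem_Asub g
    | a => simp [ha]
    | b => simp [hb]
  | mul u w hu hw => simpa using mul_mem hu hw
  | add u w hu hw => simpa using add_mem hu hw

/-- A twisted derivation `h` with `h b = a` that kills the other generators. -/
theorem exists_twisted_derivation (hl : lft a = lft b) (hr : rgt a = rgt b)
    (τ : A K s X lft rgt →ₐ[K] A K s X lft rgt)
    (he : ∀ v, τ (ι K s X lft rgt (e v)) = ι K s X lft rgt (e v)) :
    ∃ h : A K s X lft rgt →ₗ[K] A K s X lft rgt,
      (∀ u w, h (u * w) = h u * w + τ u * h w) ∧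
      (∀ v, h (ι K s X lft rgt (e v)) = 0) ∧
      (∀ g, h (ι K s X lft rgt (x g)) = 0) ∧
      h (ι K s X lft rgt a) = 0 ∧ h (ι K s X lft rgt b) = ι K s X lft rgt a := by
  let δ : Gen s X → A K s X lft rgt := fun g => match g with
    | e _ => 0
    | x _ => 0
    | a => 0
    | b => ι K s X lft rgt a
  let f : Gen s X → Matrix (Fin 2) (Fin 2) (A K s X lft rgt) := fun g =>
    !![τ (ι K s X lft rgt g), δ g; 0, ι K s X lft rgt g]
  have δe : ∀ v, δ (e v) = 0 := fun v => rfl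
  have δl : ∀ g, ι K s X lft rgt (e (lft g)) * δ g = δ g := fun g => by
    cases g
    case b => exact hl ▸ compatible_ι.left a (by simp)
    all_goals exact mul_zero _
  have δr : ∀ g, δ g * ι K s X lft rgt (e (rgt g)) = δ g := fun g => by
    cases g
    case b => exact hr ▸ compatible_ι.right a (by simp)
    all_goals exact zero_mul _
  have hf : Compatible lft rgt f :=
    { idem := fun v => by simp [f, δe, he, compatible_ι.idem]
      orth := fun v w hvw => by
        ext i j
        fin_cases i <;> fin_cases j <;> simp [f, δe, he, compatible_ι.orth v w hvw]
      total := by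
        ext i j
        fin_cases i <;> fin_cases j <;>
          simp [f, δe, he, Matrix.sum_apply, compatible_ι.total]
      left := fun g hg => by
        have h₁ := (compatible_ι (K := K) (lft := lft) (rgt := rgt)).left g hg
        have h₂ := congrArg τ h₁
        rw [map_mul, he] at h₂
        simp [f, δe, he, h₁, h₂, δl]
      right := fun g hg => by
        have h₁ := (compatible_ι (K := K) (lft := lft) (rgt := rgt)).right g hg
        have h₂ := congrArg τ h₁
        rw [map_mul, he] at h₂
        simp [f, δe, he, h₁, h₂, δr] }
  obtain ⟨F, hF⟩ := exists_lift (K := K) hf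
  have key : ∀ u, F u 0 0 = τ u ∧ F u 1 0 = 0 ∧ F u 1 1 = u := fun u => by
    induction u using induction_on with
    | algebraMap r => simp [Matrix.algebraMap_matrix_apply]
    | ι g => simp [hF, f]
    | mul u w hu hw => simp [Matrix.mul_apply, Fin.sum_univ_two, hu, hw]
    | add u w hu hw => simp [hu, hw]
  refine ⟨(Matrix.entryLinearMap K _ 0 1).comp F.toLinearMap, fun u w => ?_, fun v => ?_,
    fun g => ?_, ?_, ?_⟩
  · simp [Matrix.mul_apply, Fin.sum_univ_two, key, add_comm]
  all_goals simp [hF, f, δ]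

theorem sgn_add (m n : ℤ) : sgn K (m + n) = sgn K m * sgn K n := by
  unfold sgn
  by_cases hm : Even m <;> by_cases hn : Even n <;> simp [hm, hn, Int.even_add]

theorem sgn_mul_self (n : ℤ) : sgn K n * sgn K n = 1 := by
  unfold sgn
  split_ifs <;> simp

theorem sgn_zero : sgn K 0 = 1 := by simp [sgn]

theorem sgn_one : sgn K 1 = -1 := by simp [sgn]

/-- The automorphism acting by `sgn d` in degree `d`. -/
theorem exists_sign (lft rgt : Gen s X → Fin s) (degX : X → ℤ) (da : ℤ) :
    ∃ σ : A K s X lft rgt →ₐ[K] A K s X lft rgt,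
      ∀ g, σ (ι K s X lft rgt g) = sgn K (dg s X degX da g) • ι K s X lft rgt g := by
  have se : ∀ v, sgn K (dg s X degX da (e v)) = 1 := fun v => sgn_zero
  refine exists_lift (K := K)
    { idem := fun v => by simp [se, compatible_ι.idem]
      orth := fun v w h => by simp [se, compatible_ι.orth v w h]
      total := by simp [se, compatible_ι.total]
      left := fun g hg => by simp [se, compatible_ι.left g hg]
      right := fun g hg => by simp [se, compatible_ι.right g hg] }

theorem sign_apply_of_mem_Hgr {degX : X → ℤ} {da : ℤ}
    {σ : A K s X lft rgt →ₐ[K] A K s X lft rgt}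
    (hσ : ∀ g, σ (ι K s X lft rgt g) = sgn K (dg s X degX da g) • ι K s X lft rgt g)
    {d : ℤ} {u : A K s X lft rgt} (hu : u ∈ Hgr K s X lft rgt degX da d) :
    σ u = sgn K d • u := by
  have hword : ∀ l : List (Gen s X), σ (l.map (ι K s X lft rgt)).prod =
      sgn K (l.map (dg s X degX da)).sum • (l.map (ι K s X lft rgt)).prod := fun l => by
    induction l with
    | nil => simp [sgn_zero]
    | cons g l ih => simp [hσ, ih, sgn_add, smul_smul, mul_comm]
  induction hu using Submodule.span_induction with
  | mem y hy =>
    obtain ⟨l, rfl, rfl⟩ := hy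
    exact hword l
  | zero => simp
  | add y z _ _ hy hz => simp [hy, hz]
  | smul r y _ hy => simp [hy, smul_comm r]

theorem ι_mem_Hgr (degX : X → ℤ) (da : ℤ) (g : Gen s X) :
    ι K s X lft rgt g ∈ Hgr K s X lft rgt degX da (dg s X degX da g) :=
  Submodule.subset_span ⟨[g], by simp, by simp⟩

theorem induction_homogeneous (degX : X → ℤ) (da : ℤ) {P : A K s X lft rgt → Prop}
    (zero : P 0) (add : ∀ u w, P u → P w → P (u + w))
    (mem : ∀ d, ∀ u ∈ Hgr K s X lft rgt degX da d, P u) (u : A K s X lft rgt) : P u := by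
  have mul_mem_Hgr : ∀ c d (y z : A K s X lft rgt), y ∈ Hgr K s X lft rgt degX da c →
      z ∈ Hgr K s X lft rgt degX da d → y * z ∈ Hgr K s X lft rgt degX da (c + d) := by
    intro c d y z hy hz
    refine (Submodule.mul_le (P := Hgr K s X lft rgt degX da (c + d))).1 ?_ y hy z hz
    rw [Hgr, Hgr, Submodule.span_mul_span]
    refine Submodule.span_le.2 ?_
    rintro _ ⟨_, ⟨l, rfl, rfl⟩, _, ⟨m, rfl, rfl⟩, rfl⟩
    exact Submodule.subset_span ⟨l ++ m, by simp, by simp⟩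
  have htop : ∀ u, u ∈ ⨆ d, Hgr K s X lft rgt degX da d := fun u => by
    induction u using induction_on with
    | algebraMap r =>
      refine Submodule.mem_iSup_of_mem 0 ?_
      rw [Algebra.algebraMap_eq_smul_one]
      exact Submodule.smul_mem _ _ (Submodule.subset_span ⟨[], by simp, by simp⟩)
    | ι g => exact Submodule.mem_iSup_of_mem _ (ι_mem_Hgr degX da g)
    | add u w hu hw => exact add_mem hu hw
    | mul u w hu hw =>
      have := Submodule.mul_mem_mul hu hw
      rw [Submodule.iSup_mul] at this
      refine (iSup_le fun c => ?_ : _ ≤ ⨆ d, Hgr K s X lft rgt degX da d) this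
      rw [Submodule.mul_iSup]
      refine iSup_le fun d => Submodule.mul_le.2 fun y hy z hz => ?_
      exact Submodule.mem_iSup_of_mem _ (mul_mem_Hgr c d y z hy hz)
  exact Submodule.iSup_induction _ (motive := P) (htop u) mem zero add

end Generators

end Destab

open Destab Destab.Gen

/-- Let `A` be the free graded associative `k`-algebra on homogeneous
generators `X ∪ {a, b}` with `|b| = |a| + 1`, and let `∂` be a square-zero degree `+1`
graded derivation with `∂a = b` that maps the subalgebra `A'` generated by `X` into
itself.  Then the inclusion of DG-algebras `(A', ∂|_{A'}) ↪ (A, ∂)` induces an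
isomorphism on cohomology (destabilisation). -/
theorem statement7 (K : Type) [Field K] (s : ℕ) (hs : 1 ≤ s) (X : Type)
    (lft rgt : Gen s X → Fin s) (degX : X → ℤ) (da : ℤ)
    (D : A K s X lft rgt →ₗ[K] A K s X lft rgt)
    -- `∂` is `k`-linear (vanishes on `k`):
    (hk : ∀ v : Fin s, D (ι K s X lft rgt (e v)) = 0)
    -- graded Leibniz rule:
    (hleib : ∀ (d : ℤ) (u w : A K s X lft rgt), u ∈ Hgr K s X lft rgt degX da d →
      D (u * w) = D u * w + sgn K d • (u * D w))
    -- `∂` has degree `+1`: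
    (hdeg : ∀ (d : ℤ) (u : A K s X lft rgt), u ∈ Hgr K s X lft rgt degX da d →
      D u ∈ Hgr K s X lft rgt degX da (d + 1))
    -- `∂ ∘ ∂ = 0`:
    (hsq : ∀ u, D (D u) = 0)
    -- `∂a = b`:
    (hab : D (ι K s X lft rgt a) = ι K s X lft rgt b)
    -- `∂` maps `A'` into itself:
    (hA' : ∀ u ∈ Asub K s X lft rgt, D u ∈ Asub K s X lft rgt) :
    -- the inclusion `A' ↪ A` induces a surjection on cohomology:
    (∀ u : A K s X lft rgt, D u = 0 →
      ∃ u' ∈ Asub K s X lft rgt, ∃ y : A K s X lft rgt, u - u' = D y) ∧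
    -- and an injection on cohomology:
    (∀ u ∈ Asub K s X lft rgt, D u = 0 → (∃ y : A K s X lft rgt, u = D y) →
      ∃ y' ∈ Asub K s X lft rgt, u = D y') := by
  obtain ⟨σ, hσ⟩ := exists_sign (K := K) lft rgt degX da
  have Dmul : ∀ u w, D (u * w) = D u * w + σ u * D w := fun u w => by
    induction u using induction_homogeneous degX da with
    | zero => simp
    | add u v hu hv => rw [add_mul, map_add, hu, hv, map_add, map_add]; noncomm_ring
    | mem d u hu => rw [hleib d u w hu, sign_apply_of_mem_Hgr hσ hu, smul_mul_assoc]
  have σD : ∀ u, σ (D u) = -D (σ u) := fun u => by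
    induction u using induction_homogeneous degX da with
    | zero => simp
    | add u v hu hv => simp only [map_add, hu, hv, neg_add]
    | mem d u hu =>
      rw [sign_apply_of_mem_Hgr hσ hu, sign_apply_of_mem_Hgr hσ (hdeg d u hu), sgn_add, sgn_one,
        map_smul, mul_neg_one]
      exact neg_smul (sgn K d) (D u)
  have σσ : ∀ u, σ (σ u) = u :=
    algHom_ext (F := σ.comp σ) (G := AlgHom.id K _) fun g => by
      simp [hσ, smul_smul, sgn_mul_self]
  have σe : ∀ v, σ (ι K s X lft rgt (e v)) = ι K s X lft rgt (e v) := fun v => by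
    simp [hσ, dg, sgn_zero]
  have D1 : D 1 = 0 := by
    rw [← (compatible_ι (K := K) (lft := lft) (rgt := rgt)).total, map_sum]
    exact Finset.sum_eq_zero fun v _ => hk v
  have Dalg : ∀ r : K, D (algebraMap K _ r) = 0 := fun r => by
    rw [Algebra.algebraMap_eq_smul_one, map_smul, D1, smul_zero]
  have Db : D (ι K s X lft rgt b) = 0 := by rw [← hab, hsq]
  have hl : lft a = lft b := by
    have h := congrArg D ((compatible_ι (K := K) (lft := lft) (rgt := rgt)).left a (by simp))
    rw [Dmul, hk, zero_mul, zero_add, σe, hab] at h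
    exact lft_a_eq_lft_b h
  have hr : rgt a = rgt b := by
    have h := congrArg D ((compatible_ι (K := K) (lft := lft) (rgt := rgt)).right a (by simp))
    rw [Dmul, hk, mul_zero, add_zero, hab] at h
    exact rgt_a_eq_rgt_b h
  obtain ⟨π, πe, πx, πa, πb⟩ := exists_projection (K := K) (lft := lft) (rgt := rgt)
  have πσ : ∀ u, π (σ u) = σ (π u) :=
    algHom_ext (F := π.comp σ) (G := σ.comp π) fun g => by
      cases g <;> simp [hσ, πe, πx, πa, πb]
  have πA' : ∀ u ∈ Asub K s X lft rgt, π u = u := fun u => algHom_apply_of_mem_Asub πe πx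
  have πD : ∀ u, π (D u) = D (π u) := fun u => by
    induction u using induction_on with
    | algebraMap r => simp [Dalg]
    | ι g =>
      cases g with
      | e v => simp [πe, hk]
      | x g => rw [πx, πA' _ (hA' _ (ι_x_mem_Asub g))]
      | a => simp [hab, πa, πb]
      | b => simp [Db, πb]
    | mul u w hu hw => simp only [Dmul, map_mul, map_add, hu, hw, πσ]
    | add u w hu hw => simp only [map_add, hu, hw]
  obtain ⟨h, hmul, he, hx, ha, hb⟩ := exists_twisted_derivation hl hr (σ.comp π)
    (fun v => by simp [πe, σe])
  simp only [AlgHom.comp_apply] at hmul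
  have h1 : h 1 = 0 := by
    rw [← (compatible_ι (K := K) (lft := lft) (rgt := rgt)).total, map_sum]
    exact Finset.sum_eq_zero fun v _ => he v
  have halg : ∀ r : K, h (algebraMap K _ r) = 0 := fun r => by
    rw [Algebra.algebraMap_eq_smul_one, map_smul, h1, smul_zero]
  have hA : ∀ u ∈ Asub K s X lft rgt, h u = 0 := fun u hu => by
    induction hu using Algebra.adjoin_induction with
    | mem u hu =>
      obtain ⟨v, rfl⟩ | ⟨g, rfl⟩ := hu
      · exact he v
      · exact hx g
    | algebraMap r => exact halg r
    | add u w _ _ hu hw => rw [map_add, hu, hw, add_zero]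
    | mul u w _ _ hu hw => rw [hmul, hu, hw, zero_mul, mul_zero, add_zero]
  have σh : ∀ u, σ (h u) = -h (σ u) := fun u => by
    induction u using induction_on with
    | algebraMap r => simp [halg]
    | ι g =>
      cases g with
      | b =>
        rw [hb, hσ, hσ, map_smul, hb, dg, dg, sgn_add, sgn_one, mul_neg_one]
        exact neg_eq_iff_eq_neg.1 (neg_smul (sgn K da) (ι K s X lft rgt a)).symm
      | _ => simp [hσ, he, hx, ha]
    | mul u w hu hw => exact anticommute_mul hmul πσ hu hw
    | add u w hu hw => simp only [map_add, hu, hw, neg_add]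
  have homotopy : ∀ u, D (h u) + h (D u) = u - π u := fun u => by
    induction u using induction_on with
    | algebraMap r => simp [halg, Dalg]
    | ι g =>
      cases g with
      | e v => simp [he, hk, πe]
      | x g => simp [hx, πx, hA _ (hA' _ (ι_x_mem_Asub g))]
      | a => simp [ha, hab, hb, πa]
      | b => simp [hb, hab, Db, πb]
    | mul u w hu hw => exact homotopy_mul Dmul hmul σσ πσ σD πD σh hu hw
    | add u w hu hw =>
      simp only [map_add]
      rw [add_add_add_comm, hu, hw, add_sub_add_comm]
  refine ⟨fun u hu => ⟨π u, projection_mem_Asub πe πx πa πb u, h u, ?_⟩, ?_⟩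
  · rw [← homotopy u, hu, map_zero, add_zero]
  · rintro u hu - ⟨y, rfl⟩
    exact ⟨π y, projection_mem_Asub πe πx πa πb y, by rw [← πD, πA' _ hu]⟩
end

section
/- Let k be a finite product of copies of a field K, and let A be the free graded associative k-algebra on homogeneous generators X ∪ {p, q, r, s} with |q| = |r| = |s| − 1 and |p| = |s| − 2. Let z and z' be invertible degree-0 elements of the subalgebra A' generated by X, and let ∂ be a degree +1 graded derivation on A with ∂ ∘ ∂ = 0 such that ∂ maps A' into itself, ∂z = ∂z' = 0, and ∂p = z q + r z', ∂q = s z', ∂r = −z s, ∂s = 0. Then the k-algebra endomorphism φ of A fixing every generator in X as well as p and r, and sending q ↦ z q + r z' and s ↦ z s, is an automorphism of A satisfying ∂ ∘ φ = φ ∘ ∂', where ∂' is the degree +1 graded derivation with ∂'|_{A'} = ∂|_{A'} and ∂'p = q, ∂'q = 0, ∂'r = −s, ∂'s = 0. Consequently (A, ∂) and (A, ∂') are isomorphic DG-algebras. -/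
/-!
Case 1 of the destabilisation of secondary generators: the free graded associative
algebra over `k = K^c` on homogeneous generators `X ∪ {p, q, r, s}`, with
`|q| = |r| = |s| − 1` and `|p| = |s| − 2`.
-/

namespace Destab2

inductive Gen (c : ℕ) (X : Type) : Type
  | e (v : Fin c) : Gen c X
  | x (g : X) : Gen c X
  | p : Gen c X
  | q : Gen c X
  | r : Gen c X
  | s : Gen c X

open Gen

variable (K : Type) [Field K] (c : ℕ) (X : Type)
  (lft rgt : Gen c X → Fin c)  -- the `k`-bimodule structure on the generators

/-- Relations: the `e v` are orthogonal idempotents summing to `1`, and each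
non-idempotent generator `g` satisfies `e (lft g) * g = g = g * e (rgt g)`. -/
inductive Rel : FreeAlgebra K (Gen c X) → FreeAlgebra K (Gen c X) → Prop
  | idem (v : Fin c) :
      Rel (FreeAlgebra.ι K (e v) * FreeAlgebra.ι K (e v)) (FreeAlgebra.ι K (e v))
  | orth (v w : Fin c) (h : v ≠ w) :
      Rel (FreeAlgebra.ι K (e v) * FreeAlgebra.ι K (e w)) 0
  | total : Rel (∑ v : Fin c, FreeAlgebra.ι K (e v)) 1
  | left (g : Gen c X) (h : ∀ v, g ≠ e v) :
      Rel (FreeAlgebra.ι K (e (lft g)) * FreeAlgebra.ι K g) (FreeAlgebra.ι K g)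
  | right (g : Gen c X) (h : ∀ v, g ≠ e v) :
      Rel (FreeAlgebra.ι K g * FreeAlgebra.ι K (e (rgt g))) (FreeAlgebra.ι K g)

/-- The free graded associative `k`-algebra on `X ∪ {p, q, r, s}`. -/
abbrev A := RingQuot (Rel K c X lft rgt)

def ι (g : Gen c X) : A K c X lft rgt :=
  RingQuot.mkAlgHom K (Rel K c X lft rgt) (FreeAlgebra.ι K g)

variable (degX : X → ℤ) (ds : ℤ)

/-- Degrees: `|q| = |r| = |s| − 1` and `|p| = |s| − 2`. -/
def dg : Gen c X → ℤ
  | e _ => 0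
  | x g => degX g
  | p => ds - 2
  | q => ds - 1
  | r => ds - 1
  | s => ds

/-- The homogeneous component of degree `d`. -/
def Hgr (d : ℤ) : Submodule K (A K c X lft rgt) :=
  Submodule.span K
    { y | ∃ l : List (Gen c X), (l.map (dg c X degX ds)).sum = d ∧
        y = (l.map (ι K c X lft rgt)).prod }

def sgn (d : ℤ) : K := if Even d then 1 else -1

/-- The subalgebra `A'` generated over `k` by the generators of `X`. -/
def Asub : Subalgebra K (A K c X lft rgt) :=
  Algebra.adjoin K
    ({y | ∃ v, y = ι K c X lft rgt (e v)} ∪ {y | ∃ g : X, y = ι K c X lft rgt (x g)})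

end Destab2

namespace Destab2

open Gen

section

variable {K : Type} [Field K] {c : ℕ} {X : Type} {lft rgt : Gen c X → Fin c}

local notation "𝔸" => A K c X lft rgt
local notation "γ" => ι K c X lft rgt

theorem ι_idem (v : Fin c) : γ (e v) * γ (e v) = γ (e v) := by
  simpa [ι] using RingQuot.mkAlgHom_rel K (Rel.idem (K := K) (lft := lft) (rgt := rgt) v)

theorem ι_orth {v w : Fin c} (h : v ≠ w) : γ (e v) * γ (e w) = 0 := by
  simpa [ι] using RingQuot.mkAlgHom_rel K (Rel.orth (K := K) (lft := lft) (rgt := rgt) v w h)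

theorem ι_total : ∑ v : Fin c, γ (e v) = 1 := by
  simpa [ι] using RingQuot.mkAlgHom_rel K (Rel.total (K := K) (lft := lft) (rgt := rgt))

theorem ι_left {g : Gen c X} (h : ∀ v, g ≠ e v) : γ (e (lft g)) * γ g = γ g := by
  simpa [ι] using RingQuot.mkAlgHom_rel K (Rel.left (K := K) (lft := lft) (rgt := rgt) g h)

theorem ι_right {g : Gen c X} (h : ∀ v, g ≠ e v) : γ g * γ (e (rgt g)) = γ g := by
  simpa [ι] using RingQuot.mkAlgHom_rel K (Rel.right (K := K) (lft := lft) (rgt := rgt) g h)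

/-- Induction on elements of `A`. -/
theorem A_induction {P : 𝔸 → Prop} (halg : ∀ a : K, P (algebraMap K 𝔸 a)) (hι : ∀ g, P (γ g))
    (hmul : ∀ u w, P u → P w → P (u * w)) (hadd : ∀ u w, P u → P w → P (u + w)) (u : 𝔸) :
    P u := by
  obtain ⟨f, rfl⟩ := RingQuot.mkAlgHom_surjective K (Rel K c X lft rgt) u
  induction f using FreeAlgebra.induction with
  | grade0 a => rw [AlgHom.commutes]; exact halg a
  | grade1 g => exact hι g
  | mul a b ha hb => rw [map_mul]; exact hmul _ _ ha hb
  | add a b ha hb => rw [map_add]; exact hadd _ _ ha hb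

-- The general lemmas do not unify with the instances on `A` at `rw` transparency.
theorem A_mul_neg (u w : 𝔸) : u * -w = -(u * w) := mul_neg u w

theorem A_neg_mul (u w : 𝔸) : -u * w = -(u * w) := neg_mul u w

theorem A_hom_ext {B : Type*} [Semiring B] [Algebra K B] {f₁ f₂ : 𝔸 →ₐ[K] B}
    (h : ∀ g, f₁ (γ g) = f₂ (γ g)) : f₁ = f₂ := by
  refine AlgHom.ext fun u => ?_
  induction u using A_induction with
  | halg a => simp only [AlgHom.commutes]
  | hι g => exact h g
  | hmul u w hu hw => simp only [map_mul, hu, hw]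
  | hadd u w hu hw => simp only [map_add, hu, hw]

/-- The universal property of `A`. -/
theorem exists_lift {B : Type*} [Semiring B] [Algebra K B] (f : Gen c X → B)
    (idem : ∀ v, f (e v) * f (e v) = f (e v))
    (orth : ∀ v w, v ≠ w → f (e v) * f (e w) = 0)
    (total : ∑ v, f (e v) = 1)
    (left : ∀ g, (∀ v, g ≠ e v) → f (e (lft g)) * f g = f g)
    (right : ∀ g, (∀ v, g ≠ e v) → f g * f (e (rgt g)) = f g) :
    ∃ F : 𝔸 →ₐ[K] B, ∀ g, F (γ g) = f g := by
  refine ⟨RingQuot.liftAlgHom K ⟨FreeAlgebra.lift K f, ?_⟩, fun g => ?_⟩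
  · intro a b h
    induction h with
    | idem v => simpa using idem v
    | orth v w h => simpa using orth v w h
    | total => simpa using total
    | left g h => simpa using left g h
    | right g h => simpa using right g h
  · rw [ι, RingQuot.liftAlgHom_mkAlgHom_apply, FreeAlgebra.lift_ι_apply]

theorem ι_e_ne_zero (v : Fin c) : γ (e v) ≠ 0 := by
  classical
  obtain ⟨F, hF⟩ := exists_lift (K := K) (lft := lft) (rgt := rgt) (B := K)
    (fun g => match g with
      | e w => if w = v then 1 else 0
      | _ => 0)
    (by intro w; by_cases h : w = v <;> simp [h])
    (by intro w w' h; by_cases h1 : w = v <;> by_cases h2 : w' = v <;> simp_all)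
    (by simp)
    (by rintro (_ | _ | _ | _ | _ | _) h <;> simp_all)
    (by rintro (_ | _ | _ | _ | _ | _) h <;> simp_all)
  intro h
  simpa [h] using (hF (e v)).symm

/-- Right multiplication by a generator `g` is injective on `A * e (lft g)`. -/
theorem mul_e_eq_zero_of_mul_ι_eq_zero {g : Gen c X} (hg : ∀ v, g ≠ e v) {y : 𝔸}
    (hy : y * γ g = 0) : y * γ (e (lft g)) = 0 := by
  classical
  let L : 𝔸 → Module.End K (𝔸 × K) := fun a =>
    LinearMap.inl K 𝔸 K ∘ₗ LinearMap.mulLeft K a ∘ₗ LinearMap.fst K 𝔸 K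
  let E : Module.End K (𝔸 × K) := LinearMap.inr K 𝔸 K ∘ₗ LinearMap.snd K 𝔸 K
  let T : Module.End K (𝔸 × K) :=
    LinearMap.inl K 𝔸 K ∘ₗ LinearMap.toSpanSingleton K 𝔸 (γ (e (lft g))) ∘ₗ LinearMap.snd K 𝔸 K
  have hL : ∀ a u t, L a (u, t) = (a * u, 0) := fun a u t => rfl
  have hE : ∀ u t, E (u, t) = (0, t) := fun u t => rfl
  have hT : ∀ u t, T (u, t) = (t • γ (e (lft g)), 0) := fun u t => rfl
  let f : Gen c X → Module.End K (𝔸 × K) := fun h =>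
    L (γ h) + (if h = e (rgt g) then E else 0) + (if h = g then T else 0)
  have hfe : ∀ v u t, f (e v) (u, t) = (γ (e v) * u, if v = rgt g then t else 0) := by
    intro v u t
    by_cases h : v = rgt g <;> simp [f, hL, hE, h, (hg _).symm]
  have hfg : ∀ h, (∀ v, h ≠ e v) → ∀ u t,
      f h (u, t) = (γ h * u + if h = g then t • γ (e (lft g)) else 0, 0) := by
    intro h hh u t
    by_cases h' : h = g
    · subst h'; simp [f, hL, hT, hh]
    · simp [f, hL, hh, h']
  obtain ⟨F, hF⟩ := exists_lift (K := K) (lft := lft) (rgt := rgt) f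
    (by
      intro v
      refine LinearMap.ext fun ⟨u, t⟩ => ?_
      rw [Module.End.mul_apply, hfe, hfe, ← mul_assoc, ι_idem]
      by_cases h : v = rgt g <;> simp [h])
    (by
      intro v w h
      refine LinearMap.ext fun ⟨u, t⟩ => ?_
      rw [Module.End.mul_apply, hfe, hfe, ← mul_assoc, ι_orth h]
      by_cases h1 : v = rgt g <;> by_cases h2 : w = rgt g <;> simp_all)
    (by
      refine LinearMap.ext fun ⟨u, t⟩ => ?_
      rw [LinearMap.sum_apply]
      simp only [hfe]
      refine Prod.ext ?_ ?_
      · rw [Prod.fst_sum, ← Finset.sum_mul, ι_total]; simp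
      · rw [Prod.snd_sum]; simp)
    (by
      intro h hh
      refine LinearMap.ext fun ⟨u, t⟩ => ?_
      rw [Module.End.mul_apply, hfg h hh, hfe, mul_add, ← mul_assoc, ι_left hh]
      by_cases h' : h = g
      · subst h'; simp [ι_idem]
      · simp [h'])
    (by
      intro h hh
      refine LinearMap.ext fun ⟨u, t⟩ => ?_
      rw [Module.End.mul_apply, hfe, hfg h hh, hfg h hh, ← mul_assoc, ι_right hh]
      by_cases h' : h = g
      · subst h'; simp
      · simp [h'])
  have hFl : ∀ u a : 𝔸, F u (a, 0) = (u * a, 0) := by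
    intro u
    induction u using A_induction with
    | halg a => intro b; simp [Algebra.smul_def]
    | hι h =>
      intro b
      by_cases hh : ∀ v, h ≠ e v
      · rw [hF, hfg h hh]; simp
      · push Not at hh
        obtain ⟨v, rfl⟩ := hh
        rw [hF, hfe]; simp
    | hmul u w hu hw =>
      intro b
      rw [map_mul, Module.End.mul_apply, hw, hu, mul_assoc]
    | hadd u w hu hw =>
      intro b
      rw [map_add, LinearMap.add_apply, hw, hu, add_mul]; simp
  have key : F (y * γ g) (0, 1) = (y * γ (e (lft g)), 0) := by
    rw [map_mul, Module.End.mul_apply, hF, hfg g hg, ← hFl]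
    simp
  rw [hy, map_zero, LinearMap.zero_apply] at key
  exact (congrArg Prod.fst key).symm

theorem ι_ne_zero {g : Gen c X} (hg : ∀ v, g ≠ e v) : γ g ≠ 0 := by
  intro h
  have := mul_e_eq_zero_of_mul_ι_eq_zero (y := (1 : 𝔸)) hg (by rw [h, mul_zero])
  rw [one_mul] at this
  exact ι_e_ne_zero _ this

theorem eq_lft {g : Gen c X} (hg : ∀ v, g ≠ e v) {v : Fin c} (h : γ (e v) * γ g = γ g) :
    v = lft g := by
  by_contra hne
  rw [← ι_left hg, ← mul_assoc, ι_orth hne, zero_mul, ι_left hg] at h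
  exact ι_ne_zero hg h.symm

theorem eq_rgt {g : Gen c X} (hg : ∀ v, g ≠ e v) {v : Fin c} (h : γ g * γ (e v) = γ g) :
    v = rgt g := by
  by_contra hne
  rw [← ι_right hg, mul_assoc, ι_orth (Ne.symm hne), mul_zero, ι_right hg] at h
  exact ι_ne_zero hg h.symm

open Polynomial in
/-- An idempotent `h` of the form `u * e v * w * e v` with `u * w = 1` equals `e v`,
provided `e v * h = h`. -/
theorem eq_e_of_idempotent {u w : 𝔸} {v : Fin c} (huw : u * w = 1)
    (hl : γ (e v) * (u * γ (e v) * w * γ (e v)) = u * γ (e v) * w * γ (e v))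
    (hidem : (u * γ (e v) * w * γ (e v)) * (u * γ (e v) * w * γ (e v))
      = u * γ (e v) * w * γ (e v)) :
    u * γ (e v) * w * γ (e v) = γ (e v) := by
  classical
  -- The weight homomorphism recording word length.
  obtain ⟨Λ, hΛ⟩ := exists_lift (K := K) (lft := lft) (rgt := rgt) (B := 𝔸[X])
    (fun g => if ∃ v, g = e v then C (γ g) else C (γ g) * Polynomial.X)
    (by intro v; simp [← C_mul, ι_idem])
    (by intro v w h; simp [← C_mul, ι_orth h])
    (by simp [← map_sum, ι_total])
    (by
      intro g hg
      have : ¬ ∃ v, g = e v := by simpa using hg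
      simp [this, ← mul_assoc, ← C_mul, ι_left hg])
    (by
      intro g hg
      have : ¬ ∃ v, g = e v := by simpa using hg
      simp only [this, if_false, exists_apply_eq_apply', if_true]
      rw [mul_assoc, X_mul_C, ← mul_assoc, ← C_mul, ι_right hg])
  have hΛe : ∀ v, Λ (γ (e v)) = C (γ (e v)) := by intro v; simp [hΛ]
  have hev1 : ∀ a : 𝔸, (Λ a).eval 1 = a := by
    intro a
    induction a using A_induction with
    | halg a => rw [AlgHom.commutes, Polynomial.algebraMap_apply, eval_C]
    | hι g =>
      rw [hΛ]
      by_cases h : ∃ v, g = e v <;> simp [h]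
    | hmul a b ha hb =>
      rw [map_mul, eval, eval₂_mul_noncomm _ _ fun _ => Commute.one_right _]
      exact congrArg₂ (· * ·) ha hb
    | hadd a b ha hb => rw [map_add, eval_add, ha, hb]
  have hcomm : ∀ a : 𝔸, Commute (γ (e v)) ((Λ a).coeff 0) := by
    intro a
    induction a using A_induction with
    | halg a =>
      rw [AlgHom.commutes, Polynomial.algebraMap_apply, coeff_C_zero]
      exact Algebra.commute_algebraMap_right _ _
    | hι g =>
      by_cases h : ∃ v, g = e v
      · obtain ⟨v', rfl⟩ := h
        rw [hΛe, coeff_C_zero]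
        by_cases hv : v = v'
        · subst hv; exact Commute.refl _
        · rw [Commute, SemiconjBy, ι_orth hv, ι_orth (Ne.symm hv)]
      · rw [hΛ]; simp [h]
    | hmul a b ha hb => rw [map_mul, mul_coeff_zero]; exact ha.mul_right hb
    | hadd a b ha hb => rw [map_add, coeff_add]; exact ha.add_right hb
  set h := u * γ (e v) * w * γ (e v) with hh
  have hr : h * γ (e v) = h := by rw [hh, mul_assoc, ι_idem]
  set t := γ (e v) - h with ht
  have htt : t * t = t := by
    rw [ht, sub_mul, mul_sub, mul_sub, ι_idem, hl, hr, hidem]; abel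
  have h0 : (Λ t).coeff 0 = 0 := by
    have h1 : (Λ u).coeff 0 * (Λ w).coeff 0 = 1 := by
      rw [← mul_coeff_zero, ← map_mul, huw, map_one, coeff_one_zero]
    rw [ht, map_sub, coeff_sub, hh, map_mul, map_mul, map_mul, hΛe]
    simp only [mul_coeff_zero, coeff_C_zero]
    rw [mul_assoc, mul_assoc, ← (hcomm w).eq, ← mul_assoc (γ (e v)), ι_idem, (hcomm w).eq,
      ← mul_assoc, h1, one_mul, sub_self]
  have hidΛ : Λ t * Λ t = Λ t := by rw [← map_mul, htt]
  have hco : ∀ n, (Λ t).coeff n = 0 := by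
    intro n
    induction n using Nat.strong_induction_on with
    | _ n ih =>
      rw [← hidΛ, coeff_mul]
      refine Finset.sum_eq_zero fun ij hij => ?_
      rw [Finset.HasAntidiagonal.mem_antidiagonal] at hij
      rcases Nat.eq_zero_or_pos ij.1 with h1 | h1
      · rw [h1, h0, zero_mul]
      · rw [ih ij.2 (by omega), mul_zero]
  have hz : Λ t = 0 := Polynomial.ext fun n => by rw [hco, coeff_zero]
  have := hev1 t
  rw [hz, eval_zero] at this
  exact (sub_eq_zero.mp this.symm).symm

variable {degX : X → ℤ} {ds : ℤ}

theorem ι_mem_Hgr (g : Gen c X) :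
    γ g ∈ Hgr K c X lft rgt degX ds (dg c X degX ds g) :=
  Submodule.subset_span ⟨[g], by simp, by simp⟩

theorem one_mem_Hgr : (1 : 𝔸) ∈ Hgr K c X lft rgt degX ds 0 :=
  Submodule.subset_span ⟨[], by simp, by simp⟩

theorem mul_mem_Hgr {a b : ℤ} {u w : 𝔸} (hu : u ∈ Hgr K c X lft rgt degX ds a)
    (hw : w ∈ Hgr K c X lft rgt degX ds b) : u * w ∈ Hgr K c X lft rgt degX ds (a + b) := by
  have := Submodule.mul_mem_mul hu hw
  rw [Hgr, Hgr, Submodule.span_mul_span] at this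
  refine Submodule.span_mono ?_ this
  rintro _ ⟨_, ⟨l, rfl, rfl⟩, _, ⟨l', rfl, rfl⟩, rfl⟩
  exact ⟨l ++ l', by simp, by simp⟩

theorem leibniz_one {D : 𝔸 →ₗ[K] 𝔸}
    (hleib : ∀ (d : ℤ) (u w : 𝔸), u ∈ Hgr K c X lft rgt degX ds d →
      D (u * w) = D u * w + sgn K d • (u * D w)) : D 1 = 0 := by
  simpa [sgn] using hleib 0 1 1 one_mem_Hgr

theorem leibniz_e_mul {D : 𝔸 →ₗ[K] 𝔸}
    (hleib : ∀ (d : ℤ) (u w : 𝔸), u ∈ Hgr K c X lft rgt degX ds d →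
      D (u * w) = D u * w + sgn K d • (u * D w))
    (hk : ∀ v, D (γ (e v)) = 0) {g : Gen c X} (hg : ∀ v, g ≠ e v) :
    γ (e (lft g)) * D (γ g) = D (γ g) := by
  conv_rhs => rw [← ι_left hg, hleib 0 _ _ (ι_mem_Hgr (e (lft g))), hk]
  simp [sgn]

theorem leibniz_mul_e {D : 𝔸 →ₗ[K] 𝔸}
    (hleib : ∀ (d : ℤ) (u w : 𝔸), u ∈ Hgr K c X lft rgt degX ds d →
      D (u * w) = D u * w + sgn K d • (u * D w))
    (hk : ∀ v, D (γ (e v)) = 0) {g : Gen c X} (hg : ∀ v, g ≠ e v) :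
    D (γ g) * γ (e (rgt g)) = D (γ g) := by
  conv_rhs => rw [← ι_right hg, hleib _ _ _ (ι_mem_Hgr g), hk]
  simp

/-- A homomorphism fixing the generators of `A'` fixes `A'` pointwise. -/
theorem eq_self_of_mem_Asub {φ : 𝔸 →ₐ[K] 𝔸} (he : ∀ v, φ (γ (e v)) = γ (e v))
    (hx : ∀ g, φ (γ (x g)) = γ (x g)) {u : 𝔸} (hu : u ∈ Asub K c X lft rgt) : φ u = u := by
  have : Asub K c X lft rgt ≤ AlgHom.equalizer φ (AlgHom.id K 𝔸) := by
    refine Algebra.adjoin_le ?_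
    rintro _ (⟨v, rfl⟩ | ⟨g, rfl⟩)
    · exact he v
    · exact hx g
  exact this hu

/-- An endomorphism of `A` fixing the idempotents and `X` may be prescribed on `p, q, r, s`
by any values compatible with the bimodule structure. -/
theorem exists_endo (a b d t : 𝔸)
    (ha : γ (e (lft p)) * a = a) (ha' : a * γ (e (rgt p)) = a)
    (hb : γ (e (lft q)) * b = b) (hb' : b * γ (e (rgt q)) = b)
    (hd : γ (e (lft r)) * d = d) (hd' : d * γ (e (rgt r)) = d)
    (ht : γ (e (lft s)) * t = t) (ht' : t * γ (e (rgt s)) = t) :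
    ∃ φ : 𝔸 →ₐ[K] 𝔸, (∀ v, φ (γ (e v)) = γ (e v)) ∧ (∀ g, φ (γ (x g)) = γ (x g)) ∧
      φ (γ p) = a ∧ φ (γ q) = b ∧ φ (γ r) = d ∧ φ (γ s) = t := by
  obtain ⟨φ, hφ⟩ := exists_lift (K := K) (lft := lft) (rgt := rgt) (B := 𝔸)
    (fun g => match g with
      | e v => γ (e v)
      | x g => γ (x g)
      | p => a
      | q => b
      | r => d
      | s => t)
    ι_idem (fun _ _ => ι_orth) ι_total
    (by
      rintro (v | g | _ | _ | _ | _) h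
      · exact absurd rfl (h v)
      · exact ι_left h
      all_goals assumption)
    (by
      rintro (v | g | _ | _ | _ | _) h
      · exact absurd rfl (h v)
      · exact ι_right h
      all_goals assumption)
  exact ⟨φ, fun v => hφ _, fun g => hφ _, hφ _, hφ _, hφ _, hφ _⟩

/-- A homomorphism sending generators to homogeneous elements of the same degree intertwines
two graded derivations as soon as it does so on generators. -/
theorem intertwines {D D' : 𝔸 →ₗ[K] 𝔸}
    (hleib : ∀ (d : ℤ) (u w : 𝔸), u ∈ Hgr K c X lft rgt degX ds d →
      D (u * w) = D u * w + sgn K d • (u * D w))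
    (hleib' : ∀ (d : ℤ) (u w : 𝔸), u ∈ Hgr K c X lft rgt degX ds d →
      D' (u * w) = D' u * w + sgn K d • (u * D' w))
    {φ : 𝔸 →ₐ[K] 𝔸} (hφ : ∀ g, φ (γ g) ∈ Hgr K c X lft rgt degX ds (dg c X degX ds g))
    (hgen : ∀ g, D (φ (γ g)) = φ (D' (γ g))) (u : 𝔸) : D (φ u) = φ (D' u) := by
  suffices h : ∀ w, D (φ w) = φ (D' w) → D (φ (u * w)) = φ (D' (u * w)) by
    simpa using h 1 (by rw [map_one, leibniz_one hleib, leibniz_one hleib', map_zero])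
  induction u using A_induction with
  | halg a =>
    intro w hw
    simp only [← Algebra.smul_def, map_smul, hw]
  | hι g =>
    intro w hw
    rw [map_mul, hleib _ _ _ (hφ g), hleib' _ _ _ (ι_mem_Hgr g), hgen, hw]
    simp
  | hmul u v hu hv =>
    intro w hw
    rw [mul_assoc]
    exact hu _ (hv _ hw)
  | hadd u v hu hv =>
    intro w hw
    simp only [add_mul, map_add, hu w hw, hv w hw]

end

end Destab2

open Destab2 Destab2.Gen

/-- Given invertible degree-0 cycles `z, z'` in `A'` and a square-zero
degree `+1` graded derivation `∂` on `A` stabilising `A'` with `∂p = zq + rz'`,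
`∂q = sz'`, `∂r = −zs`, `∂s = 0`, the algebra endomorphism `φ` of `A` fixing the
generators of `X` as well as `p`, `r` and sending `q ↦ zq + rz'`, `s ↦ zs` is an
automorphism satisfying `∂ ∘ φ = φ ∘ ∂'`, where `∂'` agrees with `∂` on `A'` and has
`∂'p = q`, `∂'q = 0`, `∂'r = −s`, `∂'s = 0`.  Consequently `(A, ∂)` and `(A, ∂')` are
isomorphic DG-algebras. -/
theorem statement8 (K : Type) [Field K] (c : ℕ) (hc : 1 ≤ c) (X : Type)
    (lft rgt : Gen c X → Fin c) (degX : X → ℤ) (ds : ℤ)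
    (z zi z' z'i : A K c X lft rgt)
    -- `z, z'` are invertible degree-0 elements of `A'`:
    (hzA : z ∈ Asub K c X lft rgt) (hziA : zi ∈ Asub K c X lft rgt)
    (hz'A : z' ∈ Asub K c X lft rgt) (hz'iA : z'i ∈ Asub K c X lft rgt)
    (hz0 : z ∈ Hgr K c X lft rgt degX ds 0) (hz'0 : z' ∈ Hgr K c X lft rgt degX ds 0)
    (hz : z * zi = 1) (hz' : zi * z = 1) (hw : z' * z'i = 1) (hw' : z'i * z' = 1)
    (D D' : A K c X lft rgt →ₗ[K] A K c X lft rgt)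
    -- `∂` is a square-zero degree `+1` graded derivation vanishing on `k`:
    (hk : ∀ v, D (ι K c X lft rgt (e v)) = 0)
    (hleib : ∀ (d : ℤ) (u w : A K c X lft rgt), u ∈ Hgr K c X lft rgt degX ds d →
      D (u * w) = D u * w + sgn K d • (u * D w))
    (hdeg : ∀ (d : ℤ) (u : A K c X lft rgt), u ∈ Hgr K c X lft rgt degX ds d →
      D u ∈ Hgr K c X lft rgt degX ds (d + 1))
    (hsq : ∀ u, D (D u) = 0)
    -- `∂` maps `A'` into itself and kills the cycles `z, z'`:
    (hA' : ∀ u ∈ Asub K c X lft rgt, D u ∈ Asub K c X lft rgt)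
    (hDz : D z = 0) (hDz' : D z' = 0)
    -- the values of `∂` on `p, q, r, s`:
    (hDp : D (ι K c X lft rgt p) = z * ι K c X lft rgt q + ι K c X lft rgt r * z')
    (hDq : D (ι K c X lft rgt q) = ι K c X lft rgt s * z')
    (hDr : D (ι K c X lft rgt r) = -(z * ι K c X lft rgt s))
    (hDs : D (ι K c X lft rgt s) = 0)
    -- `∂'` is a graded derivation vanishing on `k`, agreeing with `∂` on `A'`:
    (hk' : ∀ v, D' (ι K c X lft rgt (e v)) = 0)
    (hleib' : ∀ (d : ℤ) (u w : A K c X lft rgt), u ∈ Hgr K c X lft rgt degX ds d →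
      D' (u * w) = D' u * w + sgn K d • (u * D' w))
    (hagr : ∀ u ∈ Asub K c X lft rgt, D' u = D u)
    -- the values of `∂'` on `p, q, r, s`:
    (hD'p : D' (ι K c X lft rgt p) = ι K c X lft rgt q)
    (hD'q : D' (ι K c X lft rgt q) = 0)
    (hD'r : D' (ι K c X lft rgt r) = -ι K c X lft rgt s)
    (hD's : D' (ι K c X lft rgt s) = 0) :
    ∃ φ : A K c X lft rgt →ₐ[K] A K c X lft rgt,
      (∀ v, φ (ι K c X lft rgt (e v)) = ι K c X lft rgt (e v)) ∧
      (∀ g : X, φ (ι K c X lft rgt (x g)) = ι K c X lft rgt (x g)) ∧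
      (φ (ι K c X lft rgt p) = ι K c X lft rgt p) ∧
      (φ (ι K c X lft rgt r) = ι K c X lft rgt r) ∧
      (φ (ι K c X lft rgt q) = z * ι K c X lft rgt q + ι K c X lft rgt r * z') ∧
      (φ (ι K c X lft rgt s) = z * ι K c X lft rgt s) ∧
      Function.Bijective φ ∧
      (∀ u, D (φ u) = φ (D' u)) := by
  have np : ∀ v, (p : Gen c X) ≠ e v := fun v => nofun
  have nq : ∀ v, (q : Gen c X) ≠ e v := fun v => nofun
  have nr : ∀ v, (r : Gen c X) ≠ e v := fun v => nofun
  have ns : ∀ v, (s : Gen c X) ≠ e v := fun v => nofun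
  -- The generators `p, q, r, s` share their left idempotent.
  have lpq : lft p = lft q := eq_lft nq (by
    have := leibniz_e_mul hleib' hk' np
    rwa [hD'p] at this)
  have rpq : rgt p = rgt q := eq_rgt nq (by
    have := leibniz_mul_e hleib' hk' np
    rwa [hD'p] at this)
  have lrs : lft r = lft s := eq_lft ns (by
    have := leibniz_e_mul hleib' hk' nr
    rwa [hD'r, A_mul_neg, neg_inj] at this)
  have rrs : rgt r = rgt s := eq_rgt ns (by
    have := leibniz_mul_e hleib' hk' nr
    rwa [hD'r, A_neg_mul, neg_inj] at this)
  have lqs : lft q = lft s := eq_lft ns (by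
    have := leibniz_e_mul hleib hk nq
    rw [hDq] at this
    have := congrArg (· * z'i) this
    simpa only [mul_assoc, hw, mul_one] using this)
  have hpl := leibniz_e_mul hleib hk np
  have hpr := leibniz_mul_e hleib hk np
  have hrl := leibniz_e_mul hleib hk nr
  have hrr := leibniz_mul_e hleib hk nr
  rw [hDp, lpq] at hpl
  rw [hDp, rpq] at hpr
  rw [hDr, A_mul_neg, neg_inj, lrs] at hrl
  rw [hDr, A_neg_mul, neg_inj, rrs] at hrr
  obtain ⟨φ, φe, φx, φp, φq, φr, φs⟩ := exists_endo (K := K) (lft := lft) (rgt := rgt)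
    (ι K c X lft rgt p) (z * ι K c X lft rgt q + ι K c X lft rgt r * z')
    (ι K c X lft rgt r) (z * ι K c X lft rgt s)
    (ι_left np) (ι_right np) hpl hpr (ι_left nr) (ι_right nr) hrl hrr
  have φA := fun {u} => eq_self_of_mem_Asub (u := u) φe φx
  refine ⟨φ, φe, φx, φp, φr, φq, φs, ?_, ?_⟩
  · have hel := ι_left (K := K) (lft := lft) (rgt := rgt) ns
    have heq := ι_left (K := K) (lft := lft) (rgt := rgt) nq
    have her := ι_left (K := K) (lft := lft) (rgt := rgt) nr
    rw [lqs] at heq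
    rw [lrs] at her
    have hqr := ι_right (K := K) (lft := lft) (rgt := rgt) nq
    have hsr := ι_right (K := K) (lft := lft) (rgt := rgt) ns
    have hee := ι_idem (K := K) (lft := lft) (rgt := rgt) (lft s)
    have hrz : ι K c X lft rgt r * z' * ι K c X lft rgt (e (rgt q)) = ι K c X lft rgt r * z' := by
      rw [add_mul, mul_assoc z, hqr] at hpr
      exact add_left_cancel hpr
    have hze : ι K c X lft rgt (e (lft s)) * z * ι K c X lft rgt (e (lft s))
        = z * ι K c X lft rgt (e (lft s)) := by
      have := mul_e_eq_zero_of_mul_ι_eq_zero (y := ι K c X lft rgt (e (lft s)) * z - z) ns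
        (by rw [sub_mul, mul_assoc, hrl, sub_self])
      rwa [sub_mul, sub_eq_zero] at this
    have hφe := φe (lft s)
    set ε := ι K c X lft rgt (e (lft s)) with hε
    have hh : z * ε * zi * ε = ε := by
      refine eq_e_of_idempotent hz ?_ ?_
      · rw [← hε, ← mul_assoc, ← mul_assoc, ← mul_assoc, hze]
      · rw [← hε]
        calc z * ε * zi * ε * (z * ε * zi * ε)
            = z * ε * zi * (ε * z * ε) * zi * ε := by simp only [mul_assoc]
          _ = z * ε * (zi * z) * ε * zi * ε := by rw [hze]; simp only [mul_assoc]
          _ = z * (ε * ε) * zi * ε := by rw [hz', mul_one]; simp only [mul_assoc]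
          _ = z * ε * zi * ε := by rw [hee]
    have hcancel : ∀ y, ε * y = y → z * (ε * (zi * y)) = y := by
      intro y hy
      calc z * (ε * (zi * y)) = z * ε * zi * ε * y := by
            conv_lhs => rw [← hy]
            simp only [mul_assoc]
        _ = y := by rw [hh, hy]
    obtain ⟨ψ, ψe, ψx, ψp, ψq, ψr, ψs⟩ := exists_endo (K := K) (lft := lft) (rgt := rgt)
      (ι K c X lft rgt p) (ε * (zi * (ι K c X lft rgt q - ι K c X lft rgt r * z')))
      (ι K c X lft rgt r) (ε * (zi * ι K c X lft rgt s))
      (ι_left np) (ι_right np)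
      (by rw [lqs, ← hε, ← mul_assoc, hee])
      (by rw [mul_assoc, mul_assoc, sub_mul, hqr, hrz])
      (ι_left nr) (ι_right nr)
      (by rw [← hε, ← mul_assoc, hee])
      (by rw [mul_assoc, mul_assoc, hsr])
    have ψA := fun {u} => eq_self_of_mem_Asub (u := u) ψe ψx
    have h1 : φ.comp ψ = AlgHom.id K _ := by
      refine A_hom_ext ?_
      rintro (v | g | _ | _ | _ | _) <;> simp only [AlgHom.comp_apply, AlgHom.id_apply]
      · rw [ψe, φe]
      · rw [ψx, φx]
      · rw [ψp, φp]
      · rw [ψq, map_mul, map_mul, map_sub, map_mul, hφe, φA hziA, φq, φr, φA hz'A,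
          add_sub_cancel_right, ← mul_assoc zi, hz', one_mul, heq]
      · rw [ψr, φr]
      · rw [ψs, map_mul, map_mul, hφe, φA hziA, φs, ← mul_assoc zi, hz', one_mul, hel]
    have h2 : ψ.comp φ = AlgHom.id K _ := by
      refine A_hom_ext ?_
      rintro (v | g | _ | _ | _ | _) <;> simp only [AlgHom.comp_apply, AlgHom.id_apply]
      · rw [φe, ψe]
      · rw [φx, ψx]
      · rw [φp, ψp]
      · rw [φq, map_add, map_mul, map_mul, ψA hzA, ψA hz'A, ψq, ψr,
          hcancel _ (by rw [mul_sub, heq, ← mul_assoc, her]), sub_add_cancel]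
      · rw [φr, ψr]
      · rw [φs, map_mul, ψA hzA, ψs, hcancel _ hel]
    exact Function.bijective_iff_has_inverse.mpr
      ⟨ψ, fun u => DFunLike.congr_fun h2 u, fun u => DFunLike.congr_fun h1 u⟩
  · refine intertwines hleib hleib' ?_ ?_
    · rintro (v | g | _ | _ | _ | _)
      · rw [φe]; exact ι_mem_Hgr _
      · rw [φx]; exact ι_mem_Hgr _
      · rw [φp]; exact ι_mem_Hgr _
      · rw [φq]
        refine add_mem ?_ ?_
        · simpa [dg] using mul_mem_Hgr hz0 (ι_mem_Hgr q)
        · simpa [dg] using mul_mem_Hgr (ι_mem_Hgr r) hz'0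
      · rw [φr]; exact ι_mem_Hgr _
      · rw [φs]
        simpa [dg] using mul_mem_Hgr hz0 (ι_mem_Hgr s)
    · rintro (v | g | _ | _ | _ | _)
      · rw [φe, hk, hk', map_zero]
      · have hg : ι K c X lft rgt (x g) ∈ Asub K c X lft rgt :=
          Algebra.subset_adjoin (Or.inr ⟨g, rfl⟩)
        rw [φx, hagr _ hg, φA (hA' _ hg)]
      · rw [φp, hDp, hD'p, φq]
      · rw [φq, hD'q, map_zero, map_add, hleib 0 _ _ hz0, hleib _ _ _ (ι_mem_Hgr r), hDz, hDz',
          hDq, hDr]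
        simp [sgn, mul_assoc, A_neg_mul]
      · rw [φr, hDr, hD'r, map_neg, φs]
      · rw [φs, hD's, map_zero, hleib 0 _ _ hz0, hDz, hDs]
        simp
end
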